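/- arXiv:1102.4250 — 3 statements merged into one kernel-verified Lean document; each statement's English description precedes it below -/
import Mathlib

section
/- Let n ≥ 3 and let R = O(V_n)^{SL(2,ℂ)} be the algebra of SL(2,ℂ)-invariant polynomial functions on the space V_n of binary forms of degree n. If the minimal number r of algebra generators of R satisfies r − (n − 2) ≤ 100 (i.e., the homological dimension hd R = r − (n−2) of R is at most 100), then n ≤ 10. -/
open MvPolynomial

noncomputable section

namespace BinInv

/-- `k`-fold partial derivative with respect to the variable `v`. -/
def pd {A : Type*} [CommSemiring A] (v : Fin 2) (k : ℕ)
    (f : MvPolynomial (Fin 2) A) : MvPolynomial (Fin 2) A :=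
  (fun g => MvPolynomial.pderiv v g)^[k] f

/-- The `p`-th transvectant of binary forms `g`, `h` of degrees `m`, `n`,
with coefficients in a commutative `ℂ`-algebra `A`. -/
def transvectant {A : Type*} [CommRing A] [Algebra ℂ A] (m n p : ℕ)
    (g h : MvPolynomial (Fin 2) A) : MvPolynomial (Fin 2) A :=
  algebraMap ℂ (MvPolynomial (Fin 2) A)
      ((((m - p).factorial * (n - p).factorial : ℕ) : ℂ) /
        (((m.factorial * n.factorial : ℕ)) : ℂ)) *
    ∑ i ∈ Finset.range (p + 1),
      algebraMap ℂ (MvPolynomial (Fin 2) A) ((-1 : ℂ) ^ i * (p.choose i : ℂ)) *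
        (pd 0 (p - i) (pd 1 i g) * pd 0 i (pd 1 (p - i) h))

variable {p : ℕ}

/-- Index type for the coefficients of a system of binary forms of degrees `n 0, …, n (p-1)`:
the space `V = V_{n 0} ⊕ … ⊕ V_{n (p-1)}` is identified with `Idx n → ℂ`. -/
abbrev Idx (n : Fin p → ℕ) : Type := Σ i : Fin p, Fin (n i + 1)

/-- The binary form of degree `n i` with coefficient vector `c`. -/
def formAt (n : Fin p → ℕ) (c : Idx n → ℂ) (i : Fin p) : MvPolynomial (Fin 2) ℂ :=
  ∑ k : Fin (n i + 1), C (c ⟨i, k⟩) * X 0 ^ (n i - (k : ℕ)) * X 1 ^ (k : ℕ)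

/-- The substitution action of `SL(2,ℂ)` on binary forms: `(g • f)(v) = f (g⁻¹ • v)`. -/
def sl2Act (g : Matrix.SpecialLinearGroup (Fin 2) ℂ) (f : MvPolynomial (Fin 2) ℂ) :
    MvPolynomial (Fin 2) ℂ :=
  aeval (fun i => ∑ j, C ((↑(g⁻¹) : Matrix (Fin 2) (Fin 2) ℂ) i j) * X j) f

/-- The coefficient of `x^(n-k) y^k` in a binary form. -/
def coeffAt (n : Fin p → ℕ) (j : Idx n) (f : MvPolynomial (Fin 2) ℂ) : ℂ :=
  MvPolynomial.coeff
    (Finsupp.single 0 (n j.1 - (j.2 : ℕ)) + Finsupp.single 1 (j.2 : ℕ)) f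

/-- The induced action of `SL(2,ℂ)` on points of `V`, in coefficient coordinates. -/
def actPt (n : Fin p → ℕ) (g : Matrix.SpecialLinearGroup (Fin 2) ℂ) (c : Idx n → ℂ) :
    Idx n → ℂ :=
  fun j => coeffAt n j (sl2Act g (formAt n c j.1))

/-- A polynomial function on `V` is invariant if it is constant on `SL(2,ℂ)`-orbits. -/
def IsInvariant (n : Fin p → ℕ) (P : MvPolynomial (Idx n) ℂ) : Prop :=
  ∀ (g : Matrix.SpecialLinearGroup (Fin 2) ℂ) (c : Idx n → ℂ),
    eval (actPt n g c) P = eval c P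

/-- The invariant ring `R = O(V)^{SL(2,ℂ)}` as a subalgebra of `O(V)`. -/
def invariantRing (n : Fin p → ℕ) : Subalgebra ℂ (MvPolynomial (Idx n) ℂ) where
  carrier := {P | IsInvariant n P}
  mul_mem' := fun ha hb g c => by
    simp only [map_mul]; rw [ha g c, hb g c]
  one_mem' := fun g c => by simp
  add_mem' := fun ha hb g c => by
    simp only [map_add]; rw [ha g c, hb g c]
  zero_mem' := fun g c => by simp
  algebraMap_mem' := fun r g c => by simp

/-- The nullcone: the points of `V` where every homogeneous invariant of positive
degree vanishes. -/
def Nullcone (n : Fin p → ℕ) : Set (Idx n → ℂ) :=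
  {c | ∀ P ∈ invariantRing n, ∀ d : ℕ, 0 < d → P.IsHomogeneous d → eval c P = 0}

/-- `P` is a homogeneous system of parameters of the invariant ring, with degrees `d`:
the `P j` are homogeneous invariants of positive degrees `d j`, algebraically independent
over `ℂ`, and the invariant ring is integral over the subalgebra they generate. -/
def IsHSOP (n : Fin p → ℕ) {k : ℕ} (P : Fin k → MvPolynomial (Idx n) ℂ)
    (d : Fin k → ℕ) : Prop :=
  (∀ j, P j ∈ invariantRing n) ∧ (∀ j, 0 < d j) ∧
    (∀ j, (P j).IsHomogeneous (d j)) ∧ AlgebraicIndependent ℂ P ∧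
    ∀ x ∈ invariantRing n, IsIntegral (↥(Algebra.adjoin ℂ (Set.range P))) x

/-- `r` is the minimal number of generators of the invariant ring. -/
def IsMinimalNumGens (n : Fin p → ℕ) (r : ℕ) : Prop :=
  IsLeast {k | ∃ S : Finset (MvPolynomial (Idx n) ℂ),
    S.card = k ∧ Algebra.adjoin ℂ (S : Set (MvPolynomial (Idx n) ℂ)) = invariantRing n} r

/-- The invariant ring has minimal number of generators `r`, realized by a minimal
system of homogeneous generators of degrees `d 0, …, d (r-1)`. -/
def HasMinimalGens (n : Fin p → ℕ) {r : ℕ} (d : Fin r → ℕ) : Prop :=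
  IsMinimalNumGens n r ∧
    ∃ G : Fin r → MvPolynomial (Idx n) ℂ, Function.Injective G ∧
      (∀ j, (G j).IsHomogeneous (d j)) ∧
      Algebra.adjoin ℂ (Set.range G) = invariantRing n

/-- The generic binary form of degree `n i`, whose coefficients are the corresponding
coordinate functions on `V`. -/
def genForm (n : Fin p → ℕ) (i : Fin p) :
    MvPolynomial (Fin 2) (MvPolynomial (Idx n) ℂ) :=
  ∑ k : Fin (n i + 1), C (X ⟨i, k⟩) * X 0 ^ (n i - (k : ℕ)) * X 1 ^ (k : ℕ)

end BinInv

end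

noncomputable section

namespace BinForm

/-- Polynomial functions on binary forms of degree `n`; `X i` is the coefficient of
`x ^ (n - i) * y ^ i`. -/
abbrev Poly (n : ℕ) : Type := MvPolynomial (Fin (n + 1)) ℂ

/-- The bidegree (degree, torus weight) of the coordinates. -/
def wt (n : ℕ) (i : Fin (n + 1)) : ℤ × ℤ := (1, 2 * (i : ℤ) - n)

/-- The `j`-th coordinate, extended by zero beyond the range of indices. -/
def var (n j : ℕ) : Poly n := if h : j < n + 1 then X ⟨j, h⟩ else 0

/-- The raising operator. -/
def up (n : ℕ) : Derivation ℂ (Poly n) (Poly n) :=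
  mkDerivation ℂ fun i => ((i : ℂ) + 1) • var n (i + 1)

/-- The lowering operator. -/
def down (n : ℕ) : Derivation ℂ (Poly n) (Poly n) :=
  mkDerivation ℂ fun i => if 0 < (i : ℕ) then ((n : ℂ) - i + 1) • var n (i - 1) else 0

/-- Polynomials of bidegree `(d, w)`. -/
abbrev W (n : ℕ) (d w : ℤ) : Submodule ℂ (Poly n) :=
  weightedHomogeneousSubmodule ℂ (wt n) (d, w)

theorem derivation_mem_weighted {σ M : Type*} [AddCommGroup M] {w : σ → M} {δ : M}
    (D : Derivation ℂ (MvPolynomial σ ℂ) (MvPolynomial σ ℂ))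
    (hD : ∀ i, (D (X i)).IsWeightedHomogeneous w (w i + δ)) {p : MvPolynomial σ ℂ} {m : M}
    (hp : p.IsWeightedHomogeneous w m) : (D p).IsWeightedHomogeneous w (m + δ) := by
  induction hp using IsWeightedHomogeneous.induction_on with
  | zero => simpa using isWeightedHomogeneous_zero ℂ w (m + δ)
  | add a b ha hb ha' hb' => simpa using ha'.add hb'
  | monomial d r hd =>
    have e : D = mkDerivation ℂ fun i => D (X i) := derivation_ext fun i => by simp
    rw [e, mkDerivation_monomial, ← mem_weightedHomogeneousSubmodule]
    refine Submodule.smul_mem _ _ (Submodule.sum_mem _ fun i hi => ?_)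
    simp only [smul_eq_mul]
    rw [mem_weightedHomogeneousSubmodule,
      show m + δ = (m - w i) + (w i + δ) by abel]
    refine IsWeightedHomogeneous.mul (isWeightedHomogeneous_monomial _ _ _ ?_) (hD i)
    rw [eq_sub_iff_add_eq, ← hd, Finsupp.weight_sub_single_add (Finsupp.mem_support_iff.1 hi)]

theorem var_coe (n : ℕ) (i : Fin (n + 1)) : var n i = X i := by
  rw [var, dif_pos i.2]

theorem up_var (n j : ℕ) : up n (var n j) = ((j : ℂ) + 1) • var n (j + 1) := by
  by_cases h : j < n + 1
  · conv_lhs => rw [var, dif_pos h, up, mkDerivation_X]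
  · have h' : ¬ j + 1 < n + 1 := by omega
    rw [var, dif_neg h, var, dif_neg h', map_zero, smul_zero]

theorem down_var_zero (n : ℕ) : down n (var n 0) = 0 := by
  simp [var, down, mkDerivation_X]

theorem down_var_succ (n j : ℕ) : down n (var n (j + 1)) = ((n : ℂ) - j) • var n j := by
  by_cases h : j + 1 < n + 1
  · conv_lhs => rw [var, dif_pos h, down, mkDerivation_X]
    rw [if_pos (Nat.succ_pos j)]
    simp only [Nat.add_sub_cancel]
    congr 1
    push_cast
    ring
  · rw [var, dif_neg h, map_zero]
    by_cases hj : j = n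
    · simp [hj]
    · rw [var, dif_neg (by omega), smul_zero]

theorem up_lie_down_var (n j : ℕ) :
    up n (down n (var n j)) - down n (up n (var n j)) = (2 * (j : ℂ) - n) • var n j := by
  rw [up_var, Derivation.map_smul, down_var_succ, smul_smul]
  cases j with
  | zero => simp [down_var_zero]
  | succ j =>
    rw [down_var_succ, Derivation.map_smul, up_var, smul_smul, ← sub_smul]
    congr 1
    push_cast
    ring

theorem lie_eq (n : ℕ) : ⁅up n, down n⁆ =
    mkDerivation ℂ fun i : Fin (n + 1) => ((2 * (i : ℂ) - n) • X i : Poly n) := by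
  refine derivation_ext fun i => ?_
  rw [Derivation.commutator_apply, mkDerivation_X, ← var_coe, up_lie_down_var]

theorem weight_wt (n : ℕ) (m : Fin (n + 1) →₀ ℕ) :
    Finsupp.weight (wt n) m = (((m.sum fun _ k => k : ℕ) : ℤ),
      m.sum fun i k => (k : ℤ) * (2 * (i : ℤ) - n)) := by
  simp only [Finsupp.weight_apply, Finsupp.sum, wt]
  ext <;> simp [Prod.fst_sum, Prod.snd_sum]

theorem lie_apply_of_mem {n : ℕ} {d w : ℤ} {p : Poly n} (hp : p ∈ W n d w) :
    up n (down n p) - down n (up n p) = (w : ℂ) • p := by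
  rw [← Derivation.commutator_apply, lie_eq]
  rw [mem_weightedHomogeneousSubmodule] at hp
  induction hp using IsWeightedHomogeneous.induction_on with
  | zero => simp
  | add a b ha hb ha' hb' => rw [map_add, ha', hb', smul_add]
  | monomial m r hm =>
    rw [mkDerivation_monomial]
    have hw : w = m.sum fun i k => (k : ℤ) * (2 * (i : ℤ) - n) := by
      rw [weight_wt] at hm
      exact (congrArg Prod.snd hm).symm
    have : ∀ i ∈ m.support, (monomial (m - Finsupp.single i 1)) ((m i : ℕ) : ℂ) •
        ((2 * (i : ℂ) - n) • X i : Poly n) = ((m i : ℂ) * (2 * (i : ℂ) - n)) • monomial m 1 := by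
      intro i hi
      rw [smul_eq_mul, mul_smul_comm, X, monomial_mul, mul_one, smul_monomial, smul_monomial,
        Finsupp.sub_add_single_one_cancel (Finsupp.mem_support_iff.1 hi)]
      refine congrArg (monomial m) ?_
      simp only [smul_eq_mul, mul_one]
      ring
    rw [Finsupp.sum, Finset.sum_congr rfl this, ← Finset.sum_smul, smul_smul, smul_monomial,
      smul_monomial, hw, Finsupp.sum]
    congr 1
    push_cast
    simp only [smul_eq_mul, mul_one]
    ring

theorem var_mem (n j : ℕ) : var n j ∈ W n 1 (2 * (j : ℤ) - n) := by
  by_cases h : j < n + 1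
  · rw [var, dif_pos h]
    exact isWeightedHomogeneous_X ℂ (wt n) ⟨j, h⟩
  · rw [var, dif_neg h]
    exact zero_mem _

theorem up_mem {n : ℕ} {d w : ℤ} {p : Poly n} (hp : p ∈ W n d w) : up n p ∈ W n d (w + 2) := by
  have := derivation_mem_weighted (w := wt n) (δ := (0, 2)) (up n) (fun i => ?_) hp
  · simpa using this
  · have h := Submodule.smul_mem _ ((i : ℂ) + 1) (var_mem n (i + 1))
    rw [← up_var, var_coe] at h
    have e : wt n i + (0, 2) = (1, 2 * ((i + 1 : ℕ) : ℤ) - n) := by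
      simp only [wt, Prod.mk_add_mk, Nat.cast_add, Nat.cast_one, add_zero]
      ring_nf
    rw [e]
    exact h

theorem down_mem {n : ℕ} {d w : ℤ} {p : Poly n} (hp : p ∈ W n d w) :
    down n p ∈ W n d (w - 2) := by
  have := derivation_mem_weighted (w := wt n) (δ := (0, -2)) (down n) (fun i => ?_) hp
  · simpa [sub_eq_add_neg] using this
  · rw [← var_coe]
    rcases Nat.eq_zero_or_pos (i : ℕ) with h0 | h0
    · rw [h0, down_var_zero]
      exact isWeightedHomogeneous_zero _ _ _
    · obtain ⟨j, hj⟩ := Nat.exists_eq_succ_of_ne_zero h0.ne'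
      rw [hj, Nat.succ_eq_add_one, down_var_succ]
      have e : wt n i + (0, -2) = (1, 2 * (j : ℤ) - n) := by
        simp only [wt, Prod.mk_add_mk, add_zero, hj, Nat.succ_eq_add_one, Nat.cast_add,
          Nat.cast_one]
        ring_nf
      rw [e]
      exact Submodule.smul_mem _ _ (var_mem n j)

theorem eq_zero_of_chain {M : Type*} [AddCommGroup M] [Module ℂ M] (E F : M →ₗ[ℂ] M) (v : M)
    (hH : ∀ k : ℕ, E (F (F^[k] v)) = F (E (F^[k] v)) + (-2 - 2 * (k : ℂ)) • F^[k] v)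
    (h0 : F (E v) = 0) {K : ℕ} (hK : F^[K] v = 0) : v = 0 := by
  have h1 : ∀ k : ℕ, F (E (F^[k] v)) = (-(k * (k + 1)) : ℂ) • F^[k] v := by
    intro k
    induction k with
    | zero => simpa using h0
    | succ k ih =>
      rw [Function.iterate_succ_apply', hH, ih, ← add_smul, map_smul]
      congr 1
      push_cast
      ring
  induction K with
  | zero => exact hK
  | succ K ih =>
    refine ih ?_
    rw [Function.iterate_succ_apply'] at hK
    have h2 := hH K
    rw [hK, map_zero, h1, ← add_smul] at h2
    refine (smul_eq_zero.1 h2.symm).resolve_left ?_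
    have : (-(K * (K + 1)) + (-2 - 2 * K) : ℂ) = -(((K + 1) * (K + 2) : ℕ) : ℂ) := by
      push_cast
      ring
    rw [this]
    exact neg_ne_zero.2 (Nat.cast_ne_zero.2 (by positivity))

theorem weight_bound {n : ℕ} {d w : ℤ} {m : Fin (n + 1) →₀ ℕ}
    (hm : Finsupp.weight (wt n) m = (d, w)) : w ≤ n * d ∧ -(n * d) ≤ w := by
  rw [weight_wt] at hm
  have h1 := congrArg Prod.fst hm
  have h2 := congrArg Prod.snd hm
  simp only [Finsupp.sum] at h1 h2
  push_cast at h1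
  rw [← h1, ← h2, Finset.mul_sum, ← Finset.sum_neg_distrib]
  constructor <;> refine Finset.sum_le_sum fun i _ => ?_
  · have : (i : ℤ) ≤ n := by exact_mod_cast Nat.lt_succ_iff.1 i.2
    nlinarith [Int.natCast_nonneg (m i)]
  · have : (0 : ℤ) ≤ (i : ℕ) := by positivity
    nlinarith [Int.natCast_nonneg (m i)]

theorem eq_zero_of_mem {n : ℕ} {d w : ℤ} {p : Poly n} (hp : p ∈ W n d w)
    (h : n * d < w ∨ w < -(n * d)) : p = 0 := by
  refine IsWeightedHomogeneous.eq_zero_of_no_monomials hp fun m hm => ?_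
  have := weight_bound hm
  omega

theorem up_iterate_mem {n : ℕ} {d w : ℤ} {p : Poly n} (hp : p ∈ W n d w) (k : ℕ) :
    (up n)^[k] p ∈ W n d (w + 2 * k) := by
  induction k with
  | zero => simpa using hp
  | succ k ih =>
    rw [Function.iterate_succ_apply']
    convert up_mem ih using 2
    push_cast
    ring

theorem down_iterate_mem {n : ℕ} {d w : ℤ} {p : Poly n} (hp : p ∈ W n d w) (k : ℕ) :
    (down n)^[k] p ∈ W n d (w - 2 * k) := by
  induction k with
  | zero => simpa using hp
  | succ k ih =>
    rw [Function.iterate_succ_apply']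
    convert down_mem ih using 2
    push_cast
    ring

theorem eq_zero_of_down_up {n : ℕ} {d : ℤ} {p : Poly n} (hp : p ∈ W n d (-2))
    (h : down n (up n p) = 0) : p = 0 := by
  refine eq_zero_of_chain (up n : Poly n →ₗ[ℂ] Poly n) (down n : Poly n →ₗ[ℂ] Poly n) p
    (fun k => ?_) h (K := (n * d).natAbs + 1) ?_
  · have := lie_apply_of_mem (down_iterate_mem hp k)
    push_cast at this
    exact sub_eq_iff_eq_add'.1 this
  · refine eq_zero_of_mem (down_iterate_mem hp _) (Or.inr ?_)
    have := neg_abs_le ((n : ℤ) * d)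
    have := le_abs_self ((n : ℤ) * d)
    push_cast
    omega

theorem eq_zero_of_up_down {n : ℕ} {d : ℤ} {p : Poly n} (hp : p ∈ W n d 2)
    (h : up n (down n p) = 0) : p = 0 := by
  refine eq_zero_of_chain (down n : Poly n →ₗ[ℂ] Poly n) (up n : Poly n →ₗ[ℂ] Poly n) p
    (fun k => ?_) h (K := (n * d).natAbs + 1) ?_
  · have := lie_apply_of_mem (up_iterate_mem hp k)
    push_cast at this
    have e : (-2 - 2 * (k : ℂ)) = -(2 + 2 * k) := by ring
    rw [e, neg_smul]
    change down n (up n _) = up n (down n _) + -((2 + 2 * (k : ℂ)) • (up n)^[k] p)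
    rw [← this, neg_sub]
    exact (add_sub_cancel _ _).symm
  · refine eq_zero_of_mem (up_iterate_mem hp _) (Or.inl ?_)
    have := neg_abs_le ((n : ℤ) * d)
    have := le_abs_self ((n : ℤ) * d)
    push_cast
    omega

/-- The space of invariants of degree `d`. -/
def Inv (n d : ℕ) : Submodule ℂ (Poly n) :=
  W n d 0 ⊓ LinearMap.ker (up n : Poly n →ₗ[ℂ] Poly n) ⊓
    LinearMap.ker (down n : Poly n →ₗ[ℂ] Poly n)

theorem mem_Inv {n d : ℕ} {p : Poly n} :
    p ∈ Inv n d ↔ p ∈ W n d 0 ∧ up n p = 0 ∧ down n p = 0 := by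
  simp only [Inv, Submodule.mem_inf, LinearMap.mem_ker, and_assoc]
  rfl

theorem mem_Inv_of_down {n d : ℕ} {p : Poly n} (hp : p ∈ W n d 0) (h : down n p = 0) :
    p ∈ Inv n d := by
  refine mem_Inv.2 ⟨hp, ?_, h⟩
  have h1 := up_mem hp
  refine eq_zero_of_up_down (by simpa using h1) ?_
  have h2 := lie_apply_of_mem hp
  have : down n (up n p) = 0 := by simpa [h] using h2
  rw [this, map_zero]

theorem mem_Inv_of_up {n d : ℕ} {p : Poly n} (hp : p ∈ W n d 0) (h : up n p = 0) :
    p ∈ Inv n d := by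
  refine mem_Inv.2 ⟨hp, h, ?_⟩
  have h1 := down_mem hp
  refine eq_zero_of_down_up (by simpa using h1) ?_
  have h2 := lie_apply_of_mem hp
  have : up n (down n p) = 0 := by simpa [h] using h2
  rw [this, map_zero]

theorem finite_weight (n : ℕ) (d w : ℤ) :
    {m : Fin (n + 1) →₀ ℕ | Finsupp.weight (wt n) m = (d, w)}.Finite := by
  refine (Finset.finite_toSet (Finset.univ.finsuppAntidiag d.toNat)).subset fun m hm => ?_
  have h1 := congrArg Prod.fst ((weight_wt n m).symm.trans hm)
  simp only at h1
  rw [Finset.mem_coe, Finset.mem_finsuppAntidiag]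
  refine ⟨?_, Finset.subset_univ _⟩
  rw [← h1, Int.toNat_natCast, Finsupp.sum_fintype _ _ fun _ => rfl]

/-- The dimension of the space of polynomials of bidegree `(d, w)`. -/
def dimW (n : ℕ) (d w : ℤ) : ℕ :=
  Nat.card {m : Fin (n + 1) →₀ ℕ // Finsupp.weight (wt n) m = (d, w)}

instance (n : ℕ) (d w : ℤ) :
    Finite {m : Fin (n + 1) →₀ ℕ // Finsupp.weight (wt n) m = (d, w)} :=
  (finite_weight n d w).to_subtype

instance finite_W (n : ℕ) (d w : ℤ) : Module.Finite ℂ (W n d w) := by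
  have := (finite_weight n d w).to_subtype
  rw [W, weightedHomogeneousSubmodule_eq_finsupp_supported]
  exact Module.Finite.of_basis (basisRestrictSupport ℂ {m | Finsupp.weight (wt n) m = (d, w)})

theorem finrank_W (n : ℕ) (d w : ℤ) : Module.finrank ℂ (W n d w) = dimW n d w := by
  rw [W, weightedHomogeneousSubmodule_eq_finsupp_supported]
  exact Module.finrank_eq_nat_card_basis
    (basisRestrictSupport ℂ {m | Finsupp.weight (wt n) m = (d, w)})

instance finite_Inv (n d : ℕ) : Module.Finite ℂ (Inv n d) :=
  Submodule.finiteDimensional_of_le (inf_le_left.trans inf_le_left : Inv n d ≤ W n d 0)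

theorem finrank_Inv_add (n d : ℕ) :
    Module.finrank ℂ (Inv n d) + dimW n d (-2) = dimW n d 0 := by
  let D : W n d 0 →ₗ[ℂ] W n d (-2) :=
    (down n : Poly n →ₗ[ℂ] Poly n).restrict fun p hp => by simpa using down_mem hp
  let U : W n d (-2) →ₗ[ℂ] W n d 0 :=
    (up n : Poly n →ₗ[ℂ] Poly n).restrict fun p hp => by simpa using up_mem hp
  have hinj : Function.Injective (D ∘ₗ U) := by
    rw [← LinearMap.ker_eq_bot, LinearMap.ker_eq_bot']
    intro p hp
    exact Subtype.ext (eq_zero_of_down_up p.2 (congrArg Subtype.val hp))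
  have hsurj : Function.Surjective D := by
    have := LinearMap.injective_iff_surjective.1 hinj
    exact Function.Surjective.of_comp (g := U) this
  have h1 := D.finrank_range_add_finrank_ker
  rw [LinearMap.range_eq_top.2 hsurj, finrank_top, finrank_W, finrank_W] at h1
  have h2 : (LinearMap.ker D).map (W n d 0).subtype = Inv n d := by
    ext p
    simp only [Submodule.mem_map, LinearMap.mem_ker, Submodule.coe_subtype]
    constructor
    · rintro ⟨q, hq, rfl⟩
      exact mem_Inv_of_down q.2 (congrArg Subtype.val hq)
    · intro hp
      exact ⟨⟨p, (mem_Inv.1 hp).1⟩, Subtype.ext (mem_Inv.1 hp).2.2, rfl⟩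
  rw [← h2, ← (Submodule.equivMapOfInjective _ Subtype.val_injective _).finrank_eq]
  omega

open Polynomial in
/-- The Gaussian polynomials, counting monomials of degree `d` in `k` variables of
weights `0, …, k - 1`. -/
def gauss : ℕ → ℕ → Polynomial ℕ
  | _, 0 => 1
  | 0, _ + 1 => 0
  | k + 1, d + 1 => gauss k (d + 1) + Polynomial.X ^ k * gauss (k + 1) d

theorem gauss_zero_right (k : ℕ) : gauss k 0 = 1 := by cases k <;> simp [gauss]

theorem gauss_zero_succ (d : ℕ) : gauss 0 (d + 1) = 0 := by simp [gauss]

theorem gauss_succ (k d : ℕ) : gauss (k + 1) (d + 1) =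
    gauss k (d + 1) + Polynomial.X ^ k * gauss (k + 1) d := by
  rw [gauss]

theorem gauss_succ' (k d : ℕ) : gauss (k + 1) (d + 1) =
    gauss (k + 1) d + Polynomial.X ^ (d + 1) * gauss k (d + 1) := by
  induction k generalizing d with
  | zero =>
    rw [gauss_succ, gauss_zero_succ]
    simp
  | succ k ihk =>
    induction d with
    | zero =>
      have h1 := gauss_succ k 0
      have h2 := ihk 0
      rw [gauss_succ, h2]
      rw [h1] at h2
      simp only [gauss_zero_right, mul_one] at h2 ⊢
      calc _ = 1 + Polynomial.X * (gauss k (0 + 1) + Polynomial.X ^ k) := by ring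
        _ = _ := by rw [h2]; ring
    | succ d ihd =>
      have h1 := ihk (d + 1)
      have h2 := gauss_succ (k + 1) d
      have h3 := gauss_succ k (d + 1)
      rw [gauss_succ (k + 1) (d + 1)]
      calc _ = (gauss (k + 1) (d + 1) + Polynomial.X ^ (d + 2) * gauss k (d + 2)) +
            Polynomial.X ^ (k + 1) * (gauss (k + 2) d +
              Polynomial.X ^ (d + 1) * gauss (k + 1) (d + 1)) := by rw [← ihd, ← h1]
        _ = (gauss (k + 1) (d + 1) + Polynomial.X ^ (k + 1) * gauss (k + 2) d) +
            Polynomial.X ^ (d + 2) * (gauss k (d + 2) +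
              Polynomial.X ^ k * gauss (k + 1) (d + 1)) := by ring
        _ = _ := by rw [← h2, ← h3]

theorem gauss_symm (n d : ℕ) : gauss (n + 1) d = gauss (d + 1) n := by
  induction n generalizing d with
  | zero =>
    rw [gauss_zero_right]
    induction d with
    | zero => rw [gauss_zero_right]
    | succ d ih => rw [gauss_succ, gauss_zero_succ, ih]; simp
  | succ n ihn =>
    induction d with
    | zero =>
      rw [gauss_zero_right, gauss_succ, gauss_zero_succ, ← ihn, gauss_zero_right]; simp
    | succ d ihd => rw [gauss_succ, ihn, ihd, ← gauss_succ']

/-- Exponents of degree `d` and weight `s`. -/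
def expSet (k d s : ℕ) : Set (Fin k → ℕ) := {m | ∑ i, m i = d ∧ ∑ i : Fin k, (i : ℕ) * m i = s}

theorem expSet_succ (k d s : ℕ) : expSet (k + 1) (d + 1) s =
    (fun m => Fin.snoc (α := fun _ => ℕ) m 0) '' expSet k (d + 1) s ∪
    (fun m => m + Pi.single (Fin.last k) 1) ''
      {m | m ∈ expSet (k + 1) d (s - k) ∧ k ≤ s} := by
  ext m
  simp only [expSet, Set.mem_union, Set.mem_image, Set.mem_ofPred_eq]
  constructor
  · rintro ⟨h1, h2⟩
    rw [Fin.sum_univ_castSucc] at h1 h2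
    by_cases h : m (Fin.last k) = 0
    · left
      refine ⟨fun i => m i.castSucc, ⟨by simpa [h] using h1, by simpa [h] using h2⟩, ?_⟩
      rw [← h]
      exact Fin.snoc_init_self m
    · right
      obtain ⟨j, hj⟩ := Nat.exists_eq_succ_of_ne_zero h
      rw [hj] at h1 h2
      simp only [Fin.val_last, Nat.succ_eq_add_one, mul_add, mul_one, Fin.val_castSucc] at h1 h2
      refine ⟨Function.update m (Fin.last k) j, ⟨⟨?_, ?_⟩, by omega⟩, ?_⟩
      · rw [Fin.sum_univ_castSucc]
        simp [Fin.castSucc_ne_last]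
        omega
      · rw [Fin.sum_univ_castSucc]
        simp [Fin.castSucc_ne_last]
        omega
      · ext i
        by_cases hi : i = Fin.last k
        · subst hi
          simp [hj]
        · simp [hi]
  · rintro (⟨m, ⟨h1, h2⟩, rfl⟩ | ⟨m, ⟨⟨h1, h2⟩, h3⟩, rfl⟩)
    · simp only [Fin.sum_univ_castSucc, Fin.snoc_castSucc, Fin.snoc_last]
      simp [h1, h2]
    · simp only [Pi.add_apply, mul_add, Finset.sum_add_distrib, h1, h2]
      simp [Pi.single_apply]
      omega

theorem expSet_finite_and_ncard (k d s : ℕ) :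
    (expSet k d s).Finite ∧ (expSet k d s).ncard = (gauss k d).coeff s := by
  induction k generalizing d s with
  | zero =>
    refine ⟨Set.toFinite _, ?_⟩
    cases d with
    | zero =>
      rw [gauss_zero_right, Polynomial.coeff_one]
      split_ifs with h
      · subst h
        rw [Set.ncard_eq_one]
        exact ⟨0, by ext m; simp [expSet, Subsingleton.elim m 0]⟩
      · rw [Set.ncard_eq_zero]
        ext
        simp [expSet, Ne.symm h]
    | succ d =>
      rw [gauss_zero_succ, Polynomial.coeff_zero, Set.ncard_eq_zero]
      ext
      simp [expSet]
  | succ k ihk =>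
    induction d generalizing s with
    | zero =>
      have h : expSet (k + 1) 0 s = if s = 0 then {0} else ∅ := by
        ext m
        by_cases hs : s = 0
        · subst hs
          simp [expSet, _root_.funext_iff]
          intro h i
          simp [h]
        · simp only [expSet, hs, Set.mem_ofPred_eq, if_false, Set.mem_empty_iff_false, iff_false]
          rintro ⟨h1, h2⟩
          simp at h1
          simp [h1] at h2
          exact hs h2.symm
      rw [h, gauss_zero_right, Polynomial.coeff_one]
      split_ifs <;> simp
    | succ d ihd =>
      have hf : {m | m ∈ expSet (k + 1) d (s - k) ∧ k ≤ s}.Finite :=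
        (ihd (s - k)).1.subset fun m h => h.1
      have hi1 : Function.Injective fun m : Fin k → ℕ => (Fin.snoc (α := fun _ => ℕ) m 0) :=
        Fin.snoc_left_injective (α := fun _ => ℕ) 0
      have hi2 : Function.Injective
        fun m : Fin (k + 1) → ℕ => m + Pi.single (Fin.last k) 1 := add_left_injective _
      rw [expSet_succ]
      refine ⟨((ihk _ _).1.image _).union (hf.image _), ?_⟩
      rw [Set.ncard_union_eq _ ((ihk _ _).1.image _) (hf.image _),
        Set.ncard_image_of_injective _ hi1, Set.ncard_image_of_injective _ hi2, (ihk _ _).2,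
        gauss_succ, Polynomial.coeff_add, Polynomial.coeff_X_pow_mul']
      · congr 1
        split_ifs with h
        · simp only [h, and_true, Set.ofPred_mem_eq, (ihd _).2]
        · simp [h]
      · rw [Set.disjoint_left]
        rintro _ ⟨m, _, rfl⟩ ⟨m', _, h⟩
        have := congrFun h (Fin.last k)
        simp at this

theorem sum_wt {n d : ℕ} (m : Fin (n + 1) →₀ ℕ) (h : ∑ i, m i = d) :
    ∑ i, ((m i : ℕ) : ℤ) * (2 * (i : ℤ) - n) =
      2 * ((∑ i : Fin (n + 1), (i : ℕ) * m i : ℕ) : ℤ) - n * d := by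
  subst h
  push_cast
  rw [Finset.mul_sum, Finset.mul_sum, ← Finset.sum_sub_distrib]
  exact Finset.sum_congr rfl fun i _ => by ring

theorem weight_wt_eq_iff (n : ℕ) (m : Fin (n + 1) →₀ ℕ) (d s : ℕ) :
    Finsupp.weight (wt n) m = ((d : ℤ), 2 * (s : ℤ) - n * d) ↔ (m : Fin (n + 1) → ℕ) ∈
      expSet (n + 1) d s := by
  rw [weight_wt, Finsupp.sum_fintype _ _ (fun _ => rfl),
    Finsupp.sum_fintype _ _ (fun _ => by simp), Prod.mk.injEq, Nat.cast_inj, expSet,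
    Set.mem_ofPred_eq]
  refine and_congr_right fun h => ?_
  rw [sum_wt m h]
  omega

theorem dimW_eq (n d s : ℕ) : dimW n d (2 * (s : ℤ) - n * d) = (gauss (n + 1) d).coeff s := by
  rw [← (expSet_finite_and_ncard _ _ _).2, dimW, Set.ncard]
  refine Nat.card_congr (Equiv.subtypeEquiv Finsupp.equivFunOnFinite fun m => ?_)
  exact weight_wt_eq_iff n m d s

theorem dimW_eq_zero_of_neg (n d : ℕ) (s : ℤ) (hs : s < 0) : dimW n d (2 * s - n * d) = 0 := by
  rw [dimW]
  refine Nat.card_eq_zero.2 (Or.inl ⟨fun m => ?_⟩)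
  have := weight_bound m.2
  omega

/-- The number of linearly independent invariants of degree `d`. -/
def h (n d : ℕ) : ℕ := Module.finrank ℂ (Inv n d)

theorem h_eq_of_two_mul {n d s : ℕ} (hs : n * d = 2 * (s + 1)) :
    h n d + (gauss (n + 1) d).coeff s = (gauss (n + 1) d).coeff (s + 1) := by
  have hs' : (n : ℤ) * d = 2 * (s + 1) := by exact_mod_cast hs
  have e1 : 2 * (s : ℤ) - n * d = -2 := by omega
  have e2 : 2 * ((s + 1 : ℕ) : ℤ) - n * d = 0 := by push_cast; omega
  rw [h, ← dimW_eq, ← dimW_eq, e1, e2, finrank_Inv_add]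

theorem h_eq_zero_of_odd {n d : ℕ} (hs : ¬ 2 ∣ n * d) : h n d = 0 := by
  have h1 := finrank_Inv_add n d
  have h2 : dimW n d 0 = 0 := by
    rw [dimW]
    refine Nat.card_eq_zero.2 (Or.inl ⟨fun m => hs ?_⟩)
    have h3 := m.2
    rw [weight_wt, Finsupp.sum_fintype _ _ (fun _ => rfl),
      Finsupp.sum_fintype _ _ (fun _ => by simp), Prod.mk.injEq, Nat.cast_inj] at h3
    rw [sum_wt m.1 h3.1] at h3
    have h4 := h3.2
    have : (n : ℤ) * d = ((n * d : ℕ) : ℤ) := by push_cast; rfl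
    omega
  unfold h
  omega

/-- Hermite reciprocity. -/
theorem h_symm (n d : ℕ) : h n d = h d n := by
  by_cases hs : 2 ∣ n * d
  · obtain ⟨s, hs⟩ := hs
    cases s with
    | zero =>
      have h1 : ∀ n d : ℕ, n * d = 0 → h n d = 1 := by
        intro n d e
        have e' : (n : ℤ) * d = 0 := by exact_mod_cast e
        have h1 := finrank_Inv_add n d
        have h2 := dimW_eq n d 0
        have h3 := dimW_eq_zero_of_neg n d (-1) (by norm_num)
        have h4 : (gauss (n + 1) d).coeff 0 = 1 := by
          rcases Nat.mul_eq_zero.1 e with rfl | rfl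
          · rw [gauss_symm, gauss_zero_right]; simp
          · rw [gauss_zero_right]; simp
        rw [e'] at h2 h3
        norm_num at h2 h3
        unfold h
        omega
      rw [h1 n d (by simpa using hs), h1 d n (by rw [mul_comm]; simpa using hs)]
    | succ s =>
      have h1 := h_eq_of_two_mul hs
      rw [mul_comm] at hs
      have h2 := h_eq_of_two_mul hs
      rw [gauss_symm] at h1
      omega
  · rw [h_eq_zero_of_odd hs, h_eq_zero_of_odd (by rwa [mul_comm])]

end BinForm

namespace BinForm

open BinInv

/-- The binary form with the given coefficients. -/
def form (n : ℕ) (c : Fin (n + 1) → ℂ) : MvPolynomial (Fin 2) ℂ :=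
  ∑ k : Fin (n + 1), C (c k) * X 0 ^ (n - (k : ℕ)) * X 1 ^ (k : ℕ)

/-- The coefficients of a binary form. -/
def coeffs (n : ℕ) (f : MvPolynomial (Fin 2) ℂ) (k : Fin (n + 1)) : ℂ :=
  coeff (Finsupp.single 0 (n - (k : ℕ)) + Finsupp.single 1 (k : ℕ)) f

theorem single_add_single_inj {a b c d : ℕ} :
    (Finsupp.single (0 : Fin 2) a + Finsupp.single 1 b = Finsupp.single 0 c + Finsupp.single 1 d) ↔
      a = c ∧ b = d := by
  constructor
  · intro h
    have h0 := DFunLike.congr_fun h 0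
    have h1 := DFunLike.congr_fun h 1
    simp at h0 h1
    exact ⟨h0, h1⟩
  · rintro ⟨rfl, rfl⟩
    rfl

theorem C_mul_X_pow_mul_X_pow (a : ℂ) (i j : ℕ) :
    (C a * X 0 ^ i * X 1 ^ j : MvPolynomial (Fin 2) ℂ) =
      monomial (Finsupp.single 0 i + Finsupp.single 1 j) a := by
  rw [X_pow_eq_monomial, X_pow_eq_monomial, C_mul_monomial, monomial_mul, mul_one, mul_one]

theorem coeffs_form (n : ℕ) (c : Fin (n + 1) → ℂ) : coeffs n (form n c) = c := by
  ext m
  simp only [coeffs, form, coeff_sum, C_mul_X_pow_mul_X_pow, coeff_monomial,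
    single_add_single_inj]
  rw [Finset.sum_eq_single m]
  · simp
  · intro k _ hk
    rw [if_neg]
    rintro ⟨-, h⟩
    exact hk (Fin.ext h)
  · simp

theorem form_coeffs {n : ℕ} {f : MvPolynomial (Fin 2) ℂ} (hf : f.IsHomogeneous n) :
    form n (coeffs n f) = f := by
  ext m
  simp only [form, coeff_sum, C_mul_X_pow_mul_X_pow, coeff_monomial]
  have hm : m = Finsupp.single 0 (m 0) + Finsupp.single 1 (m 1) := by
    ext i
    fin_cases i <;> simp
  by_cases h : m 0 + m 1 = n
  · rw [Finset.sum_eq_single ⟨m 1, by omega⟩]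
    · have : n - m 1 = m 0 := by omega
      simp only [this, ← hm, if_true, coeffs]
    · intro k _ hk
      rw [if_neg]
      intro h'
      rw [hm, single_add_single_inj] at h'
      exact hk (Fin.ext h'.2)
    · simp
  · rw [Finset.sum_eq_zero]
    · symm
      refine hf.coeff_eq_zero ?_
      rw [Finsupp.degree_eq_sum, Fin.sum_univ_two]
      exact h
    · intro k _
      rw [if_neg]
      intro h'
      rw [hm, single_add_single_inj] at h'
      have := k.2
      omega

theorem form_isHomogeneous (n : ℕ) (c : Fin (n + 1) → ℂ) : (form n c).IsHomogeneous n := by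
  refine IsHomogeneous.sum _ _ _ fun k _ => ?_
  rw [C_mul_X_pow_mul_X_pow]
  refine isHomogeneous_monomial _ ?_
  have := k.2
  rw [Finsupp.degree_eq_sum, Fin.sum_univ_two]
  simp
  omega

/-- The action of `SL(2,ℂ)` on coefficient vectors. -/
def act (n : ℕ) (g : Matrix.SpecialLinearGroup (Fin 2) ℂ) (c : Fin (n + 1) → ℂ) :
    Fin (n + 1) → ℂ :=
  coeffs n (sl2Act g (form n c))

theorem sl2Act_isHomogeneous (g : Matrix.SpecialLinearGroup (Fin 2) ℂ) {n : ℕ}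
    {f : MvPolynomial (Fin 2) ℂ} (hf : f.IsHomogeneous n) : (sl2Act g f).IsHomogeneous n := by
  have := hf.aeval (fun i => ∑ j, C ((↑(g⁻¹) : Matrix (Fin 2) (Fin 2) ℂ) i j) * X j)
    (n := 1) fun i => IsHomogeneous.sum _ _ _ fun j _ => (isHomogeneous_X ℂ j).C_mul _
  rwa [one_mul] at this

theorem sl2Act_mul (g h : Matrix.SpecialLinearGroup (Fin 2) ℂ) (f : MvPolynomial (Fin 2) ℂ) :
    sl2Act (g * h) f = sl2Act g (sl2Act h f) := by
  unfold sl2Act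
  rw [← AlgHom.comp_apply]
  refine congrFun (congrArg _ (algHom_ext fun i => ?_)) f
  simp only [aeval_X, AlgHom.comp_apply, map_mul, algHom_C, mul_inv_rev,
    Matrix.SpecialLinearGroup.coe_mul, Matrix.mul_apply, Fin.sum_univ_two, algebraMap_eq, map_add]
  ring

theorem act_mul (n : ℕ) (g h : Matrix.SpecialLinearGroup (Fin 2) ℂ) (c : Fin (n + 1) → ℂ) :
    act n (g * h) c = act n g (act n h c) := by
  rw [act, sl2Act_mul, act, act,
    form_coeffs (sl2Act_isHomogeneous h (form_isHomogeneous n c))]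

/-- Upper unitriangular matrices. -/
def upper (s : ℂ) : Matrix.SpecialLinearGroup (Fin 2) ℂ := ⟨!![1, s; 0, 1], by simp⟩

/-- Lower unitriangular matrices. -/
def lower (s : ℂ) : Matrix.SpecialLinearGroup (Fin 2) ℂ := ⟨!![1, 0; s, 1], by simp⟩

theorem sl2Act_upper (s : ℂ) (f : MvPolynomial (Fin 2) ℂ) :
    sl2Act (upper (-s)) f = aeval ![X 0 + C s * X 1, X 1] f := by
  unfold sl2Act
  congr 1
  congr 1
  ext1 i
  rw [Matrix.SpecialLinearGroup.coe_inv]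
  fin_cases i <;> simp [upper, Matrix.adjugate_fin_two]

theorem sl2Act_lower (s : ℂ) (f : MvPolynomial (Fin 2) ℂ) :
    sl2Act (lower (-s)) f = aeval ![X 0, C s * X 0 + X 1] f := by
  unfold sl2Act
  congr 1
  congr 1
  ext1 i
  rw [Matrix.SpecialLinearGroup.coe_inv]
  fin_cases i <;> simp [lower, Matrix.adjugate_fin_two]

theorem closure_unipotent {P : Matrix.SpecialLinearGroup (Fin 2) ℂ → Prop}
    (hU : ∀ s, P (upper s)) (hL : ∀ s, P (lower s)) (hm : ∀ g h, P g → P h → P (g * h))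
    (g : Matrix.SpecialLinearGroup (Fin 2) ℂ) : P g := by
  have key : ∀ g : Matrix.SpecialLinearGroup (Fin 2) ℂ, g.1 1 0 ≠ 0 → P g := by
    intro g hg
    have hd := g.2
    rw [Matrix.det_fin_two] at hd
    have : g = upper ((g.1 0 0 - 1) / g.1 1 0) * lower (g.1 1 0) *
        upper ((g.1 1 1 - 1) / g.1 1 0) := by
      refine Subtype.ext ?_
      rw [Matrix.SpecialLinearGroup.coe_mul, Matrix.SpecialLinearGroup.coe_mul]
      change g.1 = !![1, _; 0, 1] * !![1, 0; _, 1] * !![1, _; 0, 1]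
      rw [Matrix.mul_fin_two, Matrix.mul_fin_two]
      ext i j
      fin_cases i <;> fin_cases j <;> simp
      · field_simp
        ring
      · field_simp
        linear_combination -hd
      · field_simp
        ring
    rw [this]
    exact hm _ _ (hm _ _ (hU _) (hL _)) (hU _)
  by_cases hg : g.1 1 0 = 0
  · have h1 : g = lower (-1) * (lower 1 * g) := by
      refine Subtype.ext ?_
      rw [Matrix.SpecialLinearGroup.coe_mul, Matrix.SpecialLinearGroup.coe_mul]
      change g.1 = !![1, 0; -1, 1] * (!![1, 0; 1, 1] * g.1)
      rw [← mul_assoc, Matrix.mul_fin_two]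
      simp [← Matrix.one_fin_two]
    rw [h1]
    refine hm _ _ (hL _) (key _ ?_)
    have hd := g.2
    rw [Matrix.det_fin_two, hg, mul_zero, sub_zero] at hd
    have : (lower 1 * g).1 1 0 = g.1 0 0 + g.1 1 0 := by
      rw [Matrix.SpecialLinearGroup.coe_mul]
      change ((!![1, 0; 1, 1] : Matrix (Fin 2) (Fin 2) ℂ) * g.1) 1 0 = _
      simp [Matrix.mul_apply, Fin.sum_univ_two]
    rw [this, hg, add_zero]
    exact left_ne_zero_of_mul_eq_one hd
  · exact key g hg

theorem sum_upper {A : Type*} [CommRing A] (x y z : A) {n k : ℕ} (hk : k ≤ n) :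
    ∑ m ∈ Finset.range (n + 1), (if k ≤ m then ((n - k).choose (m - k) : A) * z ^ (m - k) else 0) *
      x ^ (n - m) * y ^ m = (x + z * y) ^ (n - k) * y ^ k := by
  obtain ⟨j, rfl⟩ := Nat.exists_eq_add_of_le hk
  rw [add_assoc, Finset.sum_range_add, Finset.sum_eq_zero, zero_add, add_comm x,
    add_pow, Finset.sum_mul, Nat.add_sub_cancel_left]
  · refine Finset.sum_congr rfl fun i _ => ?_
    rw [if_pos (by omega), Nat.add_sub_cancel_left, Nat.add_sub_add_left]
    ring
  · intro i hi
    rw [if_neg (by rw [Finset.mem_range] at hi; omega), zero_mul, zero_mul]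

theorem sum_lower {A : Type*} [CommRing A] (x y z : A) {n k : ℕ} (hk : k ≤ n) :
    ∑ m ∈ Finset.range (n + 1), (if m ≤ k then (k.choose m : A) * z ^ (k - m) else 0) *
      x ^ (n - m) * y ^ m = x ^ (n - k) * (z * x + y) ^ k := by
  obtain ⟨j, rfl⟩ := Nat.exists_eq_add_of_le hk
  rw [show k + j + 1 = (k + 1) + j by ring, Finset.sum_range_add, add_comm (Finset.sum _ _),
    Finset.sum_eq_zero, zero_add, add_comm (z * x), add_pow, Finset.mul_sum,
    Nat.add_sub_cancel_left]
  · refine Finset.sum_congr rfl fun i hi => ?_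
    have hi' : i ≤ k := by rw [Finset.mem_range] at hi; omega
    rw [if_pos hi', show k + j - i = j + (k - i) by omega]
    ring
  · intro i _
    rw [if_neg (by omega), zero_mul, zero_mul]

/-- The orbit of `c` under the upper unitriangular matrices. -/
def upperCurve (n : ℕ) (c : Fin (n + 1) → ℂ) (m : ℕ) : Polynomial ℂ :=
  ∑ k : Fin (n + 1), Polynomial.C (c k) * if (k : ℕ) ≤ m then
    ((n - k).choose (m - k) : Polynomial ℂ) * Polynomial.X ^ (m - k) else 0

/-- The orbit of `c` under the lower unitriangular matrices. -/
def lowerCurve (n : ℕ) (c : Fin (n + 1) → ℂ) (m : ℕ) : Polynomial ℂ :=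
  ∑ k : Fin (n + 1), Polynomial.C (c k) * if m ≤ (k : ℕ) then
    ((k : ℕ).choose m : Polynomial ℂ) * Polynomial.X ^ (k - m) else 0

theorem act_upper (n : ℕ) (s : ℂ) (c : Fin (n + 1) → ℂ) :
    act n (upper (-s)) c = fun m : Fin (n + 1) => (upperCurve n c m).eval s := by
  rw [act, sl2Act_upper, ← coeffs_form n fun m : Fin (n + 1) => (upperCurve n c m).eval s]
  congr 1
  simp only [form, map_sum, map_mul, map_pow, aeval_X, algHom_C, algebraMap_eq, upperCurve,
    Polynomial.eval_finsetSum, Polynomial.eval_mul, Polynomial.eval_C, Finset.sum_mul]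
  rw [Finset.sum_comm]
  refine Finset.sum_congr rfl fun k _ => ?_
  have := sum_upper (X 0 : MvPolynomial (Fin 2) ℂ) (X 1) (C s) (Nat.lt_succ_iff.1 k.2)
  simp only [Matrix.cons_val_zero, Matrix.cons_val_one]
  rw [mul_assoc, ← this, Finset.sum_range, Finset.mul_sum]
  refine Finset.sum_congr rfl fun m _ => ?_
  split_ifs
  · simp
    ring
  · simp

theorem act_lower (n : ℕ) (s : ℂ) (c : Fin (n + 1) → ℂ) :
    act n (lower (-s)) c = fun m : Fin (n + 1) => (lowerCurve n c m).eval s := by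
  rw [act, sl2Act_lower, ← coeffs_form n fun m : Fin (n + 1) => (lowerCurve n c m).eval s]
  congr 1
  simp only [form, map_sum, map_mul, map_pow, aeval_X, algHom_C, algebraMap_eq, lowerCurve,
    Polynomial.eval_finsetSum, Polynomial.eval_mul, Polynomial.eval_C, Finset.sum_mul]
  rw [Finset.sum_comm]
  refine Finset.sum_congr rfl fun k _ => ?_
  have := sum_lower (X 0 : MvPolynomial (Fin 2) ℂ) (X 1) (C s) (Nat.lt_succ_iff.1 k.2)
  simp only [Matrix.cons_val_zero, Matrix.cons_val_one]
  rw [mul_assoc, ← this, Finset.sum_range, Finset.mul_sum]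
  refine Finset.sum_congr rfl fun m _ => ?_
  split_ifs
  · simp
    ring
  · simp

theorem upperCurve_zero (n : ℕ) (c : Fin (n + 1) → ℂ) (m : Fin (n + 1)) :
    (upperCurve n c m).eval 0 = c m := by
  rw [upperCurve, Polynomial.eval_finsetSum, Finset.sum_eq_single m]
  · simp
  · intro k _ hk
    rw [Polynomial.eval_mul]
    split_ifs with h
    · have : (m : ℕ) - k ≠ 0 := by
        have : (k : ℕ) ≠ m := fun h => hk (Fin.ext h)
        omega
      simp [this]
    · simp
  · simp

theorem lowerCurve_zero (n : ℕ) (c : Fin (n + 1) → ℂ) (m : Fin (n + 1)) :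
    (lowerCurve n c m).eval 0 = c m := by
  rw [lowerCurve, Polynomial.eval_finsetSum, Finset.sum_eq_single m]
  · simp
  · intro k _ hk
    rw [Polynomial.eval_mul]
    split_ifs with h
    · have : (k : ℕ) - m ≠ 0 := by
        have : (k : ℕ) ≠ m := fun h => hk (Fin.ext h)
        omega
      simp [this]
    · simp
  · simp

theorem derivative_upperCurve_zero (n : ℕ) (c : Fin (n + 1) → ℂ) :
    Polynomial.derivative (upperCurve n c 0) = 0 := by
  rw [upperCurve, Polynomial.derivative_sum]
  refine Finset.sum_eq_zero fun k _ => ?_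
  split_ifs with h
  · have : (k : ℕ) = 0 := by omega
    simp [this]
  · simp

theorem derivative_upperCurve_succ (n : ℕ) (c : Fin (n + 1) → ℂ) {m : ℕ} (hm : m < n) :
    Polynomial.derivative (upperCurve n c (m + 1)) =
      ((n : ℂ) - m) • upperCurve n c m := by
  rw [upperCurve, upperCurve, Polynomial.derivative_sum, Finset.smul_sum]
  refine Finset.sum_congr rfl fun k _ => ?_
  rcases lt_trichotomy (k : ℕ) (m + 1) with h | h | h
  · obtain ⟨j, rfl⟩ := Nat.exists_eq_add_of_le (Nat.lt_succ_iff.1 h)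
    rw [if_pos (by omega), if_pos (by omega), show (k : ℕ) + j + 1 - k = j + 1 by omega,
      Nat.add_sub_cancel_left]
    have e := congrArg (Nat.cast : ℕ → Polynomial ℂ) (Nat.choose_succ_right_eq (n - k) j)
    rw [show n - k - j = n - (k + j) by omega] at e
    rw [Polynomial.smul_eq_C_mul]
    push_cast [Nat.cast_sub hm.le] at e
    simp only [Polynomial.derivative_mul, Polynomial.derivative_C, Polynomial.derivative_natCast,
      Polynomial.derivative_X_pow, map_sub, map_natCast, zero_mul, zero_add,
      Nat.add_sub_cancel]
    push_cast
    linear_combination (Polynomial.C (c k) * Polynomial.X ^ j) * e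
  · rw [if_pos h.le, if_neg (by omega), h]
    simp
  · rw [if_neg (by omega), if_neg (by omega)]
    simp

theorem derivative_lowerCurve (n : ℕ) (c : Fin (n + 1) → ℂ) (m : ℕ) :
    Polynomial.derivative (lowerCurve n c m) =
      ((m : ℂ) + 1) • lowerCurve n c (m + 1) := by
  rw [lowerCurve, lowerCurve, Polynomial.derivative_sum, Finset.smul_sum]
  refine Finset.sum_congr rfl fun k _ => ?_
  rcases lt_trichotomy (k : ℕ) m with h | h | h
  · rw [if_neg (by omega), if_neg (by omega)]
    simp
  · rw [if_pos h.ge, if_neg (by omega), h]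
    simp
  · obtain ⟨j, hj⟩ := Nat.exists_eq_add_of_lt h
    rw [if_pos (by omega), if_pos (by omega), show (k : ℕ) - m = j + 1 by omega,
      show (k : ℕ) - (m + 1) = j by omega]
    have e := congrArg (Nat.cast : ℕ → Polynomial ℂ) (Nat.choose_succ_right_eq k m)
    rw [show (k : ℕ) - m = j + 1 by omega] at e
    rw [Polynomial.smul_eq_C_mul]
    push_cast at e
    simp only [Polynomial.derivative_mul, Polynomial.derivative_C, Polynomial.derivative_natCast,
      Polynomial.derivative_X_pow, map_natCast, map_add, zero_mul, zero_add,
      Nat.add_sub_cancel, map_one]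
    push_cast
    linear_combination -(Polynomial.C (c k) * Polynomial.X ^ j) * e

theorem derivative_aeval {n : ℕ} (D : Derivation ℂ (Poly n) (Poly n))
    (γ : Fin (n + 1) → Polynomial ℂ)
    (h : ∀ i, Polynomial.derivative (γ i) = aeval γ (D (X i))) (P : Poly n) :
    Polynomial.derivative (aeval γ P) = aeval γ (D P) := by
  induction P using MvPolynomial.induction_on with
  | C a => simp [algHom_C]
  | add p q hp hq => simp [hp, hq]
  | mul_X p i hp =>
    rw [map_mul, Polynomial.derivative_mul, hp, aeval_X, h, D.leibniz]
    simp only [smul_eq_mul, map_add, map_mul, aeval_X]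
    ring

theorem eval_aeval {n : ℕ} (γ : Fin (n + 1) → Polynomial ℂ) (s : ℂ) (P : Poly n) :
    (aeval γ P).eval s = eval (fun i => (γ i).eval s) P := by
  induction P using MvPolynomial.induction_on with
  | C a => simp [algHom_C]
  | add p q hp hq => simp [hp, hq]
  | mul_X p i hp => simp [hp]

theorem invariant_curve_iff {n : ℕ} (D : Derivation ℂ (Poly n) (Poly n))
    (γ : (Fin (n + 1) → ℂ) → Fin (n + 1) → Polynomial ℂ)
    (h0 : ∀ c i, (γ c i).eval 0 = c i)
    (h : ∀ c i, Polynomial.derivative (γ c i) = aeval (γ c) (D (X i))) (P : Poly n) :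
    (∀ s c, eval (fun i => (γ c i).eval s) P = eval c P) ↔ D P = 0 := by
  constructor
  · intro H
    refine MvPolynomial.funext fun c => ?_
    have h1 : aeval (γ c) P = Polynomial.C (eval c P) := by
      refine Polynomial.funext fun s => ?_
      rw [eval_aeval, H, Polynomial.eval_C]
    have h2 := derivative_aeval D (γ c) (h c) P
    rw [h1, Polynomial.derivative_C] at h2
    have h3 := eval_aeval (γ c) 0 (D P)
    rw [← h2] at h3
    simp only [h0] at h3
    rw [← h3]
    simp
  · intro H s c
    have h2 := derivative_aeval D (γ c) (h c) P
    rw [H, map_zero] at h2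
    have h3 := Polynomial.eq_C_of_derivative_eq_zero h2
    rw [← eval_aeval, h3, Polynomial.eval_C]
    have h4 := eval_aeval (γ c) 0 P
    rw [h3, Polynomial.eval_C] at h4
    rw [h4]
    simp only [h0]

theorem aeval_upperCurve_down (n : ℕ) (c : Fin (n + 1) → ℂ) (i : Fin (n + 1)) :
    Polynomial.derivative (upperCurve n c i) =
      aeval (fun i : Fin (n + 1) => upperCurve n c i) (down n (X i)) := by
  rw [← var_coe]
  obtain ⟨i, hi⟩ := i
  cases i with
  | zero => rw [down_var_zero, map_zero, derivative_upperCurve_zero]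
  | succ i =>
    rw [down_var_succ, map_smul, derivative_upperCurve_succ _ _ (by omega), var,
      dif_pos (by omega), aeval_X]

theorem aeval_lowerCurve_up (n : ℕ) (c : Fin (n + 1) → ℂ) (i : Fin (n + 1)) :
    Polynomial.derivative (lowerCurve n c i) =
      aeval (fun i : Fin (n + 1) => lowerCurve n c i) (up n (X i)) := by
  rw [← var_coe, up_var, map_smul, derivative_lowerCurve]
  by_cases h : (i : ℕ) + 1 < n + 1
  · rw [var, dif_pos h, aeval_X]
  · rw [var, dif_neg h, map_zero, smul_zero, lowerCurve, Finset.sum_eq_zero, smul_zero]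
    intro k _
    rw [if_neg (by omega), mul_zero]

/-- Infinitesimal characterisation of invariance. -/
theorem forall_act_iff {n : ℕ} (P : Poly n) :
    (∀ g c, eval (act n g c) P = eval c P) ↔ up n P = 0 ∧ down n P = 0 := by
  have hd := invariant_curve_iff (down n) (fun c i => upperCurve n c i) (upperCurve_zero n)
    (aeval_upperCurve_down n) P
  have hu := invariant_curve_iff (up n) (fun c i => lowerCurve n c i) (lowerCurve_zero n)
    (aeval_lowerCurve_up n) P
  rw [← hd, ← hu]
  constructor
  · intro H
    refine ⟨fun s c => ?_, fun s c => ?_⟩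
    · rw [← H (lower (-s)) c, act_lower]
    · rw [← H (upper (-s)) c, act_upper]
  · rintro ⟨H1, H2⟩ g
    refine closure_unipotent (P := fun g => ∀ c, eval (act n g c) P = eval c P) ?_ ?_ ?_ g
    · intro s c
      rw [← neg_neg s, act_upper, H2]
    · intro s c
      rw [← neg_neg s, act_lower, H1]
    · intro g h hg hh c
      rw [act_mul, hg, hh]

/-- Identification of the two coordinate rings. -/
def toPoly (n : ℕ) : MvPolynomial (Idx fun _ : Fin 1 => n) ℂ ≃ₐ[ℂ] Poly n :=
  renameEquiv ℂ (Equiv.uniqueSigma fun _ : Fin 1 => Fin (n + 1))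

theorem eval_toPoly (n : ℕ) (c : Fin (n + 1) → ℂ) (P : MvPolynomial (Idx fun _ : Fin 1 => n) ℂ) :
    eval c (toPoly n P) = eval (fun j => c j.2) P := by
  rw [toPoly, renameEquiv_apply, eval_rename]
  congr 2
  ext ⟨i, k⟩
  obtain rfl : i = 0 := Subsingleton.elim _ _
  rfl

theorem mem_invariantRing_iff {n : ℕ} (P : MvPolynomial (Idx fun _ : Fin 1 => n) ℂ) :
    P ∈ invariantRing (fun _ : Fin 1 => n) ↔ up n (toPoly n P) = 0 ∧ down n (toPoly n P) = 0 := by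
  rw [← forall_act_iff]
  simp only [eval_toPoly]
  constructor
  · intro H g c
    exact H g fun j => c j.2
  · intro H g c
    have h : c = fun j => c ⟨0, j.2⟩ := by
      ext ⟨i, k⟩
      obtain rfl : i = 0 := Subsingleton.elim _ _
      rfl
    rw [h]
    exact H g fun k => c ⟨0, k⟩

end BinForm

namespace BinForm

/-- Homogeneous components. -/
abbrev comp (n : ℕ) (m : ℤ × ℤ) : Poly n →ₗ[ℂ] Poly n :=
  weightedHomogeneousComponent (wt n) m

theorem derivation_comp {n : ℕ} {δ : ℤ × ℤ} (D : Derivation ℂ (Poly n) (Poly n))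
    (hD : ∀ {m p}, p ∈ weightedHomogeneousSubmodule ℂ (wt n) m →
      D p ∈ weightedHomogeneousSubmodule ℂ (wt n) (m + δ)) (m : ℤ × ℤ) (p : Poly n) :
    D (comp n m p) = comp n (m + δ) (D p) := by
  classical
  induction p using MvPolynomial.induction_on' with
  | monomial e a =>
    have he : monomial e a ∈ weightedHomogeneousSubmodule ℂ (wt n) (Finsupp.weight (wt n) e) :=
      isWeightedHomogeneous_monomial _ _ _ rfl
    rw [comp, comp, weightedHomogeneousComponent_of_mem he,
      weightedHomogeneousComponent_of_mem (hD he)]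
    simp only [add_left_inj]
    split_ifs <;> simp
  | add p q hp hq => rw [map_add, map_add, hp, hq, map_add, map_add]

theorem up_comp (n : ℕ) (m : ℤ × ℤ) (p : Poly n) :
    up n (comp n m p) = comp n (m + (0, 2)) (up n p) :=
  derivation_comp _ (fun {m p} hp => by
    have := up_mem (d := m.1) (w := m.2) hp
    rwa [show m + (0, 2) = (m.1, m.2 + 2) by ext <;> simp]) m p

theorem down_comp (n : ℕ) (m : ℤ × ℤ) (p : Poly n) :
    down n (comp n m p) = comp n (m + (0, -2)) (down n p) :=
  derivation_comp _ (fun {m p} hp => by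
    have := down_mem (d := m.1) (w := m.2) hp
    rwa [show m + (0, -2) = (m.1, m.2 - 2) by ext <;> simp [sub_eq_add_neg]]) m p

theorem mem_iSup_Inv {n : ℕ} {p : Poly n} (hu : up n p = 0) (hd : down n p = 0) :
    p ∈ ⨆ d : ℕ, Inv n d := by
  rw [← sum_weightedHomogeneousComponent (wt n) p,
    finsum_eq_sum _ (weightedHomogeneousComponent_finsupp p)]
  refine Submodule.sum_mem _ fun m _ => ?_
  obtain ⟨d, w⟩ := m
  have hm : comp n (d, w) p ∈ W n d w := weightedHomogeneousComponent_mem _ _ _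
  have hu' : up n (comp n (d, w) p) = 0 := by rw [up_comp, hu, map_zero]
  have hd' : down n (comp n (d, w) p) = 0 := by rw [down_comp, hd, map_zero]
  by_cases h0 : comp n (d, w) p = 0
  · change comp n (d, w) p ∈ _
    rw [h0]
    exact zero_mem _
  · have h1 := lie_apply_of_mem hm
    rw [hu', hd', map_zero, map_zero, sub_zero] at h1
    have hw : w = 0 := by
      have := (smul_eq_zero.1 h1.symm).resolve_right h0
      exact_mod_cast this
    obtain ⟨e, he⟩ := MvPolynomial.ne_zero_iff.1 h0
    have he' := congrArg Prod.fst ((weight_wt n e).symm.trans (hm he))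
    simp only at he'
    subst hw
    subst he'
    exact Submodule.mem_iSup_of_mem _ (mem_Inv.2 ⟨hm, hu', hd'⟩)

/-- The decomposable invariants of degree `d`. -/
def dec (n d : ℕ) : Submodule ℂ (Poly n) := ⨆ i ∈ Finset.Ico 1 d, Inv n i * Inv n (d - i)

theorem mul_mem_Inv {n i j : ℕ} {p q : Poly n} (hp : p ∈ Inv n i) (hq : q ∈ Inv n j) :
    p * q ∈ Inv n (i + j) := by
  rw [mem_Inv] at *
  refine ⟨?_, ?_, ?_⟩
  · have := IsWeightedHomogeneous.mul hp.1 hq.1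
    simpa using this
  · rw [Derivation.leibniz, hp.2.1, hq.2.1, smul_zero, smul_zero, add_zero]
  · rw [Derivation.leibniz, hp.2.2, hq.2.2, smul_zero, smul_zero, add_zero]

theorem Inv_mul_le (n i j : ℕ) : Inv n i * Inv n j ≤ Inv n (i + j) :=
  Submodule.mul_le.2 fun _ hp _ hq => mul_mem_Inv hp hq

theorem dec_le (n d : ℕ) : dec n d ≤ Inv n d := by
  refine iSup₂_le fun i hi => ?_
  rw [Finset.mem_Ico] at hi
  exact (Inv_mul_le n i (d - i)).trans_eq (by rw [Nat.add_sub_cancel' hi.2.le])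

theorem comp_of_mem_Inv {n i : ℕ} {p : Poly n} (hp : p ∈ Inv n i) (d : ℕ) :
    comp n (d, 0) p = if d = i then p else 0 := by
  rw [comp, weightedHomogeneousComponent_of_mem (mem_Inv.1 hp).1]
  simp

theorem eq_C_of_mem_Inv_zero {n : ℕ} {p : Poly n} (hp : p ∈ Inv n 0) :
    p = C (constantCoeff p) := by
  ext e
  rw [coeff_C, constantCoeff_eq]
  split_ifs with h
  · rw [h]
  · by_contra he
    have he' := congrArg Prod.fst ((weight_wt n e).symm.trans ((mem_Inv.1 hp).1 he))
    simp only [Nat.cast_eq_zero, Nat.cast_zero] at he'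
    rw [Finsupp.sum, Finset.sum_eq_zero_iff] at he'
    refine h (Eq.symm (Finsupp.ext fun i => ?_))
    by_contra hi
    exact hi (he' i (Finsupp.mem_support_iff.2 hi))

theorem constantCoeff_of_mem_Inv {n i : ℕ} {p : Poly n} (hp : p ∈ Inv n i) (hi : i ≠ 0) :
    constantCoeff p = 0 := by
  by_contra h
  have he' := congrArg Prod.fst ((weight_wt n 0).symm.trans ((mem_Inv.1 hp).1 h))
  simp at he'
  omega

theorem comp_mul_sub_mem {n d : ℕ} (hd : 1 ≤ d) {p q : Poly n} (hp : p ∈ ⨆ i : ℕ, Inv n i)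
    (hq : q ∈ ⨆ i : ℕ, Inv n i) :
    comp n (d, 0) (p * q) - (constantCoeff p • comp n (d, 0) q +
      constantCoeff q • comp n (d, 0) p) ∈ dec n d := by
  refine Submodule.iSup_induction _ (motive := fun p => comp n (d, 0) (p * q) -
    (constantCoeff p • comp n (d, 0) q + constantCoeff q • comp n (d, 0) p) ∈ dec n d) hp
    (fun i p hp => ?_) (by simp) (fun p p' h h' => ?_)
  · refine Submodule.iSup_induction _ (motive := fun q => comp n (d, 0) (p * q) -
      (constantCoeff p • comp n (d, 0) q + constantCoeff q • comp n (d, 0) p) ∈ dec n d) hq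
      (fun j q hq => ?_) (by simp) (fun q q' h h' => ?_)
    · rw [comp_of_mem_Inv (mul_mem_Inv hp hq), comp_of_mem_Inv hp, comp_of_mem_Inv hq]
      rcases Nat.eq_zero_or_pos i with rfl | hi
      · have h1 := eq_C_of_mem_Inv_zero hp
        rw [if_neg (by omega : ¬ d = 0), smul_zero, add_zero, zero_add]
        split_ifs
        · nth_rw 1 [h1]
          rw [C_mul', sub_self]
          exact zero_mem _
        · simp
      · rw [constantCoeff_of_mem_Inv hp hi.ne', zero_smul, zero_add]
        rcases Nat.eq_zero_or_pos j with rfl | hj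
        · have h1 := eq_C_of_mem_Inv_zero hq
          rw [add_zero]
          split_ifs
          · nth_rw 1 [h1]
            rw [mul_comm, C_mul', sub_self]
            exact zero_mem _
          · simp
        · rw [constantCoeff_of_mem_Inv hq hj.ne', zero_smul, sub_zero]
          split_ifs with h
          · refine Submodule.mem_iSup_of_mem i (Submodule.mem_iSup_of_mem ?_ ?_)
            · rw [Finset.mem_Ico]
              omega
            · rw [h, Nat.add_sub_cancel_left]
              exact Submodule.mul_mem_mul hp hq
          · exact zero_mem _
    · convert add_mem h h' using 1
      simp only [mul_add, map_add, smul_add, add_smul]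
      abel
  · convert add_mem h h' using 1
    simp only [add_mul, map_add, smul_add, add_smul]
    abel

/-- The algebra of invariants. -/
def invariants (n : ℕ) : Subalgebra ℂ (Poly n) where
  carrier := {p | up n p = 0 ∧ down n p = 0}
  mul_mem' := fun ha hb => ⟨by rw [Derivation.leibniz, ha.1, hb.1, smul_zero, smul_zero, add_zero],
    by rw [Derivation.leibniz, ha.2, hb.2, smul_zero, smul_zero, add_zero]⟩
  add_mem' := fun ha hb => ⟨by rw [map_add, ha.1, hb.1, add_zero],
    by rw [map_add, ha.2, hb.2, add_zero]⟩
  algebraMap_mem' := fun r => ⟨Derivation.map_algebraMap _ r, Derivation.map_algebraMap _ r⟩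

theorem mem_invariants {n : ℕ} {p : Poly n} : p ∈ invariants n ↔ up n p = 0 ∧ down n p = 0 :=
  Iff.rfl

theorem Inv_le_invariants {n d : ℕ} {p : Poly n} (hp : p ∈ Inv n d) : p ∈ invariants n :=
  (mem_Inv.1 hp).2

/-- The projection onto the indecomposables in a finite set of degrees. -/
def indec (n : ℕ) (D : Finset ℕ) : Poly n →ₗ[ℂ] ((d : D) → Poly n ⧸ dec n d) :=
  LinearMap.pi fun d => (dec n d).mkQ ∘ₗ comp n ((d : ℕ), 0)

theorem indec_mem_span {n : ℕ} {S : Set (Poly n)} (hS : Algebra.adjoin ℂ S = invariants n)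
    {D : Finset ℕ} (hD : ∀ d ∈ D, 1 ≤ d) {p : Poly n} (hp : p ∈ invariants n) :
    indec n D p ∈ Submodule.span ℂ (indec n D '' S) := by
  have key : ∀ q ∈ Algebra.adjoin ℂ S, q ∈ ⨆ i : ℕ, Inv n i := fun q hq => by
    rw [hS] at hq
    exact mem_iSup_Inv hq.1 hq.2
  rw [← hS] at hp
  induction hp using Algebra.adjoin_induction with
  | mem x hx => exact Submodule.subset_span (Set.mem_image_of_mem _ hx)
  | algebraMap r =>
    have : indec n D (algebraMap ℂ _ r) = 0 := by
      ext d
      have h0 : (C r : Poly n) ∈ Inv n 0 :=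
        mem_Inv.2 ⟨isWeightedHomogeneous_C _ _, derivation_C _ _, derivation_C _ _⟩
      have := hD d d.2
      simp only [indec, LinearMap.pi_apply, LinearMap.comp_apply, algebraMap_eq]
      rw [comp_of_mem_Inv h0, if_neg (by omega), map_zero]
      rfl
    rw [this]
    exact zero_mem _
  | add x y _ _ hx hy => rw [map_add]; exact add_mem hx hy
  | mul x y hx' hy' hx hy =>
    have : indec n D (x * y) = constantCoeff x • indec n D y + constantCoeff y • indec n D x := by
      ext d
      have := comp_mul_sub_mem (hD d d.2) (key x hx') (key y hy')
      rw [← Submodule.Quotient.mk_eq_zero, Submodule.Quotient.mk_sub, sub_eq_zero] at this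
      exact this
    rw [this]
    exact add_mem (Submodule.smul_mem _ _ hy) (Submodule.smul_mem _ _ hx)

theorem finrank_map_mkQ_dec (n d : ℕ) :
    Module.finrank ℂ ((Inv n d).map (dec n d).mkQ) + Module.finrank ℂ (dec n d) = h n d := by
  have h1 := ((dec n d).mkQ.domRestrict (Inv n d)).finrank_range_add_finrank_ker
  rw [LinearMap.range_domRestrict, LinearMap.ker_domRestrict, Submodule.ker_mkQ] at h1
  rw [h, ← h1, (Submodule.comapSubtypeEquivOfLe (dec_le n d)).finrank_eq]

theorem sum_le_card {n : ℕ} {S : Finset (Poly n)}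
    (hS : Algebra.adjoin ℂ (S : Set (Poly n)) = invariants n)
    {D : Finset ℕ} (hD : ∀ d ∈ D, 1 ≤ d) :
    ∑ d ∈ D, (h n d - Module.finrank ℂ (dec n d)) ≤ S.card := by
  classical
  let N (d : D) : Submodule ℂ (Poly n ⧸ dec n d) := (Inv n d).map (dec n d).mkQ
  let L := Submodule.span ℂ (indec n D '' (S : Set (Poly n)))
  have : Module.Finite ℂ L := Module.Finite.span_of_finite ℂ (S.finite_toSet.image _)
  let ι : ((d : D) → N d) →ₗ[ℂ] ((d : D) → Poly n ⧸ dec n d) :=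
    LinearMap.pi fun d => (N d).subtype ∘ₗ LinearMap.proj d
  have hι : Function.Injective ι := fun x y hxy => by
    ext d
    exact congrFun hxy d
  have hL : ∀ x, ι x ∈ L := by
    intro x
    choose y hy hy' using fun d : D => (x d).2
    have e : ι x = indec n D (∑ d : D, y d) := by
      ext d
      simp only [indec, LinearMap.pi_apply, LinearMap.comp_apply, map_sum]
      rw [Finset.sum_eq_single d]
      · rw [comp_of_mem_Inv (hy d), if_pos rfl, hy']
        rfl
      · intro e _ he
        rw [comp_of_mem_Inv (hy e), if_neg fun h => he (Subtype.ext h.symm), map_zero]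
      · simp
    rw [e]
    exact indec_mem_span hS hD (sum_mem fun d _ => Inv_le_invariants (hy d))
  have h1 := LinearMap.finrank_le_finrank_of_injective (f := ι.codRestrict L hL)
    fun x y hxy => hι (congrArg Subtype.val hxy)
  have h2 : Module.finrank ℂ L ≤ S.card := by
    have := finrank_span_finset_le_card (R := ℂ) (S.image (indec n D))
    rw [Finset.coe_image] at this
    exact this.trans Finset.card_image_le
  have (d : D) : Module.Finite ℂ (N d) := inferInstanceAs (Module.Finite ℂ ((Inv n d).map _))
  have (d : D) : Module.Free ℂ (N d) := Module.Free.of_divisionRing _ _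
  rw [Module.finrank_pi_fintype] at h1
  rw [← Finset.sum_coe_sort]
  refine le_trans (Finset.sum_le_sum fun d _ => ?_) (h1.trans h2)
  have := finrank_map_mkQ_dec n d
  exact Nat.sub_le_of_le_add this.ge

theorem sum_range_eq_list (f : ℕ → ℕ) (d : ℕ) :
    ∑ i ∈ Finset.range d, f i = ((List.range d).map f).sum := by
  induction d with
  | zero => rfl
  | succ d ih => rw [Finset.sum_range_succ, List.range_succ, List.map_append, List.sum_append, ih]; simp

theorem coeff_gauss_le (k d s : ℕ) : (gauss k d).coeff s ≤ 2 ^ (k + d) := by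
  induction k generalizing d s with
  | zero =>
    cases d with
    | zero =>
      rw [gauss_zero_right, Polynomial.coeff_one]
      split_ifs <;> simp
    | succ d => simp [gauss_zero_succ]
  | succ k ihk =>
    induction d generalizing s with
    | zero =>
      rw [gauss_zero_right, Polynomial.coeff_one]
      split_ifs
      · exact Nat.one_le_two_pow
      · simp
    | succ d ihd =>
      rw [gauss_succ, Polynomial.coeff_add, Polynomial.coeff_X_pow_mul']
      have h1 := ihk (d + 1) s
      have h2 : (if k ≤ s then (gauss (k + 1) d).coeff (s - k) else 0) ≤ 2 ^ (k + 1 + d) := by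
        split_ifs
        · exact ihd _
        · simp
      calc _ ≤ 2 ^ (k + (d + 1)) + 2 ^ (k + 1 + d) := add_le_add h1 h2
        _ = 2 ^ (k + 1 + (d + 1)) := by ring

theorem eval_div_pow_mod {B : ℕ} (hB : 0 < B) (p : Polynomial ℕ) (hp : ∀ s, p.coeff s < B)
    (s : ℕ) : p.eval B / B ^ s % B = p.coeff s := by
  induction s generalizing p with
  | zero =>
    rw [pow_zero, Nat.div_one]
    nth_rw 1 [← Polynomial.divX_mul_X_add p]
    simp [Nat.mod_eq_of_lt (hp 0)]
  | succ s ih =>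
    have h1 : p.eval B / B = p.divX.eval B := by
      nth_rw 1 [← Polynomial.divX_mul_X_add p]
      simp only [Polynomial.eval_add, Polynomial.eval_mul, Polynomial.eval_X, Polynomial.eval_C]
      rw [add_comm, Nat.add_mul_div_right _ _ hB, Nat.div_eq_of_lt (hp 0), zero_add]
    rw [pow_succ', ← Nat.div_div_eq_div_mul, h1, ih _ fun s => by
      rw [Polynomial.coeff_divX]; exact hp _, Polynomial.coeff_divX]

/-- Identity function which makes the kernel evaluate a numeral. -/
def force {α : Type} (c : ℕ) (f : ℕ → α) : α :=
  match c with
  | 0 => f 0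
  | m + 1 => f (m + 1)

theorem force_eq {α : Type} (c : ℕ) (f : ℕ → α) : force c f = f c := by
  cases c <;> rfl

/-- Evaluation of all the entries of a list. -/
def forceList {α : Type} : List ℕ → (List ℕ → α) → α
  | [], f => f []
  | a :: l, f => force a fun a => forceList l fun l => f (a :: l)

theorem forceList_eq {α : Type} (l : List ℕ) (f : List ℕ → α) : forceList l f = f l := by
  induction l generalizing f with
  | nil => rfl
  | cons a l ih => rw [forceList, force_eq, ih]

/-- One step of the recursion for the Gaussian polynomials, evaluated at `2 ^ 128`. -/
def gaussStep (b : ℕ) : ℕ → List ℕ → List ℕ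
  | _, [] => []
  | a, c :: l => force (c + b * a) fun e => e :: gaussStep b e l

/-- The values at `2 ^ 128` of the Gaussian polynomials of degrees at most `D`. -/
def gaussRow (D : ℕ) : ℕ → List ℕ
  | 0 => 1 :: List.replicate D 0
  | k + 1 => 1 :: gaussStep ((2 ^ 128) ^ k) 1 (gaussRow D k).tail

/-- A list consists of the values of the Gaussian polynomials in `k` variables. -/
def IsRow (k : ℕ) : ℕ → List ℕ → Prop
  | _, [] => True
  | d, c :: l => c = (gauss k d).eval (2 ^ 128) ∧ IsRow k (d + 1) l

theorem isRow_gaussStep {k d : ℕ} {l : List ℕ} (hl : IsRow k (d + 1) l) {a : ℕ}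
    (ha : a = (gauss (k + 1) d).eval (2 ^ 128)) :
    IsRow (k + 1) (d + 1) (gaussStep ((2 ^ 128) ^ k) a l) := by
  induction l generalizing d a with
  | nil => trivial
  | cons c l ih =>
    rw [gaussStep, force_eq]
    have : c + (2 ^ 128) ^ k * a = (gauss (k + 1) (d + 1)).eval (2 ^ 128) := by
      rw [gauss_succ, hl.1, ha]
      simp only [Polynomial.eval_add, Polynomial.eval_mul, Polynomial.eval_pow, Polynomial.eval_X]
    exact ⟨this, ih hl.2 this⟩

theorem isRow_gaussRow (D k : ℕ) : IsRow k 0 (gaussRow D k) := by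
  induction k with
  | zero =>
    refine ⟨by simp [gauss_zero_right], ?_⟩
    have : ∀ m d, IsRow 0 (d + 1) (List.replicate m 0) := by
      intro m
      induction m with
      | zero => exact fun _ => trivial
      | succ m ih => exact fun d => ⟨by simp [gauss_zero_succ], ih _⟩
    exact this D 0
  | succ k ih =>
    refine ⟨by simp [gauss_zero_right], isRow_gaussStep ?_ (by simp [gauss_zero_right])⟩
    cases h : gaussRow D k with
    | nil => trivial
    | cons c l =>
      rw [h] at ih
      exact ih.2

theorem length_gaussRow (D k : ℕ) : (gaussRow D k).length = D + 1 := by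
  have : ∀ b a l, (gaussStep b a l).length = l.length := by
    intro b a l
    induction l generalizing a with
    | nil => rfl
    | cons c l ih => rw [gaussStep, force_eq, List.length_cons, ih, List.length_cons]
  induction k with
  | zero => simp [gaussRow]
  | succ k ih => rw [gaussRow, List.length_cons, this, List.length_tail, ih, Nat.add_sub_cancel]

/-- The dimensions of the spaces of invariants, from the values of Gaussian polynomials. -/
def hOfRow (n : ℕ) : ℕ → List ℕ → List ℕ
  | _, [] => []
  | d, c :: l =>
    (if n * d % 2 = 1 then 0 else if n * d = 0 then 1 else
      c / (2 ^ 128) ^ (n * d / 2) % 2 ^ 128 - c / (2 ^ 128) ^ (n * d / 2 - 1) % 2 ^ 128) ::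
      hOfRow n (d + 1) l

/-- The dimensions of the spaces of invariants of degree at most `D`. -/
def hList (n D : ℕ) : List ℕ := forceList (gaussRow D (n + 1)) (hOfRow n 0)

theorem h_of_mul_eq_zero {n d : ℕ} (e : n * d = 0) : h n d = 1 := by
  have e' : (n : ℤ) * d = 0 := by exact_mod_cast e
  have h1 := finrank_Inv_add n d
  have h2 := dimW_eq n d 0
  have h3 := dimW_eq_zero_of_neg n d (-1) (by norm_num)
  have h4 : (gauss (n + 1) d).coeff 0 = 1 := by
    rcases Nat.mul_eq_zero.1 e with rfl | rfl
    · rw [gauss_symm, gauss_zero_right]; simp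
    · rw [gauss_zero_right]; simp
  rw [e'] at h2 h3
  norm_num at h2 h3
  unfold h
  omega

theorem hOfRow_getD {n D d e i : ℕ} {l : List ℕ} (hl : IsRow (n + 1) d l) (hi : i < l.length)
    (he : d + l.length ≤ D + 1) (hD : n + D < 127) (hde : e = d + i) :
    (hOfRow n d l).getD i 0 = h n e := by
  induction l generalizing d i with
  | nil => simp at hi
  | cons c l ih =>
    cases i with
    | zero =>
      rw [hOfRow, List.getD_cons_zero]
      obtain rfl : e = d := hde
      have hb : ∀ s, (gauss (n + 1) e).coeff s < 2 ^ 128 := fun s =>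
        (coeff_gauss_le _ _ s).trans_lt (Nat.pow_lt_pow_right (by norm_num) (by
          simp only [List.length_cons] at he; omega))
      have h2 := eval_div_pow_mod (by norm_num) _ hb
      rw [← hl.1] at h2
      rw [h2, h2]
      split_ifs with h3 h4
      · exact (h_eq_zero_of_odd (by omega)).symm
      · exact (h_of_mul_eq_zero h4).symm
      · have h5 := h_eq_of_two_mul (n := n) (d := e) (s := n * e / 2 - 1) (by omega)
        rw [show n * e / 2 - 1 + 1 = n * e / 2 by omega] at h5
        omega
    | succ i =>
      rw [hOfRow, List.getD_cons_succ]
      simp only [List.length_cons] at hi he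
      exact ih hl.2 (by omega) (by omega) (by omega)

theorem hList_getD {n D d : ℕ} (hd : d ≤ D) (hD : n + D < 127) :
    (hList n D).getD d 0 = h n d := by
  rw [hList, forceList_eq]
  exact hOfRow_getD (isRow_gaussRow D (n + 1)) (by rw [length_gaussRow]; omega)
    (by rw [length_gaussRow]; omega) hD (zero_add d).symm

/-- Upper bound for the dimension of the decomposable part. -/
def crude (f : ℕ → ℕ) (d : ℕ) : ℕ :=
  ((List.range d).map fun i => if i = 0 then 0 else if 2 * i < d then f i * f (d - i) else
    if 2 * i = d then f i * (f i + 1) / 2 else 0).sum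

theorem finrank_mul_le {A : Type*} [CommRing A] [Algebra ℂ A] (M N : Submodule ℂ A)
    [Module.Finite ℂ M] [Module.Finite ℂ N] :
    Module.finrank ℂ (M * N : Submodule ℂ A) ≤ Module.finrank ℂ M * Module.finrank ℂ N := by
  let b := Module.finBasis ℂ M
  let c := Module.finBasis ℂ N
  have hM : Submodule.span ℂ (Set.range fun i => (b i : A)) = M := by
    have := congrArg (Submodule.map M.subtype) b.span_eq
    rw [Submodule.map_span, Submodule.map_top, Submodule.range_subtype, ← Set.range_comp] at this
    exact this
  have hN : Submodule.span ℂ (Set.range fun i => (c i : A)) = N := by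
    have := congrArg (Submodule.map N.subtype) c.span_eq
    rw [Submodule.map_span, Submodule.map_top, Submodule.range_subtype, ← Set.range_comp] at this
    exact this
  have h1 : M * N = Submodule.span ℂ (Set.range fun p : Fin _ × Fin _ =>
      (b p.1 : A) * (c p.2 : A)) := by
    nth_rw 1 [← hM, ← hN]
    rw [Submodule.span_mul_span]
    congr 1
    ext x
    simp [Set.mem_mul]
  rw [h1]
  refine (finrank_range_le_card _).trans ?_
  simp

theorem finrank_mul_self_le {A : Type*} [CommRing A] [Algebra ℂ A] (M : Submodule ℂ A)
    [Module.Finite ℂ M] :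
    Module.finrank ℂ (M * M : Submodule ℂ A) ≤
      Module.finrank ℂ M * (Module.finrank ℂ M + 1) / 2 := by
  let b := Module.finBasis ℂ M
  have hM : Submodule.span ℂ (Set.range fun i => (b i : A)) = M := by
    have := congrArg (Submodule.map M.subtype) b.span_eq
    rw [Submodule.map_span, Submodule.map_top, Submodule.range_subtype, ← Set.range_comp] at this
    exact this
  have h1 : M * M = Submodule.span ℂ (Set.range fun p : Sym2 (Fin _) =>
      Sym2.lift ⟨fun i j => (b i : A) * (b j : A), fun i j => mul_comm _ _⟩ p) := by
    conv_lhs => rw [← hM]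
    rw [Submodule.span_mul_span]
    congr 1
    ext x
    simp only [Set.mem_mul, Set.mem_range, Sym2.exists, Sym2.lift_mk]
    constructor
    · rintro ⟨_, ⟨i, rfl⟩, _, ⟨j, rfl⟩, rfl⟩
      exact ⟨i, j, rfl⟩
    · rintro ⟨i, j, rfl⟩
      exact ⟨_, ⟨i, rfl⟩, _, ⟨j, rfl⟩, rfl⟩
  rw [h1]
  refine (finrank_range_le_card _).trans ?_
  rw [Sym2.card, Fintype.card_fin, Nat.choose_two_right, Nat.add_sub_cancel, mul_comm]

instance finite_Inv_mul (n i j : ℕ) : Module.Finite ℂ (Inv n i * Inv n j : Submodule ℂ (Poly n)) :=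
  Submodule.finiteDimensional_of_le (Inv_mul_le n i j)

instance finite_dec (n d : ℕ) : Module.Finite ℂ (dec n d) :=
  Submodule.finiteDimensional_of_le (dec_le n d)

theorem finrank_finset_sup_le {M ι : Type*} [AddCommGroup M] [Module ℂ M] (s : Finset ι)
    (f : ι → Submodule ℂ M) [∀ i, Module.Finite ℂ (f i)] :
    Module.finrank ℂ (s.sup f : Submodule ℂ M) ≤ ∑ i ∈ s, Module.finrank ℂ (f i) := by
  classical
  induction s using Finset.induction_on with
  | empty => simp
  | insert a s ha ih =>
    rw [Finset.sup_insert, Finset.sum_insert ha]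
    have : Module.Finite ℂ (s.sup f : Submodule ℂ M) := by
      exact Submodule.finiteDimensional_finset_sup _ _
    exact (Submodule.finrank_add_le_finrank_add_finrank _ _).trans (Nat.add_le_add_left ih _)

theorem dec_le_sup (n d : ℕ) :
    dec n d ≤ ((Finset.range d).filter fun i => 1 ≤ i ∧ 2 * i ≤ d).sup
      fun i => Inv n i * Inv n (d - i) := by
  refine iSup₂_le fun i hi => ?_
  rw [Finset.mem_Ico] at hi
  rcases le_or_gt (2 * i) d with h | h
  · exact Finset.le_sup (f := fun i => Inv n i * Inv n (d - i)) (by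
      rw [Finset.mem_filter, Finset.mem_range]; omega)
  · have := Finset.le_sup (s := (Finset.range d).filter fun i => 1 ≤ i ∧ 2 * i ≤ d)
      (f := fun i => Inv n i * Inv n (d - i)) (b := d - i) (by
        rw [Finset.mem_filter, Finset.mem_range]; omega)
    simp only [Nat.sub_sub_self hi.2.le] at this
    rwa [mul_comm] at this

theorem finrank_dec_le (n d : ℕ) : Module.finrank ℂ (dec n d) ≤ crude (h n) d := by
  have hf : Module.Finite ℂ (((Finset.range d).filter fun i => 1 ≤ i ∧ 2 * i ≤ d).sup
      fun i => Inv n i * Inv n (d - i) : Submodule ℂ (Poly n)) := by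
    exact Submodule.finiteDimensional_finset_sup _ _
  refine (Submodule.finrank_mono (dec_le_sup n d)).trans ((finrank_finset_sup_le _ _).trans ?_)
  rw [Finset.sum_filter, crude, ← sum_range_eq_list]
  refine Finset.sum_le_sum fun i _ => ?_
  rcases Nat.eq_zero_or_pos i with rfl | hi
  · simp
  rw [if_neg hi.ne']
  rcases lt_trichotomy (2 * i) d with h | h | h
  · rw [if_pos ⟨hi, h.le⟩, if_pos h]
    exact finrank_mul_le _ _
  · rw [if_pos ⟨hi, h.le⟩, if_neg (by omega), if_pos h, show d - i = i by omega]
    exact finrank_mul_self_le _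
  · rw [if_neg (by omega)]
    exact Nat.zero_le _

/-- Lower bound for the number of generators of degree at most `D`. -/
def crudeSum (f : ℕ → ℕ) (D : ℕ) : ℕ :=
  ((List.range (D + 1)).map fun d => if d = 0 then 0 else f d - crude f d).sum

theorem crude_congr {f g : ℕ → ℕ} {d : ℕ} (hfg : ∀ i < d, f i = g i) : crude f d = crude g d := by
  rw [crude, crude]
  congr 1
  refine List.map_congr_left fun i hi => ?_
  rw [List.mem_range] at hi
  rcases Nat.eq_zero_or_pos i with rfl | h0
  · simp
  · rw [hfg i hi, hfg (d - i) (by omega)]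

theorem crudeSum_le_card {n : ℕ} {S : Finset (Poly n)}
    (hS : Algebra.adjoin ℂ (S : Set (Poly n)) = invariants n) (D : ℕ) :
    crudeSum (h n) D ≤ S.card := by
  refine le_trans ?_ (sum_le_card hS (D := Finset.Ico 1 (D + 1))
    fun d hd => (Finset.mem_Ico.1 hd).1)
  have e : Finset.Ico 1 (D + 1) = (Finset.range (D + 1)).filter fun d => ¬ d = 0 := by
    ext d
    rw [Finset.mem_Ico, Finset.mem_filter, Finset.mem_range]
    omega
  rw [e, Finset.sum_filter, crudeSum, ← sum_range_eq_list]
  refine Finset.sum_le_sum fun d _ => ?_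
  by_cases hd : d = 0
  · simp [hd]
  · rw [if_neg hd, if_pos hd]
    exact Nat.sub_le_sub_left (finrank_dec_le n d) _

/-- Test that there are many generators of degree at most `D`. -/
def manyGens (n D : ℕ) : Bool :=
  forceList (hList n D) fun l => decide (n + 99 ≤ crudeSum (fun d => l.getD d 0) D)

theorem le_card_of_manyGens {n D : ℕ} (hD : n + D < 127) (hm : manyGens n D = true)
    {S : Finset (Poly n)} (hS : Algebra.adjoin ℂ (S : Set (Poly n)) = invariants n) :
    n + 99 ≤ S.card := by
  rw [manyGens, forceList_eq, decide_eq_true_eq] at hm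
  refine hm.trans (le_trans (le_of_eq ?_) (crudeSum_le_card hS D))
  rw [crudeSum, crudeSum]
  congr 1
  refine List.map_congr_left fun d hd => ?_
  rw [List.mem_range] at hd
  rw [hList_getD (by omega) hD]
  congr 2
  exact crude_congr fun i hi => hList_getD (by omega) hD

theorem manyGens_of_le_fifteen : ∀ n < 16, 11 ≤ n → n ≠ 12 → manyGens n 14 = true := by
  decide +kernel

theorem manyGens_of_le_twentyTwo : ∀ n < 23, 16 ≤ n → manyGens n 10 = true := by
  decide +kernel

theorem manyGens_of_le_eightyEight : ∀ n < 89, 23 ≤ n → manyGens n 8 = true := by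
  decide +kernel

theorem gauss_eq_sum (k d : ℕ) :
    gauss (k + 1) d = ∑ j ∈ Finset.range (d + 1), Polynomial.X ^ j * gauss k j := by
  induction d with
  | zero => simp [gauss_zero_right]
  | succ d ih => rw [gauss_succ', ih, Finset.sum_range_succ _ (d + 1)]

theorem coeff_gauss_succ (k d s : ℕ) : (gauss (k + 1) d).coeff s =
    ∑ j ∈ Finset.range (d + 1), if j ≤ s then (gauss k j).coeff (s - j) else 0 := by
  simp only [gauss_eq_sum, Polynomial.finsetSum_coeff, Polynomial.coeff_X_pow_mul']

theorem gauss_one (d : ℕ) : gauss 1 d = 1 := by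
  rw [gauss_eq_sum, Finset.sum_range_succ']
  simp [gauss_zero_succ, gauss_zero_right]

theorem coeff_gauss_two (d s : ℕ) : (gauss 2 d).coeff s = if s ≤ d then 1 else 0 := by
  rw [coeff_gauss_succ]
  simp only [gauss_one, Polynomial.coeff_one]
  have : ∀ j, (if j ≤ s then if s - j = 0 then 1 else 0 else 0) = if s = j then 1 else 0 := by
    intro j
    split_ifs <;> omega
  simp only [this, Finset.sum_ite_eq, Finset.mem_range, Nat.lt_succ_iff]

theorem coeff_gauss_three (d s : ℕ) : (gauss 3 d).coeff s =
    ((Finset.range (d + 1)).filter fun j => j ≤ s ∧ s ≤ 2 * j).card := by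
  rw [coeff_gauss_succ, Finset.card_filter]
  refine Finset.sum_congr rfl fun j _ => ?_
  rw [coeff_gauss_two]
  split_ifs <;> omega

theorem coeff_gauss_four (d s : ℕ) : (gauss 4 d).coeff s =
    ((Finset.range (d + 1) ×ˢ Finset.range (d + 1)).filter fun p =>
      p.2 ≤ p.1 ∧ p.1 + p.2 ≤ s ∧ s ≤ p.1 + 2 * p.2).card := by
  rw [coeff_gauss_succ, Finset.card_filter, Finset.sum_product]
  refine Finset.sum_congr rfl fun j hj => ?_
  rw [Finset.mem_range] at hj
  rw [coeff_gauss_three, ← Finset.card_filter]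
  split_ifs with h
  · congr 1
    ext i
    simp only [Finset.mem_filter, Finset.mem_range]
    omega
  · symm
    rw [Finset.card_eq_zero, Finset.filter_eq_empty_iff]
    intro i _
    dsimp only
    omega

theorem h_one_right {n : ℕ} (hn : 1 ≤ n) : h n 1 = 0 := by
  rw [h_symm]
  by_cases h2 : 2 ∣ 1 * n
  · obtain ⟨e, he⟩ := h2
    have := h_eq_of_two_mul (n := 1) (d := n) (s := e - 1) (by omega)
    rw [coeff_gauss_two, coeff_gauss_two, if_pos (by omega), if_pos (by omega)] at this
    omega
  · exact h_eq_zero_of_odd h2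

theorem h_two_right_le {n : ℕ} (hn : 1 ≤ n) : h n 2 ≤ 1 := by
  rw [h_symm]
  obtain ⟨m, rfl⟩ : ∃ m, n = m + 1 := ⟨n - 1, by omega⟩
  have := h_eq_of_two_mul (n := 2) (d := m + 1) (s := m) rfl
  rw [coeff_gauss_three, coeff_gauss_three] at this
  have h1 : ((Finset.range (m + 1 + 1)).filter fun j => j ≤ m + 1 ∧ m + 1 ≤ 2 * j) ⊆
      insert (m + 1) ((Finset.range (m + 1 + 1)).filter fun j => j ≤ m ∧ m ≤ 2 * j) := by
    intro j
    simp only [Finset.mem_insert, Finset.mem_filter, Finset.mem_range]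
    omega
  have h2 := (Finset.card_le_card h1).trans (Finset.card_insert_le _ _)
  omega

theorem h_three_right_le {n : ℕ} (hn : 1 ≤ n) : h n 3 ≤ 1 := by
  rw [h_symm]
  by_cases h2 : 2 ∣ 3 * n
  · obtain ⟨e, rfl⟩ : ∃ e, n = 2 * (e + 1) := ⟨n / 2 - 1, by omega⟩
    have := h_eq_of_two_mul (n := 3) (d := 2 * (e + 1)) (s := 3 * e + 2) (by ring)
    rw [coeff_gauss_four, coeff_gauss_four] at this
    set S := (Finset.range (2 * (e + 1) + 1) ×ˢ Finset.range (2 * (e + 1) + 1)).filter fun p =>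
      p.2 ≤ p.1 ∧ p.1 + p.2 ≤ 3 * e + 2 + 1 ∧ 3 * e + 2 + 1 ≤ p.1 + 2 * p.2 with hS
    set T := (Finset.range (2 * (e + 1) + 1) ×ˢ Finset.range (2 * (e + 1) + 1)).filter fun p =>
      p.2 ≤ p.1 ∧ p.1 + p.2 ≤ 3 * e + 2 ∧ 3 * e + 2 ≤ p.1 + 2 * p.2 with hT
    have h3 : (S.erase (e + 1, e + 1)).card ≤ T.card := by
      refine Finset.card_le_card_of_injOn
        (fun p => if p.1 = p.2 then (2 * (e + 1), 2 * (e + 1) - p.1) else (p.1 - 1, p.2)) ?_ ?_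
      · rintro ⟨j, i⟩ hp
        simp only [hS, Finset.coe_erase, Finset.coe_filter, Finset.mem_product, Finset.mem_range,
          Set.mem_sdiff, Set.mem_ofPred_eq, Set.mem_singleton_iff, Prod.mk.injEq] at hp
        rw [Finset.mem_coe]
        dsimp only
        split_ifs with h <;>
          · simp only [hT, Finset.mem_filter, Finset.mem_product, Finset.mem_range]
            omega
      · rintro ⟨j, i⟩ hp ⟨j', i'⟩ hp' h
        simp only [hS, Finset.coe_erase, Finset.coe_filter, Finset.mem_product, Finset.mem_range,
          Set.mem_sdiff, Set.mem_ofPred_eq, Set.mem_singleton_iff, Prod.mk.injEq] at hp hp'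
        dsimp only at h
        split_ifs at h <;> simp only [Prod.mk.injEq] at h ⊢ <;> omega
    have h4 := Finset.pred_card_le_card_erase (s := S) (a := (e + 1, e + 1))
    omega
  · exact (h_eq_zero_of_odd h2).le.trans zero_le_one

theorem exists_degrees {σ : Type*} (m : MonomialOrder σ) (N : ℕ)
    (V : Submodule ℂ (MvPolynomial σ ℂ)) [Module.Finite ℂ V] (hV : Module.finrank ℂ V = N) :
    ∃ s : Finset m.syn, s.card = N ∧ ∀ e ∈ s, ∃ f ∈ V, f ≠ 0 ∧ m.toSyn (m.degree f) = e := by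
  classical
  induction N generalizing V with
  | zero => exact ⟨∅, by simp⟩
  | succ N ih =>
    have hV0 : V ≠ ⊥ := by
      rintro rfl
      simp at hV
    obtain ⟨f, hfV, hf0⟩ := Submodule.exists_mem_ne_zero_of_ne_bot hV0
    let b := Module.finBasis ℂ V
    let U := Finset.univ.biUnion fun i => (b i : MvPolynomial σ ℂ).support
    have hU : ∀ g ∈ V, g.support ⊆ U := by
      intro g hg c hc
      by_contra hcU
      refine mem_support_iff.1 hc ?_
      have h1 := congrArg (Subtype.val) (b.sum_repr ⟨g, hg⟩)
      rw [AddSubmonoidClass.coe_finsetSum] at h1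
      change _ = g at h1
      rw [← h1, coeff_sum]
      refine Finset.sum_eq_zero fun i _ => ?_
      rw [SetLike.val_smul, coeff_smul]
      have : coeff c (b i : MvPolynomial σ ℂ) = 0 := by
        by_contra h2
        exact hcU (Finset.mem_biUnion.2 ⟨i, Finset.mem_univ _, mem_support_iff.2 h2⟩)
      rw [this, smul_zero]
    obtain ⟨e, he, hmax⟩ := Finset.exists_max_image
      (U.filter fun e => ∃ g ∈ V, g ≠ 0 ∧ m.degree g = e) m.toSyn
      ⟨m.degree f, Finset.mem_filter.2 ⟨hU f hfV (m.degree_mem_support hf0), f, hfV, hf0, rfl⟩⟩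
    obtain ⟨g, hg, hg0, rfl⟩ := (Finset.mem_filter.1 he).2
    let φ : V →ₗ[ℂ] ℂ := (lcoeff ℂ (m.degree g)).comp V.subtype
    have hφ : LinearMap.range φ = ⊤ := by
      rw [LinearMap.range_eq_top]
      refine LinearMap.surjective fun h => m.coeff_degree_ne_zero_iff.2 hg0 ?_
      exact LinearMap.congr_fun h ⟨g, hg⟩
    have h1 := φ.finrank_range_add_finrank_ker
    rw [hφ, finrank_top, Module.finrank_self, hV] at h1
    let V' := (LinearMap.ker φ).map V.subtype
    have h2 : Module.finrank ℂ V' = N := by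
      rw [Submodule.finrank_map_subtype_eq]
      omega
    obtain ⟨s, hs, hs'⟩ := ih V' h2
    have hlt : ∀ e ∈ s, e < m.toSyn (m.degree g) := by
      intro e he
      obtain ⟨k, ⟨k, hk, rfl⟩, hk0, rfl⟩ := hs' e he
      refine lt_of_le_of_ne (hmax _ (Finset.mem_filter.2
        ⟨hU _ k.2 (m.degree_mem_support hk0), _, k.2, hk0, rfl⟩)) fun h => ?_
      have h3 := m.toSyn.injective h
      refine m.coeff_degree_ne_zero_iff.2 hk0 ?_
      rw [h3]
      exact hk
    refine ⟨insert (m.toSyn (m.degree g)) s, ?_, ?_⟩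
    · rw [Finset.card_insert_of_notMem fun h => (hlt _ h).false, hs]
    · intro e he
      rcases Finset.mem_insert.1 he with rfl | he
      · exact ⟨g, hg, hg0, rfl⟩
      · obtain ⟨k, ⟨k, hk, rfl⟩, hk0, rfl⟩ := hs' e he
        exact ⟨_, k.2, hk0, rfl⟩

theorem card_le_finrank_of_degrees {σ : Type*} (m : MonomialOrder σ)
    (V : Submodule ℂ (MvPolynomial σ ℂ)) [Module.Finite ℂ V] (s : Finset m.syn)
    (hs : ∀ e ∈ s, ∃ f ∈ V, f ≠ 0 ∧ m.toSyn (m.degree f) = e) : s.card ≤ Module.finrank ℂ V := by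
  choose! f hfV hf0 hfe using hs
  have hli : LinearIndependent ℂ fun e : s => (⟨f e, hfV e e.2⟩ : V) := by
    rw [linearIndependent_iff']
    intro t c hc
    by_contra! hne
    obtain ⟨i, hi, hci⟩ := hne
    have hne : (t.filter fun i => c i ≠ 0).Nonempty := ⟨i, Finset.mem_filter.2 ⟨hi, hci⟩⟩
    obtain ⟨e, he, hmax⟩ := Finset.exists_max_image _ (fun i : s => (i : m.syn)) hne
    rw [Finset.mem_filter] at he
    have h1 := congrArg (fun v : V => (v : MvPolynomial σ ℂ).coeff (m.degree (f e))) hc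
    simp only [AddSubmonoidClass.coe_finsetSum, SetLike.val_smul, coeff_sum, coeff_smul,
      ZeroMemClass.coe_zero, coeff_zero] at h1
    rw [Finset.sum_eq_single_of_mem e he.1] at h1
    · rcases smul_eq_zero.1 h1 with h2 | h2
      · exact he.2 h2
      · exact m.coeff_degree_ne_zero_iff.2 (hf0 e e.2) h2
    · intro j hj hje
      by_cases hcj : c j = 0
      · rw [hcj, zero_smul]
      · rw [m.coeff_eq_zero_of_lt, smul_zero]
        rw [hfe e e.2, hfe j j.2]
        exact lt_of_le_of_ne (hmax j (Finset.mem_filter.2 ⟨hj, hcj⟩)) fun h => hje (Subtype.ext h)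
  simpa using hli.fintype_card_le_finrank

theorem finrank_add_le_finrank_mul {σ : Type*} [LinearOrder σ] [WellFoundedGT σ]
    (V U : Submodule ℂ (MvPolynomial σ ℂ))
    [Module.Finite ℂ V] [Module.Finite ℂ U] [Module.Finite ℂ (V * U : Submodule ℂ _)]
    (hV : 0 < Module.finrank ℂ V) (hU : 0 < Module.finrank ℂ U) :
    Module.finrank ℂ V + Module.finrank ℂ U ≤
      Module.finrank ℂ (V * U : Submodule ℂ (MvPolynomial σ ℂ)) + 1 := by
  classical
  let m : MonomialOrder σ := MonomialOrder.lex
  obtain ⟨s, hs, hs'⟩ := exists_degrees m _ V rfl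
  obtain ⟨t, ht, ht'⟩ := exists_degrees m _ U rfl
  open scoped Pointwise in
  have h1 : s.card + t.card - 1 ≤ (s + t).card :=
    cauchy_davenport_add_of_linearOrder_isCancelAdd (Finset.card_pos.1 (by omega))
      (Finset.card_pos.1 (by omega))
  open scoped Pointwise in
  have h2 : (s + t).card ≤ Module.finrank ℂ (V * U : Submodule ℂ (MvPolynomial σ ℂ)) := by
    refine card_le_finrank_of_degrees m _ _ fun e he => ?_
    obtain ⟨a, ha, b, hb, rfl⟩ := Finset.mem_add.1 he
    obtain ⟨f, hf, hf0, rfl⟩ := hs' a ha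
    obtain ⟨g, hg, hg0, rfl⟩ := ht' b hb
    exact ⟨f * g, Submodule.mul_mem_mul hf hg, mul_ne_zero hf0 hg0, by
      rw [m.degree_mul hf0 hg0, map_add]⟩
  omega

theorem h_six_add (n : ℕ) (hn : 0 < h n 6) : h n 6 + 23 ≤ h (n + 22) 6 := by
  have h22 : h 6 22 = 24 := by
    rw [← hList_getD (n := 6) (D := 22) le_rfl (by norm_num)]
    decide +kernel
  rw [h_symm n, h_symm (n + 22)]
  rw [h_symm n] at hn
  have h1 := finrank_add_le_finrank_mul (Inv 6 n) (Inv 6 22) hn (by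
    change 0 < h 6 22
    omega)
  have h2 := Submodule.finrank_mono (Inv_mul_le 6 n 22)
  have h3 : h 6 n + h 6 22 ≤ h 6 (n + 22) + 1 := h1.trans (Nat.add_le_add_right h2 1)
  omega

theorem le_h_six : ∀ n, 67 ≤ n → n + 101 ≤ h n 6 := by
  have h1 : ∀ n < 89, 67 ≤ n → n + 101 ≤ (hList n 6).getD 6 0 := by decide +kernel
  intro n
  induction n using Nat.strong_induction_on with
  | _ n ih =>
    intro hn
    rcases lt_or_ge n 89 with h | h
    · exact (h1 n h hn).trans (hList_getD le_rfl (by omega)).le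
    · have h2 := ih (n - 22) (by omega) (by omega)
      have h3 := h_six_add (n - 22) (by omega)
      rw [Nat.sub_add_cancel (by omega)] at h3
      omega

theorem le_card_of_sixtySeven_le {n : ℕ} (hn : 67 ≤ n) {S : Finset (Poly n)}
    (hS : Algebra.adjoin ℂ (S : Set (Poly n)) = invariants n) : n + 99 ≤ S.card := by
  refine le_trans ?_ (crudeSum_le_card hS 6)
  have h1 := h_one_right (n := n) (by omega)
  have h2 := h_two_right_le (n := n) (by omega)
  have h3 := h_three_right_le (n := n) (by omega)
  have h6 := le_h_six n hn
  have c4 : crude (h n) 4 ≤ 1 := by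
    simp [crude, List.range_succ, h1]
    interval_cases h n 2 <;> simp
  have c6 : crude (h n) 6 ≤ h n 4 + 1 := by
    simp [crude, List.range_succ, h1]
    interval_cases h n 2 <;> interval_cases h n 3 <;> simp
  simp [crudeSum, List.range_succ]
  omega

/-- Coefficients of the sixth transvectant of a form of degree `12` and a form of degree `k`. -/
def coef (k r s : ℕ) : ℤ :=
  if r ≤ k ∧ s ≤ r + 6 ∧ r ≤ s + 6 then
    ((List.range 7).map fun l => (if l % 2 = 0 then 1 else -1 : ℤ) *
      ((Nat.choose 6 l * (12 - (r + 6 - s)).descFactorial (6 - l) * (r + 6 - s).descFactorial l *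
        (k - s).descFactorial l * s.descFactorial (6 - l) : ℕ) : ℤ)).sum
  else 0

/-- Entries of the matrix of the sixth transvectant. -/
def ent (k r s : ℕ) : Poly 12 := (coef k r s : ℂ) • var 12 (r + 6 - s)

/-- The sixth transvectant with a form of degree `12`, as an endomorphism of the space of forms of
degree `k`. -/
def matA (k : ℕ) : Matrix (Fin (k + 1)) (Fin (k + 1)) (Poly 12) := Matrix.of fun r s => ent k r s

/-- The operator `x ∂/∂y` on forms of degree `k`. -/
def matE (k : ℕ) : Matrix (Fin (k + 1)) (Fin (k + 1)) (Poly 12) :=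
  Matrix.of fun r s => if (r : ℕ) + 1 = s then C ((s : ℕ) : ℂ) else 0

/-- Traces of the powers of the sixth transvectant. -/
def T (k d : ℕ) : Poly 12 := (matA k ^ d).trace

theorem map_mul_derivation {m : Type*} [Fintype m] {n : ℕ} (D : Derivation ℂ (Poly n) (Poly n))
    (M N : Matrix m m (Poly n)) : (M * N).map D = M.map D * N + M * N.map D := by
  refine Matrix.ext fun i j => ?_
  simp only [Matrix.map_apply, Matrix.mul_apply, Matrix.add_apply, map_sum, Derivation.leibniz,
    smul_eq_mul]
  rw [← Finset.sum_add_distrib]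
  apply Finset.sum_congr rfl
  intro _ _
  ring

/-- Equivariance of the sixth transvectant. -/
def equivariant (k : ℕ) : Bool :=
  decide (∀ r < k + 1, ∀ s < k + 1, r + 7 ≤ s + 12 →
    (((r + 7 - s : ℕ) : ℤ)) * coef k r s =
      (r + 1) * coef k (r + 1) s - s * (if s = 0 then 0 else coef k r (s - 1)))

theorem coef_eq_zero {k r s : ℕ} (h : ¬ (r ≤ k ∧ s ≤ r + 6 ∧ r ≤ s + 6)) : coef k r s = 0 :=
  if_neg h

theorem matE_mul_apply (k : ℕ) (r s : Fin (k + 1)) :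
    (matE k * matA k) r s = ((r : ℕ) + 1 : ℂ) • ent k (r + 1) s := by
  rw [Matrix.mul_apply]
  by_cases hr : (r : ℕ) + 1 < k + 1
  · rw [Finset.sum_eq_single (⟨r + 1, hr⟩ : Fin (k + 1))]
    · simp [matE, matA, MvPolynomial.smul_eq_C_mul]
    · intro t _ ht
      rw [matE, Matrix.of_apply, if_neg, zero_mul]
      exact fun h => ht (Fin.ext h.symm)
    · simp
  · rw [Finset.sum_eq_zero, ent, coef_eq_zero (by omega)]
    · simp
    · intro t _
      rw [matE, Matrix.of_apply, if_neg (by omega), zero_mul]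

theorem mul_matE_apply (k : ℕ) (r s : Fin (k + 1)) :
    (matA k * matE k) r s = ((s : ℕ) : ℂ) • if (s : ℕ) = 0 then 0 else ent k r (s - 1) := by
  rw [Matrix.mul_apply]
  by_cases hs : (s : ℕ) = 0
  · rw [if_pos hs, smul_zero]
    refine Finset.sum_eq_zero fun t _ => ?_
    rw [matE, Matrix.of_apply, if_neg (by omega), mul_zero]
  · rw [if_neg hs, Finset.sum_eq_single (⟨s - 1, by omega⟩ : Fin (k + 1))]
    · rw [matE, Matrix.of_apply, if_pos (by dsimp only; omega), MvPolynomial.smul_eq_C_mul, mul_comm]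
      rfl
    · intro t _ ht
      rw [matE, Matrix.of_apply, if_neg, mul_zero]
      exact fun h => ht (Fin.ext (by dsimp only; omega))
    · simp

theorem up_matA {k : ℕ} (hk : equivariant k = true) :
    (matA k).map (up 12) = matE k * matA k - matA k * matE k := by
  rw [equivariant, decide_eq_true_eq] at hk
  refine Matrix.ext fun r s => ?_
  rw [Matrix.sub_apply, matE_mul_apply, mul_matE_apply, Matrix.map_apply, matA, Matrix.of_apply]
  have h1 : up 12 (ent k r s) = (((r + 7 - s : ℕ) * coef k r s : ℤ) : ℂ) • var 12 (r + 7 - s) := by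
    rw [ent, Derivation.map_smul, up_var]
    by_cases h : (s : ℕ) ≤ r + 6
    · rw [show (r : ℕ) + 7 - s = r + 6 - s + 1 by omega, smul_smul]
      push_cast
      rw [mul_comm]
    · rw [coef_eq_zero (by omega)]
      simp
  have h2 : (if (s : ℕ) = 0 then 0 else ent k r (s - 1)) =
      ((if (s : ℕ) = 0 then 0 else coef k r (s - 1) : ℤ) : ℂ) • var 12 (r + 7 - s) := by
    split_ifs with h
    · simp
    · rw [ent]
      by_cases h' : (s : ℕ) ≤ r + 7
      · rw [show (r : ℕ) + 6 - (s - 1) = r + 7 - s by omega]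
      · rw [coef_eq_zero (by omega)]
        simp
  rw [h1, h2, ent, show (r : ℕ) + 1 + 6 - s = r + 7 - s by omega, smul_smul, smul_smul, ← sub_smul]
  by_cases h : (r : ℕ) + 7 ≤ s + 12
  · rw [hk r r.2 s s.2 h]
    push_cast
    rfl
  · rw [var, dif_neg (by omega), smul_zero, smul_zero]

theorem up_matA_pow {k : ℕ} (hk : equivariant k = true) (d : ℕ) :
    (matA k ^ d).map (up 12) = matE k * matA k ^ d - matA k ^ d * matE k := by
  induction d with
  | zero =>
    refine Matrix.ext fun i j => ?_
    rw [pow_zero, Matrix.map_apply, Matrix.one_apply, mul_one, one_mul, sub_self]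
    split_ifs <;> simp
  | succ d ih =>
    rw [pow_succ, map_mul_derivation, ih, up_matA hk]
    noncomm_ring

theorem up_T {k : ℕ} (hk : equivariant k = true) (d : ℕ) : up 12 (T k d) = 0 := by
  have h1 : up 12 (T k d) = ((matA k ^ d).map (up 12)).trace := by
    simp [T, Matrix.trace, map_sum]
  rw [h1, up_matA_pow hk, Matrix.trace_sub, Matrix.trace_mul_comm, sub_self]

theorem ent_mem (k r s : ℕ) : ent k r s ∈ W 12 1 (2 * ((r : ℤ) - s)) := by
  by_cases h : s ≤ r + 6
  · have := var_mem 12 (r + 6 - s)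
    rw [show 2 * ((r + 6 - s : ℕ) : ℤ) - (12 : ℕ) = 2 * ((r : ℤ) - s) by omega] at this
    exact Submodule.smul_mem _ _ this
  · rw [ent, coef_eq_zero (by omega)]
    simp

theorem matA_pow_mem (k d : ℕ) (r s : Fin (k + 1)) :
    (matA k ^ d) r s ∈ W 12 d (2 * ((r : ℤ) - s)) := by
  induction d generalizing s with
  | zero =>
    rw [pow_zero, Matrix.one_apply]
    split_ifs with h
    · subst h
      rw [sub_self, mul_zero]
      exact isWeightedHomogeneous_one ℂ (wt 12)
    · exact Submodule.zero_mem _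
  | succ d ih =>
    rw [pow_succ, Matrix.mul_apply]
    refine Submodule.sum_mem _ fun t _ => ?_
    have := IsWeightedHomogeneous.mul (ih t) (ent_mem k t s)
    rw [show ((d : ℤ), 2 * ((r : ℤ) - t)) + (1, 2 * (((t : ℕ) : ℤ) - (s : ℕ))) =
      (((d + 1 : ℕ) : ℤ), 2 * ((r : ℤ) - s)) by ext <;> simp; ring] at this
    exact this

theorem T_mem_Inv {k : ℕ} (hk : equivariant k = true) (d : ℕ) : T k d ∈ Inv 12 d := by
  refine mem_Inv_of_up ?_ (up_T hk d)
  refine Submodule.sum_mem (W 12 d 0) fun i _ => ?_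
  have := matA_pow_mem k d i i
  rwa [sub_self, mul_zero] at this

theorem equivariant_six : equivariant 6 = true := by decide +kernel
theorem equivariant_eight : equivariant 8 = true := by decide +kernel
theorem equivariant_ten : equivariant 10 = true := by decide +kernel
theorem equivariant_twelve : equivariant 12 = true := by decide +kernel
theorem equivariant_fourteen : equivariant 14 = true := by decide +kernel
theorem equivariant_sixteen : equivariant 16 = true := by decide +kernel

/-- Evaluation at an integral point. -/
def ev (v : ℕ → ℤ) : Poly 12 →ₐ[ℂ] ℂ := aeval fun i => (v i : ℂ)

/-- The value at an integral point of the sixth transvectant. -/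
def matZ (k : ℕ) (v : ℕ → ℤ) : Matrix (Fin (k + 1)) (Fin (k + 1)) ℤ :=
  Matrix.of fun r s => coef k r s * v (r + 6 - s)

theorem ev_ent (k : ℕ) (v : ℕ → ℤ) (r s : ℕ) :
    ev v (ent k r s) = ((coef k r s * v (r + 6 - s) : ℤ) : ℂ) := by
  rw [ent, map_smul]
  by_cases h : r + 6 - s < 12 + 1
  · rw [var, dif_pos h, ev, aeval_X]
    simp
  · rw [coef_eq_zero (by omega)]
    simp

theorem map_ev_matA_pow (k d : ℕ) (v : ℕ → ℤ) :
    (matA k ^ d).map (ev v) = (matZ k v ^ d).map (Int.castRingHom ℂ) := by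
  have h1 : (matA k).map (ev v) = (matZ k v).map (Int.castRingHom ℂ) := by
    ext r s
    exact ev_ent k v r s
  have h2 := map_pow ((ev v).toRingHom.mapMatrix) (matA k) d
  have h3 := map_pow ((Int.castRingHom ℂ).mapMatrix) (matZ k v) d
  simp only [RingHom.mapMatrix_apply] at h2 h3
  rw [h3, ← h1]
  exact h2

theorem ev_T (k d : ℕ) (v : ℕ → ℤ) : ev v (T k d) = ((matZ k v ^ d).trace : ℤ) := by
  have h1 : ev v (T k d) = ((matA k ^ d).map (ev v)).trace := by
    simp [T, Matrix.trace, map_sum]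
  rw [h1, map_ev_matA_pow]
  simp [Matrix.trace]

/-- Derivative in the direction of an integral vector. -/
def dir (w : ℕ → ℤ) : Derivation ℂ (Poly 12) (Poly 12) :=
  mkDerivation ℂ fun i : Fin (12 + 1) => C (w i : ℂ)

theorem trace_pow_mul_map {m : Type*} [Fintype m] [DecidableEq m] {n : ℕ}
    (D : Derivation ℂ (Poly n) (Poly n)) (M : Matrix m m (Poly n)) (d j : ℕ) :
    (M ^ j * (M ^ (d + 1)).map D).trace = (d + 1) * (M ^ (j + d) * M.map D).trace := by
  induction d generalizing j with
  | zero => simp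
  | succ d ih =>
    rw [pow_succ M (d + 1), map_mul_derivation, mul_add, Matrix.trace_add, ← mul_assoc,
      Matrix.trace_mul_comm, ← mul_assoc, ← pow_succ', ih, ← mul_assoc, ← pow_add,
      show j + 1 + d = j + (d + 1) by ring]
    push_cast
    ring

theorem ev_dir_T (k d : ℕ) (v w : ℕ → ℤ) : ev v (dir w (T k (d + 1))) =
    ((((d : ℤ) + 1) * (matZ k v ^ d * matZ k w).trace : ℤ) : ℂ) := by
  have h1 : dir w (T k (d + 1)) = (matA k ^ 0 * (matA k ^ (d + 1)).map (dir w)).trace := by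
    simp [T, Matrix.trace, map_sum]
  have h2 : (matA k).map (dir w) = (matZ k w).map fun a => C (a : ℂ) := by
    refine Matrix.ext fun r s => ?_
    rw [Matrix.map_apply, Matrix.map_apply, matA, matZ, Matrix.of_apply, Matrix.of_apply, ent,
      Derivation.map_smul]
    by_cases h : (r : ℕ) + 6 - s < 12 + 1
    · rw [var, dif_pos h, dir, mkDerivation_X, MvPolynomial.smul_eq_C_mul, ← C_mul]
      simp
    · rw [coef_eq_zero (by omega)]
      simp
  rw [h1, trace_pow_mul_map, zero_add, h2, map_mul]
  have h3 : ev v ((matA k ^ d * (matZ k w).map fun a => C (a : ℂ)).trace) =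
      (((matA k ^ d).map (ev v)) * (matZ k w).map (Int.castRingHom ℂ)).trace := by
    simp [Matrix.trace, map_sum, Matrix.mul_apply, ev]
  rw [h3, map_ev_matA_pow, ← Matrix.map_mul]
  simp [Matrix.trace]

/-- Sum of two lists. -/
def addL : List ℤ → List ℤ → List ℤ
  | [], y => y
  | x, [] => x
  | a :: x, b :: y => (a + b) :: addL x y

theorem addL_getD (x y : List ℤ) (j : ℕ) : (addL x y).getD j 0 = x.getD j 0 + y.getD j 0 := by
  induction x generalizing y j with
  | nil => simp [addL]
  | cons a x ih =>
    cases y with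
    | nil => simp [addL]
    | cons b y =>
      cases j with
      | zero => simp [addL]
      | succ j =>
        rw [addL, List.getD_cons_succ, List.getD_cons_succ, List.getD_cons_succ, ih]

/-- Product of a row vector and a matrix. -/
def rowMul : List ℤ → List (List ℤ) → List ℤ
  | a :: x, r :: l => if a = 0 then rowMul x l else addL (r.map (a * ·)) (rowMul x l)
  | _, _ => []

theorem rowMul_getD (x : List ℤ) (l : List (List ℤ)) (j K : ℕ) (hl : l.length ≤ K) :
    (rowMul x l).getD j 0 = ∑ t ∈ Finset.range K, x.getD t 0 * (l.getD t []).getD j 0 := by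
  induction x generalizing l K with
  | nil => simp [rowMul]
  | cons a x ih =>
    cases l with
    | nil => simp [rowMul]
    | cons r l =>
      obtain ⟨K, rfl⟩ : ∃ K', K = K' + 1 := ⟨K - 1, by simp at hl; omega⟩
      have hl' : l.length ≤ K := by simpa using hl
      have h1 : (r.map (a * ·)).getD j 0 = a * r.getD j 0 := by
        have := List.getD_map (f := (a * ·)) (l := r) (n := j) (d := 0)
        rwa [mul_zero] at this
      rw [Finset.sum_range_succ', rowMul]
      simp only [List.getD_cons_succ, List.getD_cons_zero]
      rw [← ih l K hl']
      split_ifs with h0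
      · rw [h0, zero_mul, add_zero]
      · rw [addL_getD, h1, add_comm]

/-- Forced evaluation of an integer. -/
def forceInt {α : Type} (c : ℤ) (f : ℤ → α) : α :=
  match c with
  | .ofNat n => force n fun n => f (.ofNat n)
  | .negSucc n => force n fun n => f (.negSucc n)

theorem forceInt_eq {α : Type} (c : ℤ) (f : ℤ → α) : forceInt c f = f c := by
  cases c with
  | ofNat n => exact force_eq n fun n => f (.ofNat n)
  | negSucc n => exact force_eq n fun n => f (.negSucc n)

/-- Forced evaluation of a row. -/
def forceRow {α : Type} : List ℤ → (List ℤ → α) → α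
  | [], f => f []
  | a :: l, f => forceInt a fun a => forceRow l fun l => f (a :: l)

theorem forceRow_eq {α : Type} (l : List ℤ) (f : List ℤ → α) : forceRow l f = f l := by
  induction l generalizing f with
  | nil => rfl
  | cons a l ih => rw [forceRow, forceInt_eq, ih]

/-- Forced evaluation of a matrix. -/
def forceMat {α : Type} : List (List ℤ) → (List (List ℤ) → α) → α
  | [], f => f []
  | a :: l, f => forceRow a fun a => forceMat l fun l => f (a :: l)

theorem forceMat_eq {α : Type} (l : List (List ℤ)) (f : List (List ℤ) → α) :
    forceMat l f = f l := by
  induction l generalizing f with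
  | nil => rfl
  | cons a l ih => rw [forceMat, forceRow_eq, ih]

/-- The matrix with given rows. -/
def toMat (K : ℕ) (l : List (List ℤ)) : Matrix (Fin K) (Fin K) ℤ :=
  Matrix.of fun i j => (l.getD i []).getD j 0

/-- Product of matrices. -/
def mulL (l l' : List (List ℤ)) : List (List ℤ) := l.map fun x => rowMul x l'

theorem toMat_mulL {K : ℕ} (l l' : List (List ℤ)) (h : l'.length ≤ K) :
    toMat K (mulL l l') = toMat K l * toMat K l' := by
  refine Matrix.ext fun i j => ?_
  rw [Matrix.mul_apply, toMat, toMat, toMat, Matrix.of_apply, mulL]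
  have h1 := List.getD_map (f := fun x => rowMul x l') (l := l) (n := i) (d := [])
  rw [show rowMul [] l' = [] by simp [rowMul]] at h1
  rw [h1, rowMul_getD _ _ _ K h, Finset.sum_range]
  rfl

/-- `l' * l ^ d` for `d < 2 ^ c`. -/
def mulPowL : ℕ → List (List ℤ) → ℕ → List (List ℤ) → List (List ℤ)
  | 0, _, _, l' => l'
  | c + 1, l, d, l' =>
    if d = 0 then l' else if d = 1 then mulL l' l else
      forceMat (mulL l l) fun m => if d % 2 = 0 then mulPowL c m (d / 2) l' else
        forceMat (mulL l' l) fun l' => mulPowL c m (d / 2) l'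

theorem toMat_mulPowL {K : ℕ} (c : ℕ) (l l' : List (List ℤ)) (h : l.length ≤ K) (d : ℕ)
    (hd : d < 2 ^ c) : toMat K (mulPowL c l d l') = toMat K l' * toMat K l ^ d := by
  induction c generalizing l l' d with
  | zero =>
    obtain rfl : d = 0 := by simpa using hd
    simp [mulPowL]
  | succ c ih =>
    have hm : (mulL l l).length ≤ K := by rwa [mulL, List.length_map]
    rw [mulPowL, forceMat_eq, forceMat_eq]
    split_ifs with h0 h1 h2
    · simp [h0]
    · rw [toMat_mulL _ _ h, h1, pow_one]
    · rw [ih _ _ hm _ (by omega), toMat_mulL _ _ h, ← pow_two, ← pow_mul,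
        show 2 * (d / 2) = d by omega]
    · rw [ih _ _ hm _ (by omega), toMat_mulL _ _ h, toMat_mulL _ _ h, ← pow_two, ← pow_mul, mul_assoc,
        ← pow_succ', show 2 * (d / 2) + 1 = d by omega]

/-- The rows of the value at an integral point of the sixth transvectant. -/
def listZ (k : ℕ) (v : List ℤ) : List (List ℤ) :=
  (List.range (k + 1)).map fun r => (List.range (k + 1)).map fun s =>
    forceInt (v.getD (r + 6 - s) 0) fun c => if c = 0 then 0 else coef k r s * c

/-- The point with the given coordinates. -/
def pt (v : List ℤ) (j : ℕ) : ℤ := v.getD j 0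

theorem toMat_listZ (k : ℕ) (v : List ℤ) : toMat (k + 1) (listZ k v) = matZ k (pt v) := by
  refine Matrix.ext fun i j => ?_
  rw [toMat, matZ, Matrix.of_apply, Matrix.of_apply, listZ]
  rw [List.getD_eq_getElem (n := i) _ _ (by simp; omega), List.getElem_map, List.getElem_range,
    List.getD_eq_getElem (n := j) _ _ (by simp; omega), List.getElem_map, List.getElem_range, forceInt_eq,
    pt]
  split_ifs with h
  · rw [h, mul_zero]
  · rfl

theorem length_listZ (k : ℕ) (v : List ℤ) : (listZ k v).length = k + 1 := by simp [listZ]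

/-- The trace of a matrix. -/
def traceL (K : ℕ) (l : List (List ℤ)) : ℤ :=
  ((List.range K).map fun i => (l.getD i []).getD i 0).sum

theorem traceL_eq (K : ℕ) (l : List (List ℤ)) : traceL K l = (toMat K l).trace := by
  rw [traceL, Matrix.trace, ← List.sum_ofFn, List.ofFn_eq_map, ← List.map_coe_finRange_eq_range, List.map_map]
  rfl

/-- The trace of `A(v) ^ d A(w)`. -/
def trZ (k d : ℕ) (v w : List ℤ) : ℤ :=
  forceMat (listZ k v) fun l => forceMat (listZ k w) fun l' =>
    traceL (k + 1) (mulPowL d l d l')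

theorem trZ_eq (k d : ℕ) (v w : List ℤ) :
    trZ k d v w = (matZ k (pt v) ^ d * matZ k (pt w)).trace := by
  rw [trZ, forceMat_eq, forceMat_eq, traceL_eq, toMat_mulPowL _ _ _ (length_listZ k v).le _ Nat.lt_two_pow_self, toMat_listZ,
    toMat_listZ, Matrix.trace_mul_comm]

theorem ev_T_succ (k d : ℕ) (v : List ℤ) : ev (pt v) (T k (d + 1)) = (trZ k d v v : ℂ) := by
  rw [ev_T, trZ_eq, pow_succ]

theorem ev_dir_T_succ (k d : ℕ) (v w : List ℤ) :
    ev (pt v) (dir (pt w) (T k (d + 1))) = (((d : ℤ) + 1) * trZ k d v w : ℤ) := by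
  rw [ev_dir_T, trZ_eq]

end BinForm

namespace BinForm

open Module

/-- The invariant of degree `2` of binary forms of degree `12`. -/
def quad : Poly 12 :=
  (27720 : ℂ) • (var 12 0 * var 12 12) - (2310 : ℂ) • (var 12 1 * var 12 11) +
    (420 : ℂ) • (var 12 2 * var 12 10) - (126 : ℂ) • (var 12 3 * var 12 9) +
    (56 : ℂ) • (var 12 4 * var 12 8) - (35 : ℂ) • (var 12 5 * var 12 7) +
    (15 : ℂ) • (var 12 6 * var 12 6)

theorem quad_mem_Inv : quad ∈ Inv 12 2 := by
  have hm : ∀ i j : ℕ, i + j = 12 → var 12 i * var 12 j ∈ W 12 (2 : ℕ) 0 := fun i j hij => by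
    have := IsWeightedHomogeneous.mul (var_mem 12 i) (var_mem 12 j)
    rwa [show ((1 : ℤ), 2 * (i : ℤ) - (12 : ℕ)) + (1, 2 * (j : ℤ) - (12 : ℕ)) =
      (((2 : ℕ) : ℤ), (0 : ℤ)) by ext <;> simp <;> omega] at this
  refine mem_Inv_of_up ?_ ?_
  · unfold quad
    refine add_mem (sub_mem (add_mem (sub_mem (add_mem (sub_mem ?_ ?_) ?_) ?_) ?_) ?_) ?_ <;>
      exact Submodule.smul_mem _ _ (hm _ _ rfl)
  · have h13 : var 12 13 = 0 := by simp [var]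
    simp only [quad, map_add, map_sub, Derivation.map_smul, Derivation.leibniz, up_var, h13,
      Nat.reduceAdd, smul_eq_mul]
    simp only [MvPolynomial.smul_eq_C_mul, zero_add, mul_zero, CharP.cast_eq_zero, Nat.cast_ofNat, Nat.cast_one, map_add, map_one, map_ofNat]
    ring

theorem prime_quad : Prime quad := by
  set g : Poly 12 := - (2310 : ℂ) • (X 1 * X 11) +
    (420 : ℂ) • (X 2 * X 10) - (126 : ℂ) • (X 3 * X 9) + (56 : ℂ) • (X 4 * X 8) -
    (35 : ℂ) • (X 5 * X 7) + (15 : ℂ) • (X 6 * X 6) with hg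
  have hq : quad = (27720 : ℂ) • X 12 * X 0 + g := by
    have h := fun i : Fin 13 => var_coe 12 i
    rw [quad, hg, ← h 0, ← h 1, ← h 2, ← h 3, ← h 4, ← h 5, ← h 6, ← h 7, ← h 8, ← h 9, ← h 10,
      ← h 11, ← h 12]
    simp only [MvPolynomial.smul_eq_C_mul, map_neg]
    change _ = C 27720 * var 12 12 * var 12 0 + (-C 2310 * (var 12 1 * var 12 11) +
      C 420 * (var 12 2 * var 12 10) - C 126 * (var 12 3 * var 12 9) +
      C 56 * (var 12 4 * var 12 8) - C 35 * (var 12 5 * var 12 7) + C 15 * (var 12 6 * var 12 6))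
    ring
  have hs : ∀ i : Fin 13, i ≠ 0 → (X i : Poly 12) ∈ supported ℂ ({0}ᶜ : Set (Fin 13)) :=
    fun i hi => X_mem_supported.2 hi
  have hv : ∀ p : Poly 12, p ∈ supported ℂ ({0}ᶜ : Set (Fin 13)) → 0 ∉ p.vars := fun p hp h =>
    mem_supported.1 hp h rfl
  have hgs : g ∈ supported ℂ ({0}ᶜ : Set (Fin 13)) := by
    rw [hg]
    refine add_mem (sub_mem (add_mem (sub_mem (add_mem ?_ ?_) ?_) ?_) ?_) ?_ <;>
      exact Subalgebra.smul_mem _ (mul_mem (hs _ (by decide)) (hs _ (by decide))) _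
  rw [hq]
  refine (irreducible_mul_X_add _ g 0 ?_ (hv _ (Subalgebra.smul_mem _ (hs 12 (by decide)) _))
    (hv g hgs) ?_).prime
  · exact smul_ne_zero (by norm_num) (X_ne_zero 12)
  · rw [MvPolynomial.smul_eq_C_mul,
      isRelPrime_mul_unit_left_left ((isUnit_iff_ne_zero.2 (by norm_num : (27720 : ℂ) ≠ 0)).map C),
      (MvPolynomial.X_prime (i := (12 : Fin 13))).irreducible.isRelPrime_iff_not_dvd]
    intro hd
    have := map_dvd (aeval (fun i : Fin 13 => if i = 6 then (1 : ℂ) else 0)) hd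
    simp [hg, Fin.ext_iff] at this

theorem comp_mul_of_mem {n : ℕ} {m k : ℤ × ℤ} {p : Poly n}
    (hp : p ∈ weightedHomogeneousSubmodule ℂ (wt n) m) (t : Poly n) :
    comp n (m + k) (p * t) = p * comp n k t := by
  let := weightedGradedAlgebra ℂ (wt n)
  have h := DirectSum.coe_decompose_mul_add_of_left_mem
    (𝒜 := weightedHomogeneousSubmodule ℂ (wt n)) (i := m) (j := k) (b := t) hp
  have h1 := fun (x : Poly n) (e : ℤ × ℤ) => weightedDecomposition.decompose'_apply ℂ (wt n) x e
  exact (h1 _ _).symm.trans (h.trans (congrArg (p * ·) (h1 _ _)))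

theorem mem_Inv_of_mul_mem {n i j : ℕ} {p t : Poly n} (hp : p ∈ Inv n i) (h0 : p ≠ 0)
    (h : p * t ∈ Inv n (i + j)) : t ∈ Inv n j := by
  rw [mem_Inv] at hp h ⊢
  refine ⟨?_, ?_, ?_⟩
  · have h1 := comp_mul_of_mem (k := (j, 0)) hp.1 t
    rw [comp, weightedHomogeneousComponent_of_mem h.1, if_pos (by ext <;> simp)] at h1
    rw [mul_left_cancel₀ h0 h1]
    exact weightedHomogeneousComponent_mem _ _ _
  · have h1 := h.2.1
    rw [Derivation.leibniz, hp.2.1, smul_zero, add_zero, smul_eq_mul] at h1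
    exact (mul_eq_zero.1 h1).resolve_left h0
  · have h1 := h.2.2
    rw [Derivation.leibniz, hp.2.2, smul_zero, add_zero, smul_eq_mul] at h1
    exact (mul_eq_zero.1 h1).resolve_left h0

theorem h_twelve : ∀ d < 17, h 12 d =
    [1, 0, 1, 1, 3, 3, 8, 10, 20, 28, 52, 73, 127, 181, 291, 418, 639].getD d 0 := by
  intro d hd
  rw [← hList_getD (show d ≤ 16 by omega) (by norm_num)]
  have : hList 12 16 =
      [1, 0, 1, 1, 3, 3, 8, 10, 20, 28, 52, 73, 127, 181, 291, 418, 639] := by decide +kernel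
  rw [this]

theorem Inv_twelve_one : Inv 12 1 = ⊥ := Submodule.finrank_eq_zero.1 (h_twelve 1 (by norm_num))

theorem Inv_eq_span {n d : ℕ} (hd : h n d = 1) {p : Poly n} (hp : p ∈ Inv n d) (h0 : p ≠ 0) :
    Inv n d = Submodule.span ℂ {p} := by
  refine (Submodule.eq_of_le_of_finrank_eq ?_ ?_).symm
  · rwa [Submodule.span_singleton_le_iff_mem]
  · rw [finrank_span_singleton h0]
    exact hd.symm

theorem Inv_twelve_two : Inv 12 2 = Submodule.span ℂ {quad} :=
  Inv_eq_span (h_twelve 2 (by norm_num)) quad_mem_Inv prime_quad.ne_zero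

theorem finrank_span_singleton_mul {n : ℕ} {p : Poly n} (hp : p ≠ 0) (V : Submodule ℂ (Poly n)) :
    finrank ℂ (Submodule.span ℂ {p} * V : Submodule ℂ (Poly n)) = finrank ℂ V := by
  have h1 : Submodule.span ℂ {p} * V = V.map (LinearMap.mulLeft ℂ p) := by
    ext x
    rw [Submodule.mem_span_singleton_mul, Submodule.mem_map]
    rfl
  rw [h1]
  exact (Submodule.equivMapOfInjective _ (mul_right_injective₀ hp) V).finrank_eq.symm

/-- The part of the decomposable invariants coming from the invariants of degrees `2` and `3`. -/
def low (d : ℕ) : Submodule ℂ (Poly 12) := Inv 12 2 * Inv 12 (d - 2) ⊔ Inv 12 3 * Inv 12 (d - 3)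

instance (d : ℕ) : Module.Finite ℂ (low d) := by
  unfold low
  infer_instance

theorem low_le {d : ℕ} (hd : 3 ≤ d) : low d ≤ Inv 12 d := by
  refine sup_le ((Inv_mul_le _ _ _).trans_eq ?_) ((Inv_mul_le _ _ _).trans_eq ?_) <;>
    congr 1 <;> omega

theorem Inv_two_mul_le (d : ℕ) : Inv 12 2 * Inv 12 d ≤ low (d + 2) := by
  rw [low, Nat.add_sub_cancel]
  exact le_sup_left

theorem Inv_three_mul_le (d : ℕ) : Inv 12 3 * Inv 12 d ≤ low (d + 3) := by
  rw [low, Nat.add_sub_cancel]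
  exact le_sup_right

theorem low_mul_le {d : ℕ} (hd : 3 ≤ d) (e : ℕ) : low d * Inv 12 e ≤ low (d + e) := by
  rw [low, Submodule.sup_mul, mul_assoc, mul_assoc]
  refine sup_le ?_ ?_
  · refine (mul_le_mul' le_rfl (Inv_mul_le _ _ _)).trans ((Inv_two_mul_le _).trans_eq ?_)
    congr 1
    omega
  · refine (mul_le_mul' le_rfl (Inv_mul_le _ _ _)).trans ((Inv_three_mul_le _).trans_eq ?_)
    congr 1
    omega

theorem finrank_low {d : ℕ} {c : Poly 12} (hc : c ∈ Inv 12 3) (h0 : c ≠ 0) :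
    finrank ℂ (low (d + 5)) + h 12 d = h 12 (d + 3) + h 12 (d + 2) := by
  have hq := quad_mem_Inv
  have hq0 := prime_quad.ne_zero
  have h3 : Inv 12 3 = Submodule.span ℂ {c} := Inv_eq_span (h_twelve 3 (by norm_num)) hc h0
  have hqc : ¬ quad ∣ c := by
    rintro ⟨t, ht⟩
    have h1 : t ∈ Inv 12 1 := mem_Inv_of_mul_mem hq hq0 (ht ▸ hc)
    rw [Inv_twelve_one, Submodule.mem_bot] at h1
    exact h0 (by rw [ht, h1, mul_zero])
  have hinf : Inv 12 2 * Inv 12 (d + 3) ⊓ Inv 12 3 * Inv 12 (d + 2) =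
      Submodule.span ℂ {quad * c} * Inv 12 d := by
    rw [Inv_twelve_two, h3]
    ext x
    rw [Submodule.mem_inf]
    simp only [Submodule.mem_span_singleton_mul]
    constructor
    · rintro ⟨⟨f, hf, rfl⟩, g, hg, hfg⟩
      obtain ⟨t, rfl⟩ : quad ∣ g :=
        (prime_quad.dvd_or_dvd (show quad ∣ c * g from hfg ▸ dvd_mul_right _ _)).resolve_left hqc
      refine ⟨t, mem_Inv_of_mul_mem hq hq0 (by rwa [add_comm d 2] at hg), ?_⟩
      rw [← hfg]
      ring
    · rintro ⟨t, ht, rfl⟩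
      refine ⟨⟨c * t, ?_, by ring⟩, quad * t, ?_, by ring⟩
      · rw [add_comm d 3]
        exact mul_mem_Inv hc ht
      · rw [add_comm d 2]
        exact mul_mem_Inv hq ht
  have h1 := Submodule.finrank_sup_add_finrank_inf_eq (Inv 12 2 * Inv 12 (d + 3))
    (Inv 12 3 * Inv 12 (d + 2))
  rw [hinf, finrank_span_singleton_mul (mul_ne_zero hq0 h0), Inv_twelve_two, h3,
    finrank_span_singleton_mul hq0, finrank_span_singleton_mul h0, ← h3, ← Inv_twelve_two] at h1
  exact h1

theorem exists_sup_eq_of_le {M : Type*} [AddCommGroup M] [Module ℂ M] {V W : Submodule ℂ M}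
    [Module.Finite ℂ W] (hV : V ≤ W) :
    ∃ K ≤ W, V ⊔ K = W ∧ finrank ℂ V + finrank ℂ K = finrank ℂ W := by
  obtain ⟨K, hK⟩ := exists_isCompl V
  have : FiniteDimensional ℂ V := Submodule.finiteDimensional_of_le hV
  have h1 : V ⊔ K ⊓ W = W := by
    rw [← sup_inf_assoc_of_le _ hV, hK.sup_eq_top, top_inf_eq]
  refine ⟨K ⊓ W, inf_le_right, h1, ?_⟩
  have h2 := Submodule.finrank_sup_add_finrank_inf_eq V (K ⊓ W)
  rw [h1, ← inf_assoc, hK.inf_eq_bot, bot_inf_eq, finrank_bot, add_zero] at h2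
  exact h2.symm

theorem finrank_sup_le {M : Type*} [AddCommGroup M] [Module ℂ M] (V W : Submodule ℂ M)
    [Module.Finite ℂ V] [Module.Finite ℂ W] :
    finrank ℂ (V ⊔ W : Submodule ℂ M) ≤ finrank ℂ V + finrank ℂ W := by
  have := Submodule.finrank_sup_add_finrank_inf_eq V W
  omega

theorem finrank_sup_mul_le {A : Type*} [CommRing A] [Algebra ℂ A] {U G V W : Submodule ℂ A}
    [Module.Finite ℂ U] [Module.Finite ℂ G] [Module.Finite ℂ W] {k : ℕ} (hG : finrank ℂ G ≤ k)
    (hV : V ≤ W) (hU : G * V ≤ U) :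
    finrank ℂ (U ⊔ G * W : Submodule ℂ A) + k * finrank ℂ V ≤ finrank ℂ U + k * finrank ℂ W := by
  obtain ⟨K, hKW, hK, hd⟩ := exists_sup_eq_of_le hV
  have : FiniteDimensional ℂ K := Submodule.finiteDimensional_of_le hKW
  have : Module.Finite ℂ (G * K : Submodule ℂ A) :=
    Module.Finite.iff_fg.2 ((Module.Finite.iff_fg.1 ‹_›).mul (Module.Finite.iff_fg.1 ‹_›))
  rw [← hd, ← hK, Submodule.mul_sup, ← sup_assoc, sup_eq_left.2 hU]
  have h1 := finrank_sup_le U (G * K)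
  have h2 := (finrank_mul_le G K).trans (Nat.mul_le_mul_right _ hG)
  rw [mul_add]
  omega

theorem finite_mul {M N : Submodule ℂ (Poly 12)} [hM : Module.Finite ℂ M] [hN : Module.Finite ℂ N] :
    Module.Finite ℂ (M * N : Submodule ℂ (Poly 12)) :=
  Module.Finite.iff_fg.2 ((Module.Finite.iff_fg.1 hM).mul (Module.Finite.iff_fg.1 hN))

/-- A complement of `low i` of dimension at most `k`. -/
structure IsLowCompl (i k : ℕ) (G : Submodule ℂ (Poly 12)) : Prop where
  le : G ≤ Inv 12 i
  sup : Inv 12 i ≤ low i ⊔ G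
  dim : finrank ℂ G ≤ k

theorem exists_isLowCompl {i k : ℕ} (hi : 3 ≤ i) (h : h 12 i ≤ finrank ℂ (low i) + k) :
    ∃ G, IsLowCompl i k G := by
  obtain ⟨K, h1, h2, h3⟩ := exists_sup_eq_of_le (low_le hi)
  refine ⟨K, h1, h2.ge, ?_⟩
  change _ = BinForm.h 12 i at h3
  omega

theorem finrank_sup_Inv_mul_le {i j k : ℕ} {G U V : Submodule ℂ (Poly 12)} (hi : 3 ≤ i) (hj : 3 ≤ j)
    (hG : IsLowCompl i k G) [Module.Finite ℂ U] (hU : low (i + j) ≤ U) (hV : V ≤ Inv 12 j)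
    (hVU : G * V ≤ U) :
    finrank ℂ (U ⊔ Inv 12 i * Inv 12 j : Submodule ℂ (Poly 12)) + k * finrank ℂ (low j ⊔ V : Submodule ℂ (Poly 12)) ≤
      finrank ℂ U + k * h 12 j := by
  have : Module.Finite ℂ G := Submodule.finiteDimensional_of_le hG.le
  have : Module.Finite ℂ (G * Inv 12 j : Submodule ℂ (Poly 12)) := finite_mul
  have h1 : low j ⊔ V ≤ Inv 12 j := sup_le (low_le hj) hV
  have h2 : G * (low j ⊔ V) ≤ U := by
    rw [Submodule.mul_sup]
    refine sup_le ?_ hVU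
    rw [mul_comm]
    refine (mul_le_mul' le_rfl hG.le).trans ((low_mul_le hj i).trans ?_)
    rwa [add_comm j i]
  have h3 := finrank_sup_mul_le hG.dim h1 h2
  refine le_trans (Nat.add_le_add_right (Submodule.finrank_mono (sup_le le_sup_left ?_)) _) h3
  refine (mul_le_mul' hG.sup le_rfl).trans ?_
  rw [Submodule.sup_mul]
  exact sup_le_sup ((low_mul_le hi j).trans hU) le_rfl

theorem Inv_mul_Inv_le {i j k l : ℕ} {G G' U : Submodule ℂ (Poly 12)} (hi : 3 ≤ i) (hj : 3 ≤ j)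
    (hG : IsLowCompl i k G) (hG' : IsLowCompl j l G') (hU : low (i + j) ≤ U) :
    Inv 12 i * Inv 12 j ≤ U ⊔ G * G' := by
  refine (mul_le_mul' hG.sup le_rfl).trans ?_
  rw [Submodule.sup_mul]
  refine sup_le ((low_mul_le hi j).trans (hU.trans le_sup_left)) ?_
  refine (mul_le_mul' le_rfl hG'.sup).trans ?_
  rw [Submodule.mul_sup]
  refine sup_le ?_ le_sup_right
  rw [mul_comm]
  refine (mul_le_mul' le_rfl hG.le).trans ((low_mul_le hj i).trans (le_trans ?_ le_sup_left))
  rwa [add_comm j i]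

theorem finrank_sup_Inv_mul_le' {i j k l : ℕ} {G G' U : Submodule ℂ (Poly 12)} (hi : 3 ≤ i)
    (hj : 3 ≤ j) (hG : IsLowCompl i k G) (hG' : IsLowCompl j l G') [Module.Finite ℂ U]
    (hU : low (i + j) ≤ U) :
    finrank ℂ (U ⊔ Inv 12 i * Inv 12 j : Submodule ℂ (Poly 12)) ≤ finrank ℂ U + k * l := by
  have : Module.Finite ℂ G := Submodule.finiteDimensional_of_le hG.le
  have : Module.Finite ℂ G' := Submodule.finiteDimensional_of_le hG'.le
  have : Module.Finite ℂ (G * G' : Submodule ℂ (Poly 12)) := finite_mul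
  refine (Submodule.finrank_mono (sup_le le_sup_left (Inv_mul_Inv_le hi hj hG hG' hU))).trans ?_
  refine (finrank_sup_le _ _).trans (Nat.add_le_add_left ?_ _)
  exact (finrank_mul_le _ _).trans (Nat.mul_le_mul hG.dim hG'.dim)

theorem finrank_sup_Inv_mul_self_le {i k : ℕ} {G U : Submodule ℂ (Poly 12)} (hi : 3 ≤ i)
    (hG : IsLowCompl i k G) [Module.Finite ℂ U] (hU : low (i + i) ≤ U) :
    finrank ℂ (U ⊔ Inv 12 i * Inv 12 i : Submodule ℂ (Poly 12)) ≤
      finrank ℂ U + k * (k + 1) / 2 := by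
  have : Module.Finite ℂ G := Submodule.finiteDimensional_of_le hG.le
  have : Module.Finite ℂ (G * G : Submodule ℂ (Poly 12)) := finite_mul
  refine (Submodule.finrank_mono (sup_le le_sup_left (Inv_mul_Inv_le hi hi hG hG hU))).trans ?_
  refine (finrank_sup_le _ _).trans (Nat.add_le_add_left ?_ _)
  refine (finrank_mul_self_le _).trans (Nat.div_le_div_right ?_)
  exact Nat.mul_le_mul hG.dim (Nat.add_le_add_right hG.dim 1)

theorem finrank_sup_Inv_four_mul_le {a b : Poly 12} (ha : a ∈ Inv 12 4) (hb : b ∈ Inv 12 4)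
    (hab : Inv 12 4 ≤ low 4 ⊔ Submodule.span ℂ {a, b}) {d : ℕ} (hd : 3 ≤ d) :
    finrank ℂ (low (4 + (d + 4)) ⊔ Inv 12 4 * Inv 12 (d + 4) : Submodule ℂ (Poly 12)) +
        (finrank ℂ (low (d + 4)) +
        finrank ℂ (low (d + 4) ⊔ Submodule.span ℂ {a} * Inv 12 d : Submodule ℂ (Poly 12))) ≤
      finrank ℂ (low (4 + (d + 4))) + 2 * h 12 (d + 4) := by
  have ha' : Submodule.span ℂ {a} ≤ Inv 12 4 := by rwa [Submodule.span_singleton_le_iff_mem]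
  have hb' : Submodule.span ℂ {b} ≤ Inv 12 4 := by rwa [Submodule.span_singleton_le_iff_mem]
  have : Module.Finite ℂ (Submodule.span ℂ {a} * Inv 12 (d + 4) : Submodule ℂ (Poly 12)) := finite_mul
  have : Module.Finite ℂ (Submodule.span ℂ {b} * Inv 12 (d + 4) : Submodule ℂ (Poly 12)) := finite_mul
  have hs : ∀ x : Poly 12, finrank ℂ (Submodule.span ℂ {x}) ≤ 1 := fun x =>
    (finrank_span_le_card {x}).trans (by simp)
  have hlow : ∀ x : Poly 12, x ∈ Inv 12 4 →
      Submodule.span ℂ {x} * low (d + 4) ≤ low (4 + (d + 4)) := by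
    intro x hx
    rw [mul_comm]
    refine (mul_le_mul' le_rfl ?_).trans ((low_mul_le (by omega) 4).trans_eq ?_)
    · rwa [Submodule.span_singleton_le_iff_mem]
    · rw [add_comm 4 (d + 4)]
  have had : Submodule.span ℂ {a} * Inv 12 d ≤ Inv 12 (d + 4) :=
    (mul_le_mul' ha' le_rfl).trans ((Inv_mul_le _ _ _).trans_eq (by rw [add_comm 4 d]))
  have hbd : Submodule.span ℂ {b} * Inv 12 d ≤ Inv 12 (d + 4) :=
    (mul_le_mul' hb' le_rfl).trans ((Inv_mul_le _ _ _).trans_eq (by rw [add_comm 4 d]))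
  have h1 := finrank_sup_mul_le (hs a) (low_le (d := d + 4) (by omega)) (hlow a ha)
  have h2 := finrank_sup_mul_le (U := low (4 + (d + 4)) ⊔ Submodule.span ℂ {a} * Inv 12 (d + 4))
    (hs b) (sup_le (low_le (d := d + 4) (by omega)) had) (by
      rw [Submodule.mul_sup]
      refine sup_le_sup (hlow b hb) ?_
      rw [mul_left_comm]
      exact mul_le_mul' le_rfl hbd)
  have h3 : low (4 + (d + 4)) ⊔ Inv 12 4 * Inv 12 (d + 4) ≤
      low (4 + (d + 4)) ⊔ Submodule.span ℂ {a} * Inv 12 (d + 4) ⊔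
        Submodule.span ℂ {b} * Inv 12 (d + 4) := by
    rw [sup_assoc]
    refine sup_le le_sup_left ((mul_le_mul' hab le_rfl).trans ?_)
    rw [Submodule.sup_mul, Submodule.span_insert, Submodule.sup_mul]
    refine sup_le_sup ?_ le_rfl
    rw [low, Inv_twelve_one, Submodule.mul_bot, sup_bot_eq, mul_assoc]
    refine (mul_le_mul' le_rfl (Inv_mul_le _ _ _)).trans ((Inv_two_mul_le _).trans_eq ?_)
    congr 1
    omega
  have h4 := Submodule.finrank_mono h3
  simp only [h]
  omega

/-- A rank bound by evaluation at points. -/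
theorem finrank_add_le_of_det {m : ℕ} (E : Fin m → Poly 12 →ₗ[ℂ] ℂ) (f : Fin m → Poly 12)
    (hdet : (Matrix.of fun i j => E i (f j)).det ≠ 0) {P Q : Submodule ℂ (Poly 12)}
    [Module.Finite ℂ Q] (hP : P ≤ Q) (hP0 : ∀ x ∈ P, ∀ i, E i x = 0) (hf : ∀ j, f j ∈ Q) :
    finrank ℂ P + m ≤ finrank ℂ Q := by
  set L : Poly 12 →ₗ[ℂ] Fin m → ℂ := LinearMap.pi E with hL
  have hli : LinearIndependent ℂ fun j => L (f j) :=
    Matrix.linearIndependent_cols_of_det_ne_zero hdet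
  have h1 := LinearMap.finrank_range_add_finrank_ker (L.domRestrict Q)
  have h2 : m ≤ finrank ℂ (L.domRestrict Q).range := by
    have h3 := finrank_span_eq_card hli
    rw [Fintype.card_fin] at h3
    refine h3.ge.trans (Submodule.finrank_mono (Submodule.span_le.2 ?_))
    rintro _ ⟨j, rfl⟩
    exact ⟨⟨f j, hf j⟩, rfl⟩
  have h3 : finrank ℂ P ≤ finrank ℂ (L.domRestrict Q).ker := by
    rw [← (Submodule.comapSubtypeEquivOfLe hP).finrank_eq]
    refine Submodule.finrank_mono fun x hx => ?_
    rw [LinearMap.mem_ker]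
    exact _root_.funext fun i => hP0 _ hx i
  omega

/-- Products of the invariants `T k (d + 1)`. -/
def mon (l : List (ℕ × ℕ)) : Poly 12 := (l.map fun x => T x.1 (x.2 + 1)).prod

/-- The value of `mon l` at an integral point. -/
def monZ (v : List ℤ) (l : List (ℕ × ℕ)) : ℤ := (l.map fun x => trZ x.1 x.2 v v).prod

theorem ev_mon (v : List ℤ) (l : List (ℕ × ℕ)) : ev (pt v) (mon l) = (monZ v l : ℂ) := by
  rw [mon, monZ, map_list_prod, List.map_map, Int.cast_list_prod, List.map_map]
  congr 1
  exact List.map_congr_left fun x _ => ev_T_succ x.1 x.2 v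

/-- Linear independence of the products `mon l`, `l ∈ ms`, at the points `ps`. -/
def indep (ps : List (List ℤ)) (ms : List (List (ℕ × ℕ))) : Bool :=
  ps.length == ms.length && forceMat (ps.map fun v => ms.map fun l => monZ v l) fun M =>
    decide ((toMat ms.length M).det ≠ 0)

theorem finrank_add_le_of_indep {ps : List (List ℤ)} {ms : List (List (ℕ × ℕ))}
    (hi : indep ps ms = true) {P Q : Submodule ℂ (Poly 12)} [Module.Finite ℂ Q] (hP : P ≤ Q)
    (hP0 : ∀ v ∈ ps, ∀ x ∈ P, ev (pt v) x = 0) (hf : ∀ l ∈ ms, mon l ∈ Q) :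
    finrank ℂ P + ms.length ≤ finrank ℂ Q := by
  rw [indep, forceMat_eq, Bool.and_eq_true, beq_iff_eq, decide_eq_true_eq] at hi
  obtain ⟨hl, hd⟩ := hi
  refine finrank_add_le_of_det (fun i : Fin ms.length => (ev (pt (ps[i]'(by omega)))).toLinearMap)
    (fun j => mon ms[j]) ?_ hP (fun x hx i => hP0 _ (List.getElem_mem _) x hx)
    fun j => hf _ (List.getElem_mem _)
  have h1 : (Matrix.of fun i j : Fin ms.length =>
      (ev (pt (ps[i]'(by omega)))).toLinearMap (mon ms[j])) =
      (toMat ms.length (ps.map fun v => ms.map fun l => monZ v l)).map (Int.castRingHom ℂ) := by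
    refine Matrix.ext fun i j => ?_
    rw [Matrix.of_apply, Matrix.map_apply, toMat, Matrix.of_apply, AlgHom.toLinearMap_apply, ev_mon]
    have hi : (i : ℕ) < ps.length := by omega
    simp [hi]
  rw [h1, ← RingHom.mapMatrix_apply, ← RingHom.map_det]
  simpa using hd

/-- Common zeros of the invariants of degrees `2` and `3`. -/
def zeros : List (List ℤ) :=
  [[0, 0, -1, 1, 0, 0, 0, 1, 0, 0, 0, -1], [0, 0, 1, 0, 1, 0, 0, 0, 0, 1, 0, 1],
    [0, 1, 0, 2, 0, 0, 0, 0, 1, 0, -1], [0, 0, 1, 0, 0, 1, 0, 0, 0, 1, 0, 0, -1]]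

theorem ev_var (v : ℕ → ℤ) {j : ℕ} (hj : j < 13) : ev v (var 12 j) = v j := by
  rw [var, dif_pos hj, ev, aeval_X]

theorem T_six_three_ne_zero : T 6 3 ≠ 0 := by
  intro h0
  have h1 := ev_T_succ 6 2 [0, 0, 0, 0, 0, 0, 1]
  rw [h0, map_zero] at h1
  have h2 : trZ 6 2 [0, 0, 0, 0, 0, 0, 1] [0, 0, 0, 0, 0, 0, 1] ≠ 0 := by decide +kernel
  exact h2 (by exact_mod_cast h1.symm)

theorem Inv_twelve_three : Inv 12 3 = Submodule.span ℂ {T 6 3} :=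
  Inv_eq_span (h_twelve 3 (by norm_num)) (T_mem_Inv equivariant_six 3) T_six_three_ne_zero

/-- The value of `quad`. -/
def quadZ (v : ℕ → ℤ) : ℤ := 27720 * (v 0 * v 12) - 2310 * (v 1 * v 11) + 420 * (v 2 * v 10) -
  126 * (v 3 * v 9) + 56 * (v 4 * v 8) - 35 * (v 5 * v 7) + 15 * (v 6 * v 6)

theorem ev_quad (v : ℕ → ℤ) : ev v quad = quadZ v := by
  rw [quad, quadZ]
  simp only [map_add, map_sub, map_smul, map_mul, smul_eq_mul]
  repeat rw [ev_var _ (by norm_num)]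
  push_cast
  rfl

theorem ev_eq_zero_of_mul {v : ℕ → ℤ} {M N : Submodule ℂ (Poly 12)}
    (hM : ∀ x ∈ M, ev v x = 0) : ∀ x ∈ M * N, ev v x = 0 := by
  intro x hx
  have h1 : M * N ≤ (ev v).toLinearMap.ker := Submodule.mul_le.2 fun m hm n _ => by
    rw [LinearMap.mem_ker, AlgHom.toLinearMap_apply, map_mul, hM m hm, zero_mul]
  exact h1 hx

theorem ev_eq_zero_of_sup {v : ℕ → ℤ} {M N : Submodule ℂ (Poly 12)}
    (hM : ∀ x ∈ M, ev v x = 0) (hN : ∀ x ∈ N, ev v x = 0) : ∀ x ∈ M ⊔ N, ev v x = 0 := by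
  have h1 : M ⊔ N ≤ (ev v).toLinearMap.ker := sup_le hM hN
  exact fun x hx => h1 hx

theorem ev_eq_zero_of_span {v : ℕ → ℤ} {S : Set (Poly 12)}
    (hS : ∀ x ∈ S, ev v x = 0) : ∀ x ∈ Submodule.span ℂ S, ev v x = 0 := by
  have h1 : Submodule.span ℂ S ≤ (ev v).toLinearMap.ker := Submodule.span_le.2 hS
  exact fun x hx => h1 hx

theorem ev_low {v : List ℤ} (hv : v ∈ zeros) {d : ℕ} : ∀ x ∈ low d, ev (pt v) x = 0 := by
  refine ev_eq_zero_of_sup (ev_eq_zero_of_mul ?_) (ev_eq_zero_of_mul ?_)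
  · rw [Inv_twelve_two]
    refine ev_eq_zero_of_span fun x hx => ?_
    rw [Set.mem_singleton_iff.1 hx, ev_quad]
    have : ∀ v ∈ zeros, quadZ (pt v) = 0 := by decide +kernel
    rw [this v hv, Int.cast_zero]
  · rw [Inv_twelve_three]
    refine ev_eq_zero_of_span fun x hx => ?_
    rw [Set.mem_singleton_iff.1 hx, ev_T_succ]
    have : ∀ v ∈ zeros, trZ 6 2 v v = 0 := by decide +kernel
    rw [this v hv, Int.cast_zero]

theorem mon_mem_mul {l l' : List (ℕ × ℕ)} {i j : ℕ} (h : mon l ∈ Inv 12 i) (h' : mon l' ∈ Inv 12 j) :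
    mon (l ++ l') ∈ Inv 12 i * Inv 12 j := by
  rw [mon, List.map_append, List.prod_append]
  exact Submodule.mul_mem_mul h h'

theorem mon_singleton_mem {k : ℕ} (hk : equivariant k = true) (d : ℕ) :
    mon [(k, d)] ∈ Inv 12 (d + 1) := by
  rw [mon, List.map_singleton, List.prod_singleton]
  exact T_mem_Inv hk _

theorem indep_four : indep (zeros.take 2) [[(6, 3)], [(8, 3)]] = true := by decide +kernel
theorem indep_five : indep (zeros.take 2) [[(6, 4)], [(8, 4)]] = true := by decide +kernel
theorem indep_six : indep zeros [[(6, 5)], [(8, 5)], [(10, 5)], [(12, 5)]] = true := by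
  decide +kernel
theorem indep_eight : indep (zeros.take 3) [[(6, 3), (6, 3)], [(6, 3), (8, 3)], [(8, 3), (8, 3)]] = true := by
  decide +kernel
theorem indep_four_four : indep (zeros.take 2) [[(6, 3), (6, 3)], [(6, 3), (8, 3)]] = true := by
  decide +kernel
theorem indep_four_five : indep (zeros.take 2) [[(6, 3), (6, 4)], [(6, 3), (8, 4)]] = true := by
  decide +kernel
theorem indep_four_six : indep zeros [[(6, 3), (6, 5)], [(6, 3), (8, 5)], [(6, 3), (10, 5)],
    [(6, 3), (12, 5)]] = true := by
  decide +kernel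
theorem indep_nine : indep zeros [[(6, 3), (6, 4)], [(6, 3), (8, 4)], [(8, 3), (6, 4)],
    [(8, 3), (8, 4)]] = true := by
  decide +kernel

theorem finrank_low_four_le : 1 ≤ finrank ℂ (low 4) := by
  have h1 : finrank ℂ (Submodule.span ℂ {quad} * Inv 12 2 : Submodule ℂ (Poly 12)) = h 12 2 :=
    finrank_span_singleton_mul prime_quad.ne_zero _
  rw [h_twelve 2 (by norm_num), ← Inv_twelve_two] at h1
  have h2 := Submodule.finrank_mono (Inv_two_mul_le 2)
  rw [h1] at h2
  exact h2

theorem finrank_low_twelve : ∀ d < 10, finrank ℂ (low (d + 5)) =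
    [1, 4, 5, 10, 15, 27, 40, 70, 105, 172].getD d 0 := by
  intro d hd
  have h1 := finrank_low (d := d) (T_mem_Inv equivariant_six 3) T_six_three_ne_zero
  rw [h_twelve d (by omega), h_twelve (d + 3) (by omega), h_twelve (d + 2) (by omega)] at h1
  interval_cases d <;> simpa using h1

theorem Inv_le_low_sup {d : ℕ} (hd : 3 ≤ d) {ps : List (List ℤ)} {ms : List (List (ℕ × ℕ))}
    (hps : ps ⊆ zeros) (hi : indep ps ms = true) (hm : ∀ l ∈ ms, mon l ∈ Inv 12 d)
    (h1 : h 12 d ≤ finrank ℂ (low d) + ms.length) :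
    Inv 12 d ≤ low d ⊔ Submodule.span ℂ (mon '' {l | l ∈ ms}) := by
  have h2 : low d ⊔ Submodule.span ℂ (mon '' {l | l ∈ ms}) ≤ Inv 12 d := by
    refine sup_le (low_le hd) (Submodule.span_le.2 ?_)
    rintro _ ⟨l, hl, rfl⟩
    exact hm l hl
  have := Submodule.finiteDimensional_of_le h2
  refine (Submodule.eq_of_le_of_finrank_le h2 (h1.trans ?_)).ge
  refine finrank_add_le_of_indep hi le_sup_left (fun v hv => ev_low (hps hv)) fun l hl => ?_
  exact Submodule.mem_sup_right (Submodule.subset_span ⟨l, hl, rfl⟩)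

theorem Inv_twelve_four :
    Inv 12 4 ≤ low 4 ⊔ Submodule.span ℂ (mon '' {l | l ∈ [[(6, 3)], [(8, 3)]]}) := by
  refine Inv_le_low_sup (by norm_num) (List.take_subset _ _) indep_four ?_ ?_
  · simp [mon_singleton_mem, equivariant_six, equivariant_eight]
  · rw [h_twelve 4 (by norm_num)]
    exact Nat.add_le_add_right finrank_low_four_le 2

theorem Inv_twelve_five :
    Inv 12 5 ≤ low 5 ⊔ Submodule.span ℂ (mon '' {l | l ∈ [[(6, 4)], [(8, 4)]]}) := by
  refine Inv_le_low_sup (by norm_num) (List.take_subset _ _) indep_five ?_ ?_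
  · simp [mon_singleton_mem, equivariant_six, equivariant_eight]
  · rw [h_twelve 5 (by norm_num), finrank_low_twelve 0 (by norm_num)]
    simp

theorem Inv_twelve_six : Inv 12 6 ≤ low 6 ⊔ Submodule.span ℂ
    (mon '' {l | l ∈ [[(6, 5)], [(8, 5)], [(10, 5)], [(12, 5)]]}) := by
  refine Inv_le_low_sup (by norm_num) (List.Subset.refl _) indep_six ?_ ?_
  · simp [mon_singleton_mem, equivariant_six, equivariant_eight, equivariant_ten, equivariant_twelve]
  · rw [h_twelve 6 (by norm_num), finrank_low_twelve 1 (by norm_num)]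
    simp

theorem le_finrank_low_sup {d m : ℕ} {ps : List (List ℤ)} {ms : List (List (ℕ × ℕ))}
    (hps : ps ⊆ zeros) (hi : indep ps ms = true) (hl : ms.length = m) {V : Submodule ℂ (Poly 12)}
    [Module.Finite ℂ V] (hm : ∀ l ∈ ms, mon l ∈ V) :
    finrank ℂ (low d) + m ≤ finrank ℂ (low d ⊔ V : Submodule ℂ (Poly 12)) := by
  rw [← hl]
  exact finrank_add_le_of_indep hi le_sup_left (fun v hv => ev_low (hps hv)) fun l hl =>
    Submodule.mem_sup_right (hm l hl)

theorem dec_twelve_le {d : ℕ} {U : Submodule ℂ (Poly 12)} (hU : low d ≤ U)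
    (h : ∀ i, 4 ≤ i → 2 * i ≤ d → Inv 12 i * Inv 12 (d - i) ≤ U) : dec 12 d ≤ U := by
  refine (dec_le_sup 12 d).trans (Finset.sup_le fun i hi => ?_)
  obtain ⟨hi1, hi2⟩ := (Finset.mem_filter.1 hi).2
  rcases lt_or_ge i 4 with h4 | h4
  · have : i = 1 ∨ i = 2 ∨ i = 3 := by omega
    rcases this with rfl | rfl | rfl
    · rw [Inv_twelve_one, Submodule.bot_mul]
      exact bot_le
    · exact le_sup_left.trans hU
    · exact le_sup_right.trans hU
  · exact h i h4 hi2

theorem exists_isLowCompl_five : ∃ G, IsLowCompl 5 2 G := exists_isLowCompl (by norm_num) (by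
  rw [h_twelve 5 (by norm_num), finrank_low_twelve 0 (by norm_num)]; decide)

theorem exists_isLowCompl_six : ∃ G, IsLowCompl 6 4 G := exists_isLowCompl (by norm_num) (by
  rw [h_twelve 6 (by norm_num), finrank_low_twelve 1 (by norm_num)]; decide)

theorem exists_isLowCompl_seven : ∃ G, IsLowCompl 7 5 G := exists_isLowCompl (by norm_num) (by
  rw [h_twelve 7 (by norm_num), finrank_low_twelve 2 (by norm_num)]; decide)

theorem exists_isLowCompl_four : ∃ G, IsLowCompl 4 2 G := exists_isLowCompl (by norm_num) (by
  rw [h_twelve 4 (by norm_num)]; exact Nat.add_le_add_right finrank_low_four_le 2)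

theorem finrank_dec_le_of_le {d m : ℕ} {U : Submodule ℂ (Poly 12)} [Module.Finite ℂ U]
    (hU : dec 12 d ≤ U) (hm : finrank ℂ U ≤ m) : finrank ℂ (dec 12 d) ≤ m :=
  (Submodule.finrank_mono hU).trans hm

theorem finrank_dec_seven : finrank ℂ (dec 12 7) ≤ 5 := by
  refine finrank_dec_le_of_le (U := low 7) (dec_twelve_le le_rfl fun i _ _ => by omega) ?_
  exact (finrank_low_twelve 2 (by norm_num)).le

theorem finrank_dec_eight : finrank ℂ (dec 12 8) ≤ 13 := by
  obtain ⟨G, hG⟩ := exists_isLowCompl_four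
  have : Module.Finite ℂ (low 8 ⊔ Inv 12 4 * Inv 12 4 : Submodule ℂ (Poly 12)) :=
    Submodule.finiteDimensional_of_le (sup_le (low_le (by norm_num)) (Inv_mul_le 12 4 4))
  refine finrank_dec_le_of_le (U := low 8 ⊔ Inv 12 4 * Inv 12 4)
    (dec_twelve_le le_sup_left fun i h1 h2 => ?_) ?_
  · obtain rfl : i = 4 := by omega
    exact le_sup_right
  · have h1 := finrank_sup_Inv_mul_self_le (U := low 8) (by norm_num) hG le_rfl
    rw [finrank_low_twelve 3 (by norm_num)] at h1
    exact h1

attribute [local instance] finite_mul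

theorem mul_Inv_four_mul_le {i j : ℕ} {G : Submodule ℂ (Poly 12)} (hG : G ≤ Inv 12 i) :
    G * (Inv 12 4 * Inv 12 j) ≤ Inv 12 4 * Inv 12 (i + j) := by
  rw [mul_left_comm]
  exact mul_le_mul' le_rfl ((mul_le_mul' hG le_rfl).trans (Inv_mul_le 12 i j))

theorem mon_six_mem (d : ℕ) : mon [(6, d)] ∈ Inv 12 (d + 1) := mon_singleton_mem equivariant_six d

theorem mon_eight_mem (d : ℕ) : mon [(8, d)] ∈ Inv 12 (d + 1) := mon_singleton_mem equivariant_eight d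

theorem mon_append_mem_span_mul {l l' : List (ℕ × ℕ)} {j : ℕ} (h' : mon l' ∈ Inv 12 j) :
    mon (l ++ l') ∈ Submodule.span ℂ {mon l} * Inv 12 j := by
  have h1 : mon (l ++ l') = mon l * mon l' := by rw [mon, List.map_append, List.prod_append]; rfl
  rw [h1]
  exact Submodule.mul_mem_mul (Submodule.mem_span_singleton_self _) h'

theorem finrank_low_sup_Inv_four_mul_le {d m : ℕ} (hd : 3 ≤ d) {ps : List (List ℤ)}
    {ms : List (List (ℕ × ℕ))} (hps : ps ⊆ zeros) (hi : indep ps ms = true) (hl : ms.length = m)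
    (hm : ∀ l ∈ ms, mon l ∈ Submodule.span ℂ {mon [(6, 3)]} * Inv 12 d) :
    finrank ℂ (low (4 + (d + 4)) ⊔ Inv 12 4 * Inv 12 (d + 4) : Submodule ℂ (Poly 12)) +
        (2 * finrank ℂ (low (d + 4)) + m) ≤ finrank ℂ (low (4 + (d + 4))) + 2 * h 12 (d + 4) := by
  have h1 := finrank_sup_Inv_four_mul_le (mon_six_mem 3) (mon_eight_mem 3) (by
    refine Inv_twelve_four.trans (le_of_eq ?_)
    congr 2
    ext x
    simp [eq_comm]) hd
  have h2 := le_finrank_low_sup (d := d + 4) hps hi hl hm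
  omega

theorem four_le_finrank : 13 ≤ finrank ℂ (low 8 ⊔ Inv 12 4 * Inv 12 4 : Submodule ℂ (Poly 12)) := by
  have h1 := le_finrank_low_sup (d := 8) (List.take_subset _ _) indep_eight rfl
    (V := Inv 12 4 * Inv 12 4) (by
      simpa using ⟨mon_mem_mul (mon_six_mem 3) (mon_six_mem 3),
        mon_mem_mul (mon_six_mem 3) (mon_eight_mem 3), mon_mem_mul (mon_eight_mem 3) (mon_eight_mem 3)⟩)
  rw [finrank_low_twelve 3 (by norm_num)] at h1
  exact h1

theorem finrank_dec_nine : finrank ℂ (dec 12 9) ≤ 19 := by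
  obtain ⟨G, hG⟩ := exists_isLowCompl_four
  obtain ⟨G', hG'⟩ := exists_isLowCompl_five
  refine finrank_dec_le_of_le (U := low 9 ⊔ Inv 12 4 * Inv 12 5)
    (dec_twelve_le le_sup_left fun i h1 h2 => ?_) ?_
  · obtain rfl : i = 4 := by omega
    exact le_sup_right
  · have h1 := finrank_sup_Inv_mul_le' (U := low 9) (by norm_num) (by norm_num) hG hG' le_rfl
    rw [finrank_low_twelve 4 (by norm_num)] at h1
    exact h1

theorem finrank_dec_ten : finrank ℂ (dec 12 10) ≤ 38 := by
  obtain ⟨G, hG⟩ := exists_isLowCompl_four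
  obtain ⟨G', hG'⟩ := exists_isLowCompl_five
  refine finrank_dec_le_of_le (U := low 10 ⊔ Inv 12 4 * Inv 12 6 ⊔ Inv 12 5 * Inv 12 5)
    (dec_twelve_le (le_sup_left.trans le_sup_left) fun i h1 h2 => ?_) ?_
  · have : i = 4 ∨ i = 5 := by omega
    rcases this with rfl | rfl
    · exact le_sup_right.trans le_sup_left
    · exact le_sup_right
  · have h1 := finrank_sup_Inv_mul_le (U := low 10) (j := 6) (V := ⊥) (by norm_num) (by norm_num) hG
      le_rfl bot_le (by simp)
    have h2 := finrank_sup_Inv_mul_self_le (U := low 10 ⊔ Inv 12 4 * Inv 12 6) (by norm_num) hG'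
      le_sup_left
    rw [sup_bot_eq, finrank_low_twelve 1 (by norm_num), finrank_low_twelve 5 (by norm_num),
      h_twelve 6 (by norm_num)] at h1
    simp at h1 h2
    omega

theorem finrank_dec_eleven : finrank ℂ (dec 12 11) ≤ 58 := by
  obtain ⟨G, hG⟩ := exists_isLowCompl_four
  obtain ⟨G', hG'⟩ := exists_isLowCompl_five
  refine finrank_dec_le_of_le (U := low 11 ⊔ Inv 12 4 * Inv 12 7 ⊔ Inv 12 5 * Inv 12 6)
    (dec_twelve_le (le_sup_left.trans le_sup_left) fun i h1 h2 => ?_) ?_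
  · have : i = 4 ∨ i = 5 := by omega
    rcases this with rfl | rfl
    · exact le_sup_right.trans le_sup_left
    · exact le_sup_right
  · have h1 := finrank_sup_Inv_mul_le (U := low 11) (j := 7) (V := ⊥) (by norm_num) (by norm_num) hG
      le_rfl bot_le (by simp)
    have h2 := finrank_sup_Inv_mul_le (U := low 11 ⊔ Inv 12 4 * Inv 12 7) (j := 6) (V := ⊥)
      (by norm_num) (by norm_num) hG' le_sup_left bot_le (by simp)
    rw [sup_bot_eq, finrank_low_twelve 2 (by norm_num), finrank_low_twelve 6 (by norm_num),
      h_twelve 7 (by norm_num)] at h1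
    rw [sup_bot_eq, finrank_low_twelve 1 (by norm_num), h_twelve 6 (by norm_num)] at h2
    simp at h1 h2
    omega

theorem finrank_dec_twelve : finrank ℂ (dec 12 12) ≤ 108 := by
  obtain ⟨G, hG⟩ := exists_isLowCompl_five
  obtain ⟨G', hG'⟩ := exists_isLowCompl_six
  refine finrank_dec_le_of_le
    (U := low 12 ⊔ Inv 12 4 * Inv 12 8 ⊔ Inv 12 5 * Inv 12 7 ⊔ Inv 12 6 * Inv 12 6)
    (dec_twelve_le ((le_sup_left.trans le_sup_left).trans le_sup_left)
      fun i h1 h2 => ?_) ?_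
  · have : i = 4 ∨ i = 5 ∨ i = 6 := by omega
    rcases this with rfl | rfl | rfl
    · exact (le_sup_right.trans le_sup_left).trans le_sup_left
    · exact le_sup_right.trans le_sup_left
    · exact le_sup_right
  · have h1 := finrank_low_sup_Inv_four_mul_le (d := 4) (by norm_num) (List.take_subset _ _)
      indep_four_four rfl (by
        simpa using ⟨mon_append_mem_span_mul (mon_six_mem 3), mon_append_mem_span_mul (mon_eight_mem 3)⟩)
    have h2 := finrank_sup_Inv_mul_le (U := low 12 ⊔ Inv 12 4 * Inv 12 8) (j := 7) (V := ⊥)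
      (by norm_num) (by norm_num) hG le_sup_left bot_le (by simp)
    have h3 := finrank_sup_Inv_mul_self_le
      (U := low 12 ⊔ Inv 12 4 * Inv 12 8 ⊔ Inv 12 5 * Inv 12 7) (by norm_num) hG'
      (le_sup_left.trans le_sup_left)
    rw [finrank_low_twelve 3 (by norm_num), finrank_low_twelve 7 (by norm_num),
      h_twelve 8 (by norm_num)] at h1
    rw [sup_bot_eq, finrank_low_twelve 2 (by norm_num), h_twelve 7 (by norm_num)] at h2
    simp at h1 h2 h3
    omega

theorem finrank_dec_thirteen : finrank ℂ (dec 12 13) ≤ 163 := by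
  obtain ⟨G, hG⟩ := exists_isLowCompl_five
  obtain ⟨G', hG'⟩ := exists_isLowCompl_six
  obtain ⟨G'', hG''⟩ := exists_isLowCompl_seven
  refine finrank_dec_le_of_le
    (U := low 13 ⊔ Inv 12 4 * Inv 12 9 ⊔ Inv 12 5 * Inv 12 8 ⊔ Inv 12 6 * Inv 12 7)
    (dec_twelve_le ((le_sup_left.trans le_sup_left).trans le_sup_left)
      fun i h1 h2 => ?_) ?_
  · have : i = 4 ∨ i = 5 ∨ i = 6 := by omega
    rcases this with rfl | rfl | rfl
    · exact (le_sup_right.trans le_sup_left).trans le_sup_left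
    · exact le_sup_right.trans le_sup_left
    · exact le_sup_right
  · have h1 := finrank_low_sup_Inv_four_mul_le (d := 5) (by norm_num) (List.take_subset _ _)
      indep_four_five rfl (by
        simpa using ⟨mon_append_mem_span_mul (mon_six_mem 4), mon_append_mem_span_mul (mon_eight_mem 4)⟩)
    have h2 := finrank_sup_Inv_mul_le (U := low 13 ⊔ Inv 12 4 * Inv 12 9) (j := 8)
      (V := Inv 12 4 * Inv 12 4) (by norm_num) (by norm_num) hG le_sup_left (Inv_mul_le 12 4 4)
      ((mul_Inv_four_mul_le hG.le).trans le_sup_right)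
    have h3 := finrank_sup_Inv_mul_le'
      (U := low 13 ⊔ Inv 12 4 * Inv 12 9 ⊔ Inv 12 5 * Inv 12 8) (by norm_num) (by norm_num) hG' hG''
      (le_sup_left.trans le_sup_left)
    have h4 := four_le_finrank
    rw [finrank_low_twelve 4 (by norm_num), finrank_low_twelve 8 (by norm_num),
      h_twelve 9 (by norm_num)] at h1
    rw [h_twelve 8 (by norm_num)] at h2
    simp at h1 h2 h3
    omega

theorem finrank_dec_fourteen : finrank ℂ (dec 12 14) ≤ 279 := by
  obtain ⟨G, hG⟩ := exists_isLowCompl_five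
  obtain ⟨G', hG'⟩ := exists_isLowCompl_six
  obtain ⟨G'', hG''⟩ := exists_isLowCompl_seven
  refine finrank_dec_le_of_le (U := low 14 ⊔ Inv 12 4 * Inv 12 10 ⊔ Inv 12 5 * Inv 12 9 ⊔
      Inv 12 6 * Inv 12 8 ⊔ Inv 12 7 * Inv 12 7)
    (dec_twelve_le (((le_sup_left.trans le_sup_left).trans le_sup_left).trans le_sup_left)
      fun i h1 h2 => ?_) ?_
  · have : i = 4 ∨ i = 5 ∨ i = 6 ∨ i = 7 := by omega
    rcases this with rfl | rfl | rfl | rfl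
    · exact ((le_sup_right.trans le_sup_left).trans le_sup_left).trans le_sup_left
    · exact (le_sup_right.trans le_sup_left).trans le_sup_left
    · exact le_sup_right.trans le_sup_left
    · exact le_sup_right
  · have h1 := finrank_low_sup_Inv_four_mul_le (d := 6) (by norm_num) (List.Subset.refl _)
      indep_four_six rfl (by
        simpa using ⟨mon_append_mem_span_mul (mon_six_mem 5), mon_append_mem_span_mul (mon_eight_mem 5),
          mon_append_mem_span_mul (mon_singleton_mem equivariant_ten 5),
          mon_append_mem_span_mul (mon_singleton_mem equivariant_twelve 5)⟩)
    have h2 := finrank_sup_Inv_mul_le (U := low 14 ⊔ Inv 12 4 * Inv 12 10) (j := 9)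
      (V := Inv 12 4 * Inv 12 5) (by norm_num) (by norm_num) hG le_sup_left (Inv_mul_le 12 4 5)
      ((mul_Inv_four_mul_le hG.le).trans le_sup_right)
    have h3 := finrank_sup_Inv_mul_le (U := low 14 ⊔ Inv 12 4 * Inv 12 10 ⊔ Inv 12 5 * Inv 12 9)
      (j := 8) (V := Inv 12 4 * Inv 12 4) (by norm_num) (by norm_num) hG'
      (le_sup_left.trans le_sup_left) (Inv_mul_le 12 4 4)
      ((mul_Inv_four_mul_le hG'.le).trans (le_sup_right.trans le_sup_left))
    have h4 := finrank_sup_Inv_mul_self_le (U := low 14 ⊔ Inv 12 4 * Inv 12 10 ⊔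
      Inv 12 5 * Inv 12 9 ⊔ Inv 12 6 * Inv 12 8) (by norm_num) hG''
      ((le_sup_left.trans le_sup_left).trans le_sup_left)
    have h5 := four_le_finrank
    have h6 := le_finrank_low_sup (d := 9) (List.Subset.refl _) indep_nine rfl
      (V := Inv 12 4 * Inv 12 5) (by
        simpa using ⟨mon_mem_mul (mon_six_mem 3) (mon_six_mem 4),
          mon_mem_mul (mon_six_mem 3) (mon_eight_mem 4),
          mon_mem_mul (mon_eight_mem 3) (mon_six_mem 4),
          mon_mem_mul (mon_eight_mem 3) (mon_eight_mem 4)⟩)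
    rw [finrank_low_twelve 5 (by norm_num), finrank_low_twelve 9 (by norm_num),
      h_twelve 10 (by norm_num)] at h1
    rw [h_twelve 9 (by norm_num)] at h2
    rw [h_twelve 8 (by norm_num)] at h3
    rw [finrank_low_twelve 4 (by norm_num)] at h6
    simp at h1 h2 h3 h4 h6
    omega

theorem aeval_eq_zero_of_weight {σ M : Type*} [AddCommMonoid M] {w : σ → M} {u : σ → ℂ}
    (hu : ∀ i, u i ≠ 0 → w i = 0) {p : MvPolynomial σ ℂ} {m : M} (hp : p.IsWeightedHomogeneous w m)
    (hm : m ≠ 0) : aeval u p = 0 := by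
  induction hp using IsWeightedHomogeneous.induction_on with
  | zero => exact map_zero _
  | add a b _ _ ha hb => rw [map_add, ha, hb, add_zero]
  | monomial d r hd =>
    rw [aeval_monomial]
    by_contra h0
    refine hm ?_
    rw [← hd, Finsupp.weight_apply, Finsupp.sum]
    refine Finset.sum_eq_zero fun i hi => ?_
    rw [hu i, smul_zero]
    intro h1
    refine h0 ?_
    rw [Finsupp.prod, Finset.prod_eq_zero hi, mul_zero]
    rw [h1, zero_pow (Finsupp.mem_support_iff.1 hi)]

/-- The grading of the coordinates by the residue of the index modulo `5`. -/
def residue (i : Fin 13) : ZMod 5 := (i : ℕ)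

theorem weighted_residue {d : ℕ} {p : Poly 12} (hp : p ∈ Inv 12 d) :
    p.IsWeightedHomogeneous residue (d : ZMod 5) := by
  intro m hm
  have h1 := (mem_Inv.1 hp).1 hm
  rw [weight_wt] at h1
  obtain ⟨h2, h3⟩ := Prod.ext_iff.1 h1
  have h4 := congrArg (Int.cast : ℤ → ZMod 5) h2
  have h5 := congrArg (Int.cast : ℤ → ZMod 5) h3
  simp only [Finsupp.sum] at h4 h5
  push_cast at h4 h5
  rw [Finsupp.weight_apply, Finsupp.sum]
  have h6 : (∑ i ∈ m.support, m i • residue i : ZMod 5) =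
      3 * ∑ i ∈ m.support, (m i : ZMod 5) * (2 * ((i : ℕ) : ZMod 5) - 12) +
      ∑ i ∈ m.support, (m i : ZMod 5) := by
    rw [Finset.mul_sum, ← Finset.sum_add_distrib]
    refine Finset.sum_congr rfl fun i _ => ?_
    rw [residue, nsmul_eq_mul]
    have : (35 : ZMod 5) = 0 := by decide
    have h' : (5 : ZMod 5) = 0 := by decide
    linear_combination (m i : ZMod 5) * this - (m i : ZMod 5) * ((i : ℕ) : ZMod 5) * h'
  rw [h6, h4, h5, mul_zero, zero_add]

/-- A point with support in the indices divisible by `5`. -/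
def base : List ℤ := [1, 0, 0, 0, 0, 66, 0, 0, 0, 0, -11]

/-- A tangent vector at `base`. -/
def tangent : List ℤ := [0, 1, 0, 0, 0, 0, -22]

theorem ev_base_of_weighted {p : Poly 12} {k : ZMod 5} (hp : p.IsWeightedHomogeneous residue k)
    (hk : k ≠ 0) : ev (pt base) p = 0 := by
  refine aeval_eq_zero_of_weight (fun i hi => ?_) hp hk
  have : ∀ i : Fin 13, pt base i ≠ 0 → residue i = 0 := by decide
  exact this i fun h0 => hi (by rw [h0, Int.cast_zero])

theorem ev_base {d : ℕ} (hd : ¬ 5 ∣ d) {p : Poly 12} (hp : p ∈ Inv 12 d) : ev (pt base) p = 0 :=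
  ev_base_of_weighted (weighted_residue hp) fun h0 => hd ((ZMod.natCast_eq_zero_iff d 5).1 h0)

theorem ev_base_five {p : Poly 12} (hp : p ∈ Inv 12 5) : ev (pt base) p = 0 := by
  refine ev_eq_zero_of_sup (ev_eq_zero_of_sup
    (ev_eq_zero_of_mul fun x hx => ev_base (by norm_num) hx)
    (ev_eq_zero_of_mul fun x hx => ev_base (by norm_num) hx)) (ev_eq_zero_of_span ?_) _ (Inv_twelve_five hp)
  rintro _ ⟨l, hl, rfl⟩
  rw [ev_mon]
  have : ∀ l ∈ [[(6, 4)], [(8, 4)]], monZ base l = 0 := by decide +kernel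
  rw [this l hl, Int.cast_zero]

/-- The derivative at `base` along `tangent`. -/
def slope : Poly 12 →ₗ[ℂ] ℂ := (ev (pt base)).toLinearMap ∘ₗ (dir (pt tangent)).toLinearMap

theorem slope_apply (p : Poly 12) : slope p = ev (pt base) (dir (pt tangent) p) := rfl

theorem slope_mul (p q : Poly 12) :
    slope (p * q) = ev (pt base) p * slope q + ev (pt base) q * slope p := by
  rw [slope_apply, Derivation.leibniz, map_add, smul_eq_mul, smul_eq_mul, map_mul, map_mul,
    slope_apply, slope_apply]

theorem mul_le_ker_slope {M N : Submodule ℂ (Poly 12)} (hM : ∀ x ∈ M, ev (pt base) x = 0)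
    (hN : ∀ x ∈ N, ev (pt base) x = 0) : M * N ≤ slope.ker :=
  Submodule.mul_le.2 fun m hm n hn => by
    rw [LinearMap.mem_ker, slope_mul, hM m hm, hN n hn, zero_mul, zero_mul, add_zero]

theorem slope_six {p : Poly 12} (hp : p ∈ Inv 12 6) : slope p = 0 := by
  have h1 : low 6 ⊔ Submodule.span ℂ (mon '' {l | l ∈ [[(6, 5)], [(8, 5)], [(10, 5)], [(12, 5)]]}) ≤
      slope.ker := by
    refine sup_le (sup_le (mul_le_ker_slope ?_ ?_) (mul_le_ker_slope ?_ ?_)) (Submodule.span_le.2 ?_)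
    iterate 4 exact fun x hx => ev_base (by norm_num) hx
    have h2 : ∀ k ∈ [6, 8, 10, 12], trZ k 5 base tangent = 0 := by decide +kernel
    rintro _ ⟨l, hl, rfl⟩
    obtain ⟨k, hk, rfl⟩ : ∃ k ∈ [6, 8, 10, 12], [(k, 5)] = l := by simpa [eq_comm] using hl
    rw [SetLike.mem_coe, LinearMap.mem_ker, slope_apply, mon, List.map_singleton,
      List.prod_singleton, ev_dir_T_succ, h2 k hk, mul_zero, Int.cast_zero]
  exact h1 (Inv_twelve_six hp)

theorem finrank_dec_lt {d : ℕ} (φ : Poly 12 →ₗ[ℂ] ℂ)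
    (h0 : ∀ i, 1 ≤ i → i < d → ∀ x ∈ Inv 12 i, ∀ y ∈ Inv 12 (d - i), φ (x * y) = 0)
    {t : Poly 12} (ht : t ∈ Inv 12 d) (h1 : φ t ≠ 0) : finrank ℂ (dec 12 d) < h 12 d := by
  refine Submodule.finrank_lt_finrank_of_lt (lt_of_le_of_ne (dec_le 12 d) fun h2 => h1 ?_)
  have h3 : dec 12 d ≤ φ.ker := iSup₂_le fun i hi => Submodule.mul_le.2 fun x hx y hy =>
    h0 i (Finset.mem_Ico.1 hi).1 (Finset.mem_Ico.1 hi).2 x hx y hy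
  exact h3 (h2 ▸ ht)

theorem finrank_dec_fifteen : finrank ℂ (dec 12 15) < h 12 15 := by
  refine finrank_dec_lt (ev (pt base)).toLinearMap (fun i h1 h2 x hx y hy => ?_)
    (T_mem_Inv equivariant_fourteen 15) ?_
  · rw [AlgHom.toLinearMap_apply, map_mul]
    by_cases h3 : 5 ∣ i
    · have : i = 5 ∨ i = 10 := by omega
      rcases this with rfl | rfl
      · rw [ev_base_five hx, zero_mul]
      · rw [ev_base_five hy, mul_zero]
    · rw [ev_base h3 hx, zero_mul]
  · rw [AlgHom.toLinearMap_apply, ev_T_succ]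
    have : trZ 14 14 base base ≠ 0 := by decide +kernel
    exact_mod_cast this

theorem ev_base_mul_slope {i : ℕ} (h1 : 1 ≤ i) (h2 : i < 16) {x y : Poly 12} (hx : x ∈ Inv 12 i)
    (hy : y ∈ Inv 12 (16 - i)) : ev (pt base) x * slope y = 0 := by
  by_cases h3 : 5 ∣ i
  · have : i = 5 ∨ i = 10 ∨ i = 15 := by omega
    rcases this with rfl | rfl | rfl
    · rw [ev_base_five hx, zero_mul]
    · rw [slope_six hy, mul_zero]
    · rw [Inv_twelve_one] at hy
      rw [(Submodule.mem_bot ℂ).1 hy, map_zero, mul_zero]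
  · rw [ev_base h3 hx, zero_mul]

theorem finrank_dec_sixteen : finrank ℂ (dec 12 16) < h 12 16 := by
  refine finrank_dec_lt slope (fun i h1 h2 x hx y hy => ?_) (T_mem_Inv equivariant_sixteen 16) ?_
  · rw [slope_mul, ev_base_mul_slope h1 h2 hx hy, ev_base_mul_slope (by omega) (by omega) hy, add_zero]
    rwa [Nat.sub_sub_self h2.le]
  · rw [slope_apply, ev_dir_T_succ]
    have : ((15 : ℕ) + 1 : ℤ) * trZ 16 15 base tangent ≠ 0 := by decide +kernel
    exact_mod_cast this

theorem finrank_dec_twelve_le {d m : ℕ} (hd : d < 16)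
    (hm : crude (fun i => [1,0,1,1,3,3,8,10,20,28,52,73,127,181,291,418,639].getD i 0) d ≤ m) :
    finrank ℂ (dec 12 d) ≤ m :=
  (finrank_dec_le 12 d).trans ((crude_congr fun i hi => h_twelve i (by omega)).trans_le hm)

theorem le_card_of_twelve {S : Finset (Poly 12)}
    (hS : Algebra.adjoin ℂ (S : Set (Poly 12)) = invariants 12) : 12 + 99 ≤ S.card := by
  have h1 := sum_le_card hS (D := {2, 3, 4, 5, 6, 7, 8, 9, 10, 11, 12, 13, 14, 15, 16}) (by decide)
  have d2 := finrank_dec_twelve_le (d := 2) (m := 0) (by norm_num) (by decide +kernel)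
  have d3 := finrank_dec_twelve_le (d := 3) (m := 0) (by norm_num) (by decide +kernel)
  have d4 := finrank_dec_twelve_le (d := 4) (m := 1) (by norm_num) (by decide +kernel)
  have d5 := finrank_dec_twelve_le (d := 5) (m := 1) (by norm_num) (by decide +kernel)
  have d6 := finrank_dec_twelve_le (d := 6) (m := 4) (by norm_num) (by decide +kernel)
  have d7 := finrank_dec_seven
  have d8 := finrank_dec_eight
  have d9 := finrank_dec_nine
  have d10 := finrank_dec_ten
  have d11 := finrank_dec_eleven
  have d12 := finrank_dec_twelve
  have d13 := finrank_dec_thirteen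
  have d14 := finrank_dec_fourteen
  have d15 := finrank_dec_fifteen
  have d16 := finrank_dec_sixteen
  simp [h_twelve] at h1 d15 d16
  omega

theorem adjoin_image_toPoly {n : ℕ} {S : Finset (MvPolynomial (BinInv.Idx fun _ : Fin 1 => n) ℂ)}
    (hS : Algebra.adjoin ℂ (S : Set (MvPolynomial (BinInv.Idx fun _ : Fin 1 => n) ℂ)) =
      BinInv.invariantRing fun _ : Fin 1 => n) :
    Algebra.adjoin ℂ (toPoly n '' S) = invariants n := by
  have h1 := AlgHom.map_adjoin (toPoly n).toAlgHom
    (S : Set (MvPolynomial (BinInv.Idx fun _ : Fin 1 => n) ℂ))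
  rw [hS] at h1
  refine h1.symm.trans (SetLike.ext fun p => ?_)
  rw [Subalgebra.mem_map, mem_invariants]
  constructor
  · rintro ⟨P, hP, rfl⟩
    exact (mem_invariantRing_iff P).1 hP
  · intro hp
    refine ⟨(toPoly n).symm p, (mem_invariantRing_iff _).2 ?_, (toPoly n).apply_symm_apply p⟩
    rwa [AlgEquiv.apply_symm_apply]

theorem le_card {n : ℕ} (hn : 11 ≤ n) {S : Finset (Poly n)}
    (hS : Algebra.adjoin ℂ (S : Set (Poly n)) = invariants n) : n + 99 ≤ S.card := by
  rcases lt_or_ge n 16 with h1 | h1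
  · rcases eq_or_ne n 12 with rfl | h0
    · exact le_card_of_twelve hS
    · exact le_card_of_manyGens (by omega) (manyGens_of_le_fifteen n h1 hn h0) hS
  rcases lt_or_ge n 23 with h2 | h2
  · exact le_card_of_manyGens (by omega) (manyGens_of_le_twentyTwo n h2 h1) hS
  rcases lt_or_ge n 89 with h3 | h3
  · exact le_card_of_manyGens (by omega) (manyGens_of_le_eightyEight n h3 h2) hS
  · exact le_card_of_sixtySeven_le (by omega) hS

theorem le_of_isMinimalNumGens {n r : ℕ} (hn : 11 ≤ n)
    (hr : BinInv.IsMinimalNumGens (fun _ : Fin 1 => n) r) : n + 99 ≤ r := by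
  classical
  obtain ⟨S, rfl, hS⟩ := hr.1
  have h1 := le_card hn (S := S.image (toPoly n)) (by rw [Finset.coe_image, adjoin_image_toPoly hS])
  exact h1.trans Finset.card_image_le

end BinForm

end

open BinInv in
/-- If `R = O(V_n)^{SL(2,ℂ)}` with `n ≥ 3` has minimal number of generators `r`
with `r - (n - 2) ≤ 100` (i.e. `hd R ≤ 100`), then `n ≤ 10`. -/
theorem hd_le_hundred_single_form (n : ℕ) (hn : 3 ≤ n) (r : ℕ)
    (hr : IsMinimalNumGens (fun _ : Fin 1 => n) r)
    (hhd : (r : ℤ) - ((n : ℤ) - 2) ≤ 100) :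
    n ≤ 10 := by
  by_contra! h
  have := BinForm.le_of_isMinimalNumGens h hr
  omega
end

section
/- Let q and r be binary quadratic forms (elements of V_2). Then the resultant of q and r satisfies Res(q,r) = (q,r)_2^2 − (q,q)_2 · (r,r)_2, where (·,·)_2 denotes the second transvectant. -/
open MvPolynomial

open BinInv in
/-- The second transvectant of two binary quadratic forms is a constant. -/
theorem transvectant_quadratics (a b c d e f : ℂ) :
    transvectant 2 2 2
        (C a * X 0 ^ 2 + C b * (X 0 * X 1) + C c * X 1 ^ 2 : MvPolynomial (Fin 2) ℂ)
        (C d * X 0 ^ 2 + C e * (X 0 * X 1) + C f * X 1 ^ 2) =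
      C (a * f - b * e / 2 + c * d) := by
  have h01 : (0 : Fin 2) ≠ 1 := by decide
  have hC : (C (a * f - b * e / 2 + c * d) : MvPolynomial (Fin 2) ℂ) =
      C (1 / 4) * (4 * (C a * C f) - 2 * (C b * C e) + 4 * (C c * C d)) := by
    have h2 : (2 : MvPolynomial (Fin 2) ℂ) = C 2 := (map_ofNat C 2).symm
    have h4 : (4 : MvPolynomial (Fin 2) ℂ) = C 4 := (map_ofNat C 4).symm
    rw [h2, h4]
    simp only [← map_mul, ← map_add, ← map_sub]
    congr 1
    ring
  rw [hC, transvectant, MvPolynomial.algebraMap_eq]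
  congr 1
  · norm_num [Nat.factorial]
  · have hpd (i : Fin 2) : pderiv i (2 : MvPolynomial (Fin 2) ℂ) = 0 :=
      Derivation.map_natCast _ 2
    simp [pd, hpd, Finset.sum_range_succ, Derivation.leibniz, Derivation.leibniz_pow,
      pderiv_X_of_ne h01, pderiv_X_of_ne h01.symm]
    ring

open BinInv in
/-- For binary quadratic forms `q = a x² + b xy + c y²` and `r = d x² + e xy + f y²`,
`Res(q, r) = (q,r)₂² − (q,q)₂ (r,r)₂`. -/
theorem resultant_of_quadratics (a b c d e f : ℂ) :
    transvectant 2 2 2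
        (C a * X 0 ^ 2 + C b * (X 0 * X 1) + C c * X 1 ^ 2 : MvPolynomial (Fin 2) ℂ)
        (C d * X 0 ^ 2 + C e * (X 0 * X 1) + C f * X 1 ^ 2) ^ 2 -
      transvectant 2 2 2
        (C a * X 0 ^ 2 + C b * (X 0 * X 1) + C c * X 1 ^ 2)
        (C a * X 0 ^ 2 + C b * (X 0 * X 1) + C c * X 1 ^ 2) *
      transvectant 2 2 2
        (C d * X 0 ^ 2 + C e * (X 0 * X 1) + C f * X 1 ^ 2)
        (C d * X 0 ^ 2 + C e * (X 0 * X 1) + C f * X 1 ^ 2) =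
    C ((a * f - c * d) ^ 2 - (a * e - b * d) * (b * f - c * e)) := by
  simp only [transvectant_quadratics, ← map_pow, ← map_mul, ← map_sub]
  congr 1
  ring
end

section
/- There is a nonzero complex constant λ such that for all binary quadratic forms q_1 = a_1x² + 2b_1xy + c_1y², q_2 = a_2x² + 2b_2xy + c_2y², q_3 = a_3x² + 2b_3xy + c_3y², the invariant (q_1, (q_2,q_3)_1)_2 equals λ times the determinant of the 3×3 matrix with rows (a_1,b_1,c_1), (a_2,b_2,c_2), (a_3,b_3,c_3). Consequently, this invariant vanishes if and only if q_1, q_2, q_3 are linearly dependent. -/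
open MvPolynomial

namespace BinInv

/-- The binary quadratic form `v₀ x² + 2 v₁ xy + v₂ y²`, as a linear function of `v`. -/
noncomputable def quadraticForm : (Fin 3 → ℂ) →ₗ[ℂ] MvPolynomial (Fin 2) ℂ where
  toFun v := C (v 0) * X 0 ^ 2 + C (2 * v 1) * (X 0 * X 1) + C (v 2) * X 1 ^ 2
  map_add' v w := by simp only [Pi.add_apply, map_add, map_mul]; ring
  map_smul' r v := by
    simp only [Pi.smul_apply, smul_eq_mul, map_mul, smul_eq_C_mul, RingHom.id_apply]; ring

theorem quadraticForm_apply (v : Fin 3 → ℂ) :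
    quadraticForm v = C (v 0) * X 0 ^ 2 + C (2 * v 1) * (X 0 * X 1) + C (v 2) * X 1 ^ 2 := rfl

theorem ker_quadraticForm : LinearMap.ker quadraticForm = ⊥ := by
  refine LinearMap.ker_eq_bot'.2 fun v hv => ?_
  have h (x y : ℂ) : v 0 * x ^ 2 + 2 * v 1 * (x * y) + v 2 * y ^ 2 = 0 := by
    simpa [quadraticForm_apply] using congrArg (eval ![x, y]) hv
  have h₀ : v 0 = 0 := by simpa using h 1 0
  have h₂ : v 2 = 0 := by simpa using h 0 1
  have h₁ : v 1 = 0 := by simpa [h₀, h₂] using h 1 1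
  ext i
  fin_cases i <;> assumption

theorem linearIndependent_quadraticForm_iff (M : Matrix (Fin 3) (Fin 3) ℂ) :
    LinearIndependent ℂ (fun i => quadraticForm (M i)) ↔ M.det ≠ 0 := by
  rw [← isUnit_iff_ne_zero, ← Matrix.isUnit_iff_isUnit_det,
    ← Matrix.linearIndependent_rows_iff_isUnit]
  exact quadraticForm.linearIndependent_iff ker_quadraticForm

theorem transvectant_one_quadraticForm (v w : Fin 3 → ℂ) :
    transvectant 2 2 1 (quadraticForm v) (quadraticForm w) =
      quadraticForm ![v 0 * w 1 - v 1 * w 0, (v 0 * w 2 - v 2 * w 0) / 2,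
        v 1 * w 2 - v 2 * w 1] := by
  have h : (C (1 / 4 : ℂ) : MvPolynomial (Fin 2) ℂ) * 4 = 1 := by
    rw [← map_ofNat C 4, ← C_mul]; norm_num
  have hC : (C (2 : ℂ) : MvPolynomial (Fin 2) ℂ) = 2 := map_ofNat C 2
  have h₂ : (2 : ℂ) * ((v 0 * w 2 - v 2 * w 0) / 2) = v 0 * w 2 - v 2 * w 0 := by ring
  simp [transvectant, pd, quadraticForm_apply, Finset.sum_range_succ, algebraMap_eq, pderiv_X,
    -map_inv₀, h₂]
  norm_num [-map_inv₀]
  simp only [hC]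
  linear_combination ((C (v 0) * C (w 1) - C (v 1) * C (w 0)) * X 0 ^ 2 +
    (C (v 0) * C (w 2) - C (v 2) * C (w 0)) * (X 0 * X 1) +
    (C (v 1) * C (w 2) - C (v 2) * C (w 1)) * X 1 ^ 2) * h

theorem transvectant_two_quadraticForm (v w : Fin 3 → ℂ) :
    transvectant 2 2 2 (quadraticForm v) (quadraticForm w) =
      C (v 0 * w 2 - 2 * (v 1 * w 1) + v 2 * w 0) := by
  have h : (C (1 / 4 : ℂ) : MvPolynomial (Fin 2) ℂ) * 4 = 1 := by
    rw [← map_ofNat C 4, ← C_mul]; norm_num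
  have hC : (C (2 : ℂ) : MvPolynomial (Fin 2) ℂ) = 2 := map_ofNat C 2
  have hd (i : Fin 2) : pderiv i (2 : MvPolynomial (Fin 2) ℂ) = 0 := by rw [← hC, pderiv_C]
  simp [transvectant, pd, quadraticForm_apply, Finset.sum_range_succ, algebraMap_eq, pderiv_X,
    -map_inv₀, hd]
  norm_num [-map_inv₀]
  simp only [hC]
  linear_combination (C (v 0) * C (w 2) - 2 * (C (v 1) * C (w 1)) + C (v 2) * C (w 0)) * h

theorem transvectant_quadraticForm_eq_det (M : Matrix (Fin 3) (Fin 3) ℂ) :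
    transvectant 2 2 2 (quadraticForm (M 0))
      (transvectant 2 2 1 (quadraticForm (M 1)) (quadraticForm (M 2))) = C M.det := by
  rw [transvectant_one_quadraticForm, transvectant_two_quadraticForm, Matrix.det_fin_three]
  congr 1
  simp
  ring

end BinInv

open BinInv in
/-- There is a nonzero constant `λ` such that for quadratic forms
`qᵢ = aᵢ x² + 2bᵢ xy + cᵢ y²`, the invariant `(q₁, (q₂,q₃)₁)₂` equals `λ` times the
determinant of the coefficient matrix; consequently it vanishes iff `q₁, q₂, q₃`
are linearly dependent. -/
theorem transvectant_det_three_quadratics :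
    ∃ lam : ℂ, lam ≠ 0 ∧
      ∀ a₁ b₁ c₁ a₂ b₂ c₂ a₃ b₃ c₃ : ℂ,
        (transvectant 2 2 2
            (C a₁ * X 0 ^ 2 + C (2 * b₁) * (X 0 * X 1) + C c₁ * X 1 ^ 2 :
              MvPolynomial (Fin 2) ℂ)
            (transvectant 2 2 1
              (C a₂ * X 0 ^ 2 + C (2 * b₂) * (X 0 * X 1) + C c₂ * X 1 ^ 2)
              (C a₃ * X 0 ^ 2 + C (2 * b₃) * (X 0 * X 1) + C c₃ * X 1 ^ 2)) =
          C (lam * Matrix.det !![a₁, b₁, c₁; a₂, b₂, c₂; a₃, b₃, c₃])) ∧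
        (transvectant 2 2 2
            (C a₁ * X 0 ^ 2 + C (2 * b₁) * (X 0 * X 1) + C c₁ * X 1 ^ 2 :
              MvPolynomial (Fin 2) ℂ)
            (transvectant 2 2 1
              (C a₂ * X 0 ^ 2 + C (2 * b₂) * (X 0 * X 1) + C c₂ * X 1 ^ 2)
              (C a₃ * X 0 ^ 2 + C (2 * b₃) * (X 0 * X 1) + C c₃ * X 1 ^ 2)) = 0 ↔
          ¬ LinearIndependent ℂ
            ![(C a₁ * X 0 ^ 2 + C (2 * b₁) * (X 0 * X 1) + C c₁ * X 1 ^ 2 :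
                MvPolynomial (Fin 2) ℂ),
              C a₂ * X 0 ^ 2 + C (2 * b₂) * (X 0 * X 1) + C c₂ * X 1 ^ 2,
              C a₃ * X 0 ^ 2 + C (2 * b₃) * (X 0 * X 1) + C c₃ * X 1 ^ 2]) := by
  refine ⟨1, one_ne_zero, fun a₁ b₁ c₁ a₂ b₂ c₂ a₃ b₃ c₃ => ?_⟩
  have hdet := transvectant_quadraticForm_eq_det !![a₁, b₁, c₁; a₂, b₂, c₂; a₃, b₃, c₃]
  have hli := linearIndependent_quadraticForm_iff !![a₁, b₁, c₁; a₂, b₂, c₂; a₃, b₃, c₃]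
  rw [one_mul]
  refine ⟨hdet, ?_⟩
  have hvec : (fun i => quadraticForm (!![a₁, b₁, c₁; a₂, b₂, c₂; a₃, b₃, c₃] i)) =
      ![quadraticForm ![a₁, b₁, c₁], quadraticForm ![a₂, b₂, c₂],
        quadraticForm ![a₃, b₃, c₃]] := by
    ext1 i
    fin_cases i <;> rfl
  rw [hvec] at hli
  refine (Eq.congr_left hdet).trans (Iff.trans ?_ (not_congr hli).symm)
  rw [C_eq_zero, not_not]
end
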